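/- arXiv:2301.00708 — 2 statements merged into one kernel-verified Lean document; each statement's English description precedes it below -/
import Mathlib

section
/- Let R be a ring and S a class of finitely presented right R-modules containing the free module R and closed under extensions and kernels of epimorphisms. Put B = S^{⊥₁}, A = ^{⊥₁}B, and C = lim→ S. Then for any short exact sequence of right R-modules 0 → M → L → M → 0 with L ∈ A and M ∈ C, one has M ∈ A; in other words, any A-periodic module belonging to C actually belongs to A. -/
open CategoryTheory CategoryTheory.Limits

universe w v u

namespace GenPeriodicity

variable {K : Type u} [Category.{v} K]

section AbelianDefs

variable [Abelian K]

/-- `Ext¹(X, Y) = 0`, expressed by the splitting of all short exact sequences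
`0 → Y → E → X → 0`. -/
def Ext1Zero (X Y : K) : Prop :=
  ∀ (E : K) (i : Y ⟶ E) (p : E ⟶ X) (w : i ≫ p = 0),
    (ShortComplex.mk i p w).ShortExact → ∃ s : X ⟶ E, s ≫ p = 𝟙 X

/-- The right `Ext¹`-orthogonal class `S^{⊥₁}`. -/
def rightPerp (S : Set K) : Set K := {B | ∀ X ∈ S, Ext1Zero X B}

/-- The left `Ext¹`-orthogonal class `^{⊥₁}B`. -/
def leftPerp (B : Set K) : Set K := {A | ∀ Y ∈ B, Ext1Zero A Y}

/-- A class of objects is closed under extensions. -/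
def ClosedUnderExtensions (C : Set K) : Prop :=
  ∀ (X : ShortComplex K), X.ShortExact → X.X₁ ∈ C → X.X₃ ∈ C → X.X₂ ∈ C

/-- A class of objects is closed under kernels of epimorphisms. -/
def ClosedUnderKernelsOfEpis (C : Set K) : Prop :=
  ∀ (X : ShortComplex K), X.ShortExact → X.X₂ ∈ C → X.X₃ ∈ C → X.X₁ ∈ C

/-- A class of objects is closed under direct summands (retracts). -/
def ClosedUnderDirectSummands (C : Set K) : Prop :=
  ∀ X ∈ C, ∀ (Y : K) (s : Y ⟶ X) (r : X ⟶ Y), s ≫ r = 𝟙 Y → Y ∈ C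

/-- A (doubly unbounded) complex is acyclic if it is exact at every term. -/
def IsAcyclic (X : CochainComplex K ℤ) : Prop := ∀ n : ℤ, X.ExactAt n

end AbelianDefs

/-- Data exhibiting `M` as a direct limit (over a directed poset) of objects from `S`. -/
structure DirectSystemTo (S : Set K) (M : K) where
  I : Type v
  [po : PartialOrder I]
  dir : IsDirected I (· ≤ ·)
  ne : Nonempty I
  F : I ⥤ K
  mem : ∀ i, F.obj i ∈ S
  c : Cocone F
  hc : IsColimit c
  iso : c.pt ≅ M

/-- `lim→ S`: the class of all direct limits of direct systems of objects of `S`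
indexed by directed posets. -/
def limClosure (S : Set K) : Set K := {M | Nonempty (DirectSystemTo S M)}

/-- A class of objects is closed under direct limits (indexed by directed posets). -/
def ClosedUnderDirectLimits (C : Set K) : Prop :=
  ∀ (I : Type v) [PartialOrder I], IsDirected I (· ≤ ·) → Nonempty I →
    ∀ (F : I ⥤ K), (∀ i, F.obj i ∈ C) → ∀ (c : Cocone F), IsColimit c → c.pt ∈ C

/-- A class of objects is closed under (set-indexed) coproducts. -/
def ClosedUnderCoproducts (C : Set K) : Prop :=
  ∀ (B : Type v) (X : B → K), (∀ b, X b ∈ C) → ∀ (c : Cofan X), IsColimit c → c.pt ∈ C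

section Modules

variable {Λ : Type u} [Ring Λ]

/-- A linear map killing the kernel of a surjection factors through it. -/
theorem exists_factor {X Y Z : Type*} [AddCommGroup X] [Module Λ X] [AddCommGroup Y] [Module Λ Y]
    [AddCommGroup Z] [Module Λ Z] (σ : X →ₗ[Λ] Y) (hσ : Function.Surjective σ) (a : X →ₗ[Λ] Z)
    (h : ∀ x, σ x = 0 → a x = 0) : ∃ b : Y →ₗ[Λ] Z, ∀ x, b (σ x) = a x := by
  refine ⟨(LinearMap.ker σ).liftQ a
      (fun x hx => LinearMap.mem_ker.2 (h x (LinearMap.mem_ker.1 hx))) ∘ₗ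
    (σ.quotKerEquivOfSurjective hσ).symm.toLinearMap, fun x => ?_⟩
  have : (σ.quotKerEquivOfSurjective hσ).symm (σ x) = (LinearMap.ker σ).mkQ x := by
    rw [LinearEquiv.symm_apply_eq]; rfl
  rw [LinearMap.comp_apply, LinearEquiv.coe_coe, this, Submodule.mkQ_apply, Submodule.liftQ_apply]

/-- A linear map with values in the kernel of a surjection factors through an injection onto
that kernel. -/
theorem exists_cofactor {X Y Z W : Type*} [AddCommGroup X] [Module Λ X] [AddCommGroup Y]
    [Module Λ Y] [AddCommGroup Z] [Module Λ Z] [AddCommGroup W] [Module Λ W]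
    (j : X →ₗ[Λ] Y) (hj : Function.Injective j) (g : Y →ₗ[Λ] Z) (he : Function.Exact j g)
    (a : W →ₗ[Λ] Y) (h : ∀ w, g (a w) = 0) : ∃ b : W →ₗ[Λ] X, ∀ w, j (b w) = a w := by
  refine ⟨(LinearEquiv.ofInjective j hj).symm.toLinearMap ∘ₗ
    a.codRestrict (LinearMap.range j) (fun w => (he _).1 (h w)), fun w => ?_⟩
  have := (LinearEquiv.ofInjective j hj).apply_symm_apply
    (a.codRestrict (LinearMap.range j) (fun w => (he _).1 (h w)) w)
  exact congrArg Subtype.val this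

/-- Pushouts of injections, together with the induced exact sequence. -/
theorem exists_pushout {A A' B C : Type u} [AddCommGroup A] [Module Λ A] [AddCommGroup A']
    [Module Λ A'] [AddCommGroup B] [Module Λ B] [AddCommGroup C] [Module Λ C]
    (j : A →ₗ[Λ] A') (hj : Function.Injective j) (ρ : A' →ₗ[Λ] C) (hρ : Function.Surjective ρ)
    (he : Function.Exact j ρ) (h : A →ₗ[Λ] B) :
    ∃ (E : ModuleCat.{u} Λ) (i : B →ₗ[Λ] E) (a : A' →ₗ[Λ] E) (p : E →ₗ[Λ] C),
      Function.Injective i ∧ Function.Surjective p ∧ Function.Exact i p ∧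
      (∀ x, a (j x) = i (h x)) ∧ (∀ x, p (a x) = ρ x) ∧
      ∀ (Y : Type u) [AddCommGroup Y] [Module Λ Y] (u : B →ₗ[Λ] Y) (v : A' →ₗ[Λ] Y),
        (∀ x, u (h x) = v (j x)) →
        ∃ w : E →ₗ[Λ] Y, (∀ x, w (i x) = u x) ∧ ∀ x, w (a x) = v x := by
  let N : Submodule Λ (B × A') := LinearMap.range (h.prod (-j))
  have hN : ∀ z : B × A', z ∈ N ↔ ∃ x, h x = z.1 ∧ - j x = z.2 := by
    intro z
    constructor
    · rintro ⟨x, rfl⟩; exact ⟨x, rfl, rfl⟩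
    · rintro ⟨x, h1, h2⟩; exact ⟨x, Prod.ext h1 h2⟩
  have hsurj : Function.Surjective N.mkQ := N.mkQ_surjective
  have hρj : ∀ x, ρ (j x) = 0 := fun x => (he _).2 ⟨x, rfl⟩
  obtain ⟨p, hp⟩ := exists_factor N.mkQ hsurj (ρ ∘ₗ LinearMap.snd Λ B A') (by
    intro z hz
    obtain ⟨x, -, h2⟩ := (hN z).1 (by simpa using hz)
    simp [← h2, hρj])
  refine ⟨ModuleCat.of Λ ((B × A') ⧸ N), N.mkQ ∘ₗ LinearMap.inl Λ B A',
    N.mkQ ∘ₗ LinearMap.inr Λ B A', p, ?_, ?_, ?_, ?_, ?_, ?_⟩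
  · rw [injective_iff_map_eq_zero]
    intro b hb
    obtain ⟨x, h1, h2⟩ := (hN (b, 0)).1 (by simpa using hb)
    have : x = 0 := hj (by simpa using h2)
    simpa [this] using h1.symm
  · intro c
    obtain ⟨a, rfl⟩ := hρ c
    exact ⟨N.mkQ (0, a), (hp _).trans (by simp)⟩
  · intro z
    obtain ⟨⟨b, a⟩, rfl⟩ := hsurj z
    constructor
    · intro hz
      rw [hp] at hz
      obtain ⟨x, rfl⟩ := (he a).1 (by simpa using hz)
      refine ⟨b + h x, ?_⟩
      rw [LinearMap.comp_apply, ← sub_eq_zero, ← map_sub, ← LinearMap.mem_ker, Submodule.ker_mkQ,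
        hN]
      exact ⟨x, by simp, by simp⟩
    · rintro ⟨b', hb'⟩
      rw [← hb', LinearMap.comp_apply, hp]
      simp
  · intro x
    rw [← sub_eq_zero]
    simp only [LinearMap.comp_apply]
    rw [← map_sub, ← LinearMap.mem_ker, Submodule.ker_mkQ, hN]
    exact ⟨-x, by simp, by simp⟩
  · exact fun x => (hp _).trans (by simp)
  · intro Y _ _ u v huv
    obtain ⟨w, hw⟩ := exists_factor N.mkQ hsurj (u.coprod v) (by
      intro z hz
      obtain ⟨x, h1, h2⟩ := (hN z).1 (by simpa using hz)
      simp [← h1, ← h2, huv])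
    exact ⟨w, fun x => (hw _).trans (by simp), fun x => (hw _).trans (by simp)⟩

/-- A class of finitely presented modules containing the free module of rank one, closed under
extensions and kernels of epimorphisms. -/
structure IsResolvingFP (S : Set (ModuleCat.{u} Λ)) : Prop where
  fp : ∀ M ∈ S, Module.FinitePresentation Λ M
  free : ModuleCat.of Λ Λ ∈ S
  ext : ClosedUnderExtensions S
  ker : ClosedUnderKernelsOfEpis S

variable {S : Set (ModuleCat.{u} Λ)}

theorem shortExact_of {X Y Z : Type u} [AddCommGroup X] [Module Λ X] [AddCommGroup Y]
    [Module Λ Y] [AddCommGroup Z] [Module Λ Z] (f : X →ₗ[Λ] Y) (g : Y →ₗ[Λ] Z)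
    (hf : Function.Injective f) (hg : Function.Surjective g) (he : Function.Exact f g) :
    ∃ w : ModuleCat.ofHom f ≫ ModuleCat.ofHom g = 0,
      (ShortComplex.mk (ModuleCat.ofHom f) (ModuleCat.ofHom g) w).ShortExact := by
  refine ⟨by ext x; exact (he _).2 ⟨x, rfl⟩, ?_⟩
  exact {
    exact := (ShortComplex.ShortExact.moduleCat_exact_iff_function_exact _).2 he
    mono_f := (ModuleCat.mono_iff_injective _).2 hf
    epi_g := (ModuleCat.epi_iff_surjective _).2 hg }

namespace IsResolvingFP

variable (hS : IsResolvingFP S)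
include hS

theorem ext_mem {X Y Z : Type u} [AddCommGroup X] [Module Λ X] [AddCommGroup Y]
    [Module Λ Y] [AddCommGroup Z] [Module Λ Z] (f : X →ₗ[Λ] Y) (g : Y →ₗ[Λ] Z)
    (hf : Function.Injective f) (hg : Function.Surjective g) (he : Function.Exact f g)
    (hX : ModuleCat.of Λ X ∈ S) (hZ : ModuleCat.of Λ Z ∈ S) : ModuleCat.of Λ Y ∈ S := by
  obtain ⟨w, hw⟩ := shortExact_of f g hf hg he
  exact hS.ext _ hw hX hZ

theorem ker_mem {X Y Z : Type u} [AddCommGroup X] [Module Λ X] [AddCommGroup Y]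
    [Module Λ Y] [AddCommGroup Z] [Module Λ Z] (f : X →ₗ[Λ] Y) (g : Y →ₗ[Λ] Z)
    (hf : Function.Injective f) (hg : Function.Surjective g) (he : Function.Exact f g)
    (hY : ModuleCat.of Λ Y ∈ S) (hZ : ModuleCat.of Λ Z ∈ S) : ModuleCat.of Λ X ∈ S := by
  obtain ⟨w, hw⟩ := shortExact_of f g hf hg he
  exact hS.ker _ hw hY hZ

theorem zero_mem : ModuleCat.of Λ PUnit.{u + 1} ∈ S :=
  hS.ker_mem (0 : PUnit.{u + 1} →ₗ[Λ] Λ) LinearMap.id (fun _ _ _ => rfl)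
    Function.surjective_id (by
      intro x
      simp only [LinearMap.id_coe, id_eq, LinearMap.zero_apply, Set.mem_range, exists_const]
      exact eq_comm) hS.free hS.free

theorem mem_of_equiv {X Y : Type u} [AddCommGroup X] [Module Λ X] [AddCommGroup Y]
    [Module Λ Y] (e : X ≃ₗ[Λ] Y) (hX : ModuleCat.of Λ X ∈ S) : ModuleCat.of Λ Y ∈ S :=
  hS.ext_mem e.toLinearMap (0 : Y →ₗ[Λ] PUnit.{u + 1}) e.injective (fun _ => ⟨0, rfl⟩)
    (fun y => ⟨fun _ => e.surjective y, fun _ => rfl⟩) hX hS.zero_mem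

theorem mem_of_subsingleton {X : Type u} [AddCommGroup X] [Module Λ X] [Subsingleton X] :
    ModuleCat.of Λ X ∈ S :=
  hS.mem_of_equiv (⟨0, 0, fun _ => rfl, fun _ => Subsingleton.elim _ _⟩ :
    PUnit.{u + 1} ≃ₗ[Λ] X) hS.zero_mem

theorem prod_mem {X Y : Type u} [AddCommGroup X] [Module Λ X] [AddCommGroup Y]
    [Module Λ Y] (hX : ModuleCat.of Λ X ∈ S) (hY : ModuleCat.of Λ Y ∈ S) :
    ModuleCat.of Λ (X × Y) ∈ S :=
  hS.ext_mem (LinearMap.inl Λ X Y) (LinearMap.snd Λ X Y) LinearMap.inl_injective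
    LinearMap.snd_surjective (Function.Exact.inl_snd) hX hY

theorem pi_mem (k : ℕ) : ModuleCat.of Λ (Fin k → Λ) ∈ S := by
  induction k with
  | zero => exact hS.mem_of_subsingleton
  | succ k ih =>
    exact hS.mem_of_equiv (Fin.consLinearEquiv Λ (fun _ : Fin (k + 1) => Λ))
      (hS.prod_mem hS.free ih)

theorem exists_presentation {X : Type u} [AddCommGroup X] [Module Λ X]
    (hX : ModuleCat.of Λ X ∈ S) : ∃ (k : ℕ) (σ : (Fin k → Λ) →ₗ[Λ] X),
      Function.Surjective σ ∧ ModuleCat.of Λ (LinearMap.ker σ) ∈ S ∧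
      ModuleCat.of Λ ((Fin k → Λ) ⧸ LinearMap.ker σ) ∈ S := by
  have : Module.FinitePresentation Λ X := hS.fp _ hX
  obtain ⟨k, σ, hσ⟩ := Module.Finite.exists_fin' Λ X
  exact ⟨k, σ, hσ, hS.ker_mem (LinearMap.ker σ).subtype σ Subtype.val_injective hσ
    (LinearMap.exact_subtype_ker_map σ) (hS.pi_mem k) hX,
    hS.mem_of_equiv (σ.quotKerEquivOfSurjective hσ).symm hX⟩

end IsResolvingFP

/-- `Ext¹(P, X) = 0` for all `P ∈ S`, in terms of extending maps along the inclusions of first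
syzygies. -/
def ExtInjective (S : Set (ModuleCat.{u} Λ)) (X : Type u) [AddCommGroup X] [Module Λ X] : Prop :=
  ∀ (k : ℕ) (Ω : Submodule Λ (Fin k → Λ)), ModuleCat.of Λ ((Fin k → Λ) ⧸ Ω) ∈ S →
    ∀ f : Ω →ₗ[Λ] X, ∃ g : (Fin k → Λ) →ₗ[Λ] X, ∀ x : Ω, g x = f x

namespace ExtInjective

variable (hS : IsResolvingFP S)

theorem of_equiv {X Y : Type u} [AddCommGroup X] [Module Λ X] [AddCommGroup Y] [Module Λ Y]
    (e : X ≃ₗ[Λ] Y) (hX : ExtInjective S X) : ExtInjective S Y := by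
  intro k Ω hΩ f
  obtain ⟨g, hg⟩ := hX k Ω hΩ (e.symm.toLinearMap ∘ₗ f)
  exact ⟨e.toLinearMap ∘ₗ g, fun x => by simp [hg]⟩

include hS

theorem exists_lift {K E Z P : Type u} [AddCommGroup K] [Module Λ K] [AddCommGroup E]
    [Module Λ E] [AddCommGroup Z] [Module Λ Z] [AddCommGroup P] [Module Λ P]
    (hK : ExtInjective S K) (ι : K →ₗ[Λ] E) (q : E →ₗ[Λ] Z) (hι : Function.Injective ι)
    (hq : Function.Surjective q) (he : Function.Exact ι q) (hP : ModuleCat.of Λ P ∈ S)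
    (h : P →ₗ[Λ] Z) : ∃ h' : P →ₗ[Λ] E, ∀ x, q (h' x) = h x := by
  obtain ⟨k, σ, hσ, -, hk⟩ := hS.exists_presentation hP
  obtain ⟨a, ha⟩ := Module.projective_lifting_property q (h ∘ₗ σ) hq
  have ha : ∀ x, q (a x) = h (σ x) := fun x => LinearMap.congr_fun ha x
  obtain ⟨b, hb⟩ := exists_cofactor ι hι q he (a ∘ₗ (LinearMap.ker σ).subtype) (by
    rintro ⟨x, hx⟩
    simp only [LinearMap.comp_apply, Submodule.subtype_apply, ha]
    rw [LinearMap.mem_ker.1 hx, map_zero])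
  obtain ⟨c, hc⟩ := hK k _ hk b
  obtain ⟨d, hd⟩ := exists_factor σ hσ (a - ι ∘ₗ c) (by
    intro x hx
    have h1 := hb ⟨x, hx⟩
    rw [← hc] at h1
    simpa [sub_eq_zero] using h1.symm)
  refine ⟨d, fun x => ?_⟩
  obtain ⟨y, rfl⟩ := hσ x
  rw [hd]
  simp [ha, (he _).2 ⟨c y, rfl⟩]

theorem exists_extend {A A' P X : Type u} [AddCommGroup A] [Module Λ A] [AddCommGroup A']
    [Module Λ A'] [AddCommGroup P] [Module Λ P] [AddCommGroup X] [Module Λ X]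
    (hX : ExtInjective S X) (j : A →ₗ[Λ] A') (ρ : A' →ₗ[Λ] P) (hj : Function.Injective j)
    (hρ : Function.Surjective ρ) (he : Function.Exact j ρ) (hP : ModuleCat.of Λ P ∈ S)
    (h : A →ₗ[Λ] X) : ∃ h' : A' →ₗ[Λ] X, ∀ x, h' (j x) = h x := by
  obtain ⟨k, σ, hσ, -, hk⟩ := hS.exists_presentation hP
  obtain ⟨a, ha⟩ := Module.projective_lifting_property ρ σ hρ
  have ha : ∀ x, ρ (a x) = σ x := fun x => LinearMap.congr_fun ha x
  obtain ⟨b, hb⟩ := exists_cofactor j hj ρ he (a ∘ₗ (LinearMap.ker σ).subtype) (by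
    rintro ⟨x, hx⟩
    simpa [ha] using hx)
  obtain ⟨c, hc⟩ := hX k _ hk (h ∘ₗ b)
  obtain ⟨d, hd⟩ := exists_factor (j.coprod a) (by
    intro x
    obtain ⟨r, hr⟩ := hσ (ρ x)
    obtain ⟨y, hy⟩ := (he (x - a r)).1 (by simp [ha, hr])
    exact ⟨(y, r), by simp [hy]⟩) (h.coprod c) (by
    rintro ⟨x, r⟩ hx
    have hx : j x + a r = 0 := by simpa using hx
    have hr : σ r = 0 := by
      have := congrArg ρ hx
      simpa [ha, (he _).2 ⟨x, rfl⟩] using this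
    have h1 := hb ⟨r, hr⟩
    have h2 : x = - b ⟨r, hr⟩ := hj (by
      rw [map_neg, h1]
      exact eq_neg_of_add_eq_zero_left hx)
    have h3 := hc ⟨r, hr⟩
    simp only [LinearMap.coprod_apply, h2]
    simp only at h3
    rw [h3]
    simp)
  exact ⟨d, fun x => by simpa using hd (x, 0)⟩

theorem coker {K E Z : Type u} [AddCommGroup K] [Module Λ K] [AddCommGroup E]
    [Module Λ E] [AddCommGroup Z] [Module Λ Z] (hK : ExtInjective S K) (hE : ExtInjective S E)
    (ι : K →ₗ[Λ] E) (q : E →ₗ[Λ] Z) (hι : Function.Injective ι)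
    (hq : Function.Surjective q) (he : Function.Exact ι q) : ExtInjective S Z := by
  intro k Ω hΩ f
  have hΩ' : ModuleCat.of Λ Ω ∈ S := hS.ker_mem Ω.subtype Ω.mkQ Subtype.val_injective
    Ω.mkQ_surjective (LinearMap.exact_subtype_mkQ Ω) (hS.pi_mem k) hΩ
  obtain ⟨h, hh⟩ := hK.exists_lift hS ι q hι hq he hΩ' f
  obtain ⟨g, hg⟩ := hE k Ω hΩ h
  exact ⟨q ∘ₗ g, fun x => by simp [hg, hh]⟩

end ExtInjective

theorem shortExact_iff {X Y Z : ModuleCat.{u} Λ} (f : X ⟶ Y) (g : Y ⟶ Z) (w : f ≫ g = 0) :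
    (ShortComplex.mk f g w).ShortExact ↔ Function.Injective f.hom ∧ Function.Surjective g.hom ∧
      Function.Exact f.hom g.hom := by
  constructor
  · intro h
    exact ⟨h.moduleCat_injective_f, h.moduleCat_surjective_g,
      (ShortComplex.ShortExact.moduleCat_exact_iff_function_exact _).1 h.exact⟩
  · rintro ⟨hf, hg, he⟩
    obtain ⟨w', hw'⟩ := shortExact_of f.hom g.hom hf hg he
    exact hw'

theorem mem_rightPerp_iff (hS : IsResolvingFP S) (X : ModuleCat.{u} Λ) :
    X ∈ rightPerp S ↔ ExtInjective S X := by
  constructor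
  · intro hX k Ω hΩ f
    obtain ⟨E, i, a, p, hi, hp, he, hai, hpa, -⟩ := exists_pushout Ω.subtype
      Subtype.val_injective Ω.mkQ Ω.mkQ_surjective (LinearMap.exact_subtype_mkQ Ω) f
    obtain ⟨w, hw⟩ := shortExact_of i p hi hp he
    obtain ⟨s, hs⟩ := hX _ hΩ _ _ _ w hw
    have hs : ∀ x, p (s.hom x) = x := fun x => congrArg (fun t => t.hom x) hs
    obtain ⟨g, hg⟩ := exists_cofactor i hi p he (a - s.hom ∘ₗ Ω.mkQ) (by
      intro x
      simp [hs, hpa])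
    refine ⟨g, fun x => hi ?_⟩
    rw [hg, ← hai]
    have : Ω.mkQ (x : Fin k → Λ) = 0 := by simp
    simp [this]
  · intro hX P hP E i p w hse
    obtain ⟨hi, hp, he⟩ := (shortExact_iff i p w).1 hse
    obtain ⟨s, hs⟩ := hX.exists_lift hS i.hom p.hom hi hp he hP LinearMap.id
    exact ⟨ModuleCat.ofHom s, by ext x; exact hs x⟩


/-- Every linear map from a finitely presented module to `M` factors through a member of `S`. -/
def FactorsThrough (S : Set (ModuleCat.{u} Λ)) (M : Type u) [AddCommGroup M] [Module Λ M] :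
    Prop :=
  ∀ (P : Type u) [AddCommGroup P] [Module Λ P], Module.FinitePresentation Λ P →
    ∀ h : P →ₗ[Λ] M, ∃ X : ModuleCat.{u} Λ, X ∈ S ∧
      ∃ (a : P →ₗ[Λ] X) (b : X →ₗ[Λ] M), ∀ x, b (a x) = h x

namespace FactorsThrough

theorem of_equiv {X Y : Type u} [AddCommGroup X] [Module Λ X] [AddCommGroup Y] [Module Λ Y]
    (e : X ≃ₗ[Λ] Y) (hX : FactorsThrough S X) : FactorsThrough S Y := by
  intro P _ _ hP h
  obtain ⟨T, hT, a, b, hab⟩ := hX P hP (e.symm.toLinearMap ∘ₗ h)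
  exact ⟨T, hT, a, e.toLinearMap ∘ₗ b, fun x => by simp [hab]⟩

theorem of_mem_limClosure {M : ModuleCat.{u} Λ} (hM : M ∈ limClosure S) : FactorsThrough S M := by
  obtain ⟨D⟩ := hM
  let _ := D.po
  classical
  have := D.dir
  have := D.ne
  have : IsFiltered D.I := isFiltered_of_directed_le_nonempty D.I
  refine of_equiv (S := S) D.iso.toLinearEquiv ?_
  intro P _ _ hP h
  obtain ⟨k, σ, hσ⟩ := Module.Finite.exists_fin' Λ P
  have hrep : ∀ j : Fin k, ∃ (i : D.I) (y : D.F.obj i),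
      (D.c.ι.app i).hom y = h (σ (Pi.single j 1)) :=
    fun j => Concrete.isColimit_exists_rep D.F D.hc _
  choose i y hy using hrep
  obtain ⟨i₀, hi₀⟩ := Finset.exists_le (Finset.univ.image i)
  have hi₀ : ∀ j, i j ≤ i₀ := fun j => hi₀ _ (Finset.mem_image_of_mem _ (Finset.mem_univ j))
  have hnat : ∀ (a b : D.I) (hab : a ≤ b) (z : D.F.obj a),
      (D.c.ι.app b).hom ((D.F.map (homOfLE hab)).hom z) = (D.c.ι.app a).hom z :=
    fun a b hab z => congrArg (fun t => t.hom z) (D.c.w (homOfLE hab))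
  let a₀ : (Fin k → Λ) →ₗ[Λ] D.F.obj i₀ := (Pi.basisFun Λ (Fin k)).constr ℕ
    (fun j => (D.F.map (homOfLE (hi₀ j))).hom (y j))
  have ha₀ : (D.c.ι.app i₀).hom ∘ₗ a₀ = h ∘ₗ σ := by
    refine (Pi.basisFun Λ (Fin k)).ext fun j => ?_
    simp only [LinearMap.comp_apply, a₀, Module.Basis.constr_basis]
    rw [hnat, hy, Pi.basisFun_apply]
  obtain ⟨T, hT⟩ := Module.FinitePresentation.fg_ker σ hσ
  have hz : ∀ t : (Fin k → Λ), t ∈ LinearMap.ker σ →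
      ∃ (j : D.I) (hj : i₀ ≤ j), (D.F.map (homOfLE hj)).hom (a₀ t) = 0 := by
    intro t ht
    have h0 : (D.c.ι.app i₀).hom (a₀ t) = (D.c.ι.app i₀).hom 0 := by
      have := LinearMap.congr_fun ha₀ t
      simp only [LinearMap.comp_apply] at this
      rw [this, LinearMap.mem_ker.1 ht, map_zero, map_zero]
    obtain ⟨j, f, g, hfg⟩ := Concrete.isColimit_exists_of_rep_eq D.F D.hc _ _ h0
    refine ⟨j, leOfHom f, ?_⟩
    rw [Subsingleton.elim (homOfLE (leOfHom f)) f]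
    exact hfg.trans (map_zero (D.F.map g).hom)
  have hz' : ∀ t : T, ∃ (j : D.I) (hj : i₀ ≤ j),
      (D.F.map (homOfLE hj)).hom (a₀ t) = 0 :=
    fun t => hz t (hT ▸ Submodule.subset_span t.2)
  choose j hj hjt using hz'
  obtain ⟨j₀, hj₀⟩ := Finset.exists_le (insert i₀ (Finset.univ.image j))
  have hij : i₀ ≤ j₀ := hj₀ _ (Finset.mem_insert_self _ _)
  have hj₀ : ∀ t, j t ≤ j₀ := fun t =>
    hj₀ _ (Finset.mem_insert_of_mem (Finset.mem_image_of_mem _ (Finset.mem_univ t)))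
  let a₁ : (Fin k → Λ) →ₗ[Λ] D.F.obj j₀ := (D.F.map (homOfLE hij)).hom ∘ₗ a₀
  have hker : LinearMap.ker σ ≤ LinearMap.ker a₁ := by
    rw [← hT, Submodule.span_le]
    intro t ht
    have h1 : D.F.map (homOfLE hij) = D.F.map (homOfLE (hj ⟨t, ht⟩)) ≫
        D.F.map (homOfLE (hj₀ ⟨t, ht⟩)) := by
      rw [← D.F.map_comp]; rfl
    have h2 := congrArg (fun s => s.hom (a₀ t)) h1
    refine LinearMap.mem_ker.2 (h2.trans ?_)
    simp only [ModuleCat.hom_comp, LinearMap.comp_apply]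
    rw [hjt ⟨t, ht⟩, map_zero]
  obtain ⟨b, hb⟩ := exists_factor σ hσ a₁ fun x hx => LinearMap.mem_ker.1 (hker hx)
  refine ⟨D.F.obj j₀, D.mem j₀, b, (D.c.ι.app j₀).hom, fun x => ?_⟩
  obtain ⟨r, rfl⟩ := hσ x
  rw [hb]
  exact (hnat _ _ hij _).trans (LinearMap.congr_fun ha₀ r)

theorem extension (hS : IsResolvingFP S) {X Y Z : Type u} [AddCommGroup X] [Module Λ X]
    [AddCommGroup Y] [Module Λ Y] [AddCommGroup Z] [Module Λ Z] (i : X →ₗ[Λ] Y) (p : Y →ₗ[Λ] Z)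
    (hi : Function.Injective i) (hp : Function.Surjective p) (he : Function.Exact i p)
    (hX : FactorsThrough S X) (hZ : FactorsThrough S Z) : FactorsThrough S Y := by
  intro P _ _ hP h
  obtain ⟨T, hT, a, b, hab⟩ := hZ P hP (p ∘ₗ h)
  obtain ⟨n, σ, hσ, hker, -⟩ := hS.exists_presentation hT
  obtain ⟨l, hl⟩ := Module.projective_lifting_property p (b ∘ₗ σ) hp
  have hl : ∀ x, p (l x) = b (σ x) := fun x => LinearMap.congr_fun hl x
  let N : Submodule Λ ((Fin n → Λ) × P) := LinearMap.ker (σ.coprod a)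
  have hsurj : Function.Surjective (σ.coprod a) := fun t => by
    obtain ⟨r, rfl⟩ := hσ t
    exact ⟨(r, 0), by simp⟩
  have hNfp : Module.FinitePresentation Λ N := by
    let τ : N →ₗ[Λ] P := LinearMap.snd Λ _ _ ∘ₗ N.subtype
    have hτ : Function.Surjective τ := fun x => by
      obtain ⟨r, hr⟩ := hσ (-a x)
      exact ⟨⟨(r, x), by simp [N, hr]⟩, rfl⟩
    have e : LinearMap.ker σ ≃ₗ[Λ] LinearMap.ker τ :=
      LinearEquiv.ofBijective (LinearMap.codRestrict (LinearMap.ker τ)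
        (LinearMap.codRestrict N (LinearMap.inl Λ _ P ∘ₗ (LinearMap.ker σ).subtype)
          (fun r => by simp [N])) (fun r => LinearMap.mem_ker.2 rfl)) (by
        constructor
        · intro r r' hrr
          have := congrArg (fun s => s.1.1.1) hrr
          exact Subtype.ext this
        · rintro ⟨⟨⟨r, x⟩, h1⟩, h2⟩
          have hx : x = 0 := h2
          subst hx
          refine ⟨⟨r, by simpa [N] using h1⟩, rfl⟩)
    have h0 : Module.FinitePresentation Λ (LinearMap.ker σ) := hS.fp _ hker
    have : Module.FinitePresentation Λ (LinearMap.ker τ) :=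
      Module.FinitePresentation.of_equiv (M := LinearMap.ker σ) (N := LinearMap.ker τ) e
    exact Module.finitePresentation_of_ker τ hτ
  obtain ⟨c₀, hc₀⟩ := exists_cofactor i hi p he ((l.coprod h) ∘ₗ N.subtype) (by
    rintro ⟨⟨r, x⟩, hx⟩
    have hx' : σ r + a x = 0 := by simpa [N] using hx
    have h1 : p (h x) = b (a x) := (hab x).symm
    change p (l r + h x) = 0
    rw [map_add, hl, h1, ← map_add, hx', map_zero])
  obtain ⟨T', hT', c, d, hcd⟩ := hX N hNfp c₀
  obtain ⟨E, i', a', p', hi', hp', he', -, -, hw⟩ := exists_pushout N.subtype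
    Subtype.val_injective (σ.coprod a) hsurj (LinearMap.exact_subtype_ker_map _) c
  obtain ⟨w, -, hw⟩ := hw Y (i ∘ₗ d) (l.coprod h) (fun x => by
    simp only [LinearMap.comp_apply, hcd, hc₀])
  exact ⟨E, hS.ext_mem i' p' hi' hp' he' hT' hT, a' ∘ₗ LinearMap.inr Λ _ P, w, fun x => by
    simp [hw]⟩

theorem exists_lift (hS : IsResolvingFP S) {K E Z P : Type u} [AddCommGroup K] [Module Λ K]
    [AddCommGroup E] [Module Λ E] [AddCommGroup Z] [Module Λ Z] [AddCommGroup P] [Module Λ P]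
    (hZ : FactorsThrough S Z) (hK : ExtInjective S K) (ι : K →ₗ[Λ] E) (q : E →ₗ[Λ] Z)
    (hι : Function.Injective ι) (hq : Function.Surjective q) (he : Function.Exact ι q)
    (hP : Module.FinitePresentation Λ P) (h : P →ₗ[Λ] Z) :
    ∃ h' : P →ₗ[Λ] E, ∀ x, q (h' x) = h x := by
  obtain ⟨T, hT, a, b, hab⟩ := hZ P hP h
  obtain ⟨b', hb'⟩ := hK.exists_lift hS ι q hι hq he hT b
  exact ⟨b' ∘ₗ a, fun x => by simp [hb', hab]⟩

end FactorsThrough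

/-- Colimits of sequences of injective maps. -/
theorem exists_seqColimit (X : ℕ → ModuleCat.{u} Λ) (ι : ∀ n, X n →ₗ[Λ] X (n + 1))
    (hι : ∀ n, Function.Injective (ι n)) :
    ∃ (Y : ModuleCat.{u} Λ) (c : ∀ n, X n →ₗ[Λ] Y), (∀ n, Function.Injective (c n)) ∧
      (∀ n x, c (n + 1) (ι n x) = c n x) ∧ (∀ y, ∃ n x, c n x = y) ∧
      ∀ (Z : Type u) [AddCommGroup Z] [Module Λ Z] (g : ∀ n, X n →ₗ[Λ] Z),
        (∀ n x, g (n + 1) (ι n x) = g n x) → ∃ w : Y →ₗ[Λ] Z, ∀ n x, w (c n x) = g n x := by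
  let F : ℕ ⥤ ModuleCat.{u} Λ := Functor.ofSequence (fun n => ModuleCat.ofHom (ι n))
  have hF : ∀ n, F.map (homOfLE (Nat.le_add_right n 1)) = ModuleCat.ofHom (ι n) := fun n =>
    Functor.ofSequence_map_homOfLE_succ _ n
  have hinj : ∀ (n m : ℕ) (h : n ≤ m), Function.Injective (F.map (homOfLE h)).hom := by
    intro n m h
    induction m, h using Nat.le_induction with
    | base =>
      have : F.map (homOfLE (le_refl n)) = 𝟙 _ := F.map_id n
      rw [this]
      exact Function.injective_id
    | succ m h ih =>
      have : F.map (homOfLE (Nat.le_succ_of_le h)) = F.map (homOfLE h) ≫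
          F.map (homOfLE (Nat.le_add_right m 1)) := by
        rw [← F.map_comp]; rfl
      rw [this, hF]
      exact (hι m).comp ih
  have := preservesFilteredColimitsOfSize_shrink.{0, u, 0, u} (forget (ModuleCat.{u} Λ))
  have : PreservesColimitsOfShape ℕ (forget (ModuleCat.{u} Λ)) :=
    PreservesFilteredColimitsOfSize.preserves_filtered_colimits ℕ
  refine ⟨colimit F, fun n => (colimit.ι F n).hom, ?_, ?_, ?_, ?_⟩
  · intro n
    refine (injective_iff_map_eq_zero (colimit.ι F n).hom).2 fun x hx => ?_
    obtain ⟨m, f, g, hfg⟩ := Concrete.isColimit_exists_of_rep_eq F (colimit.isColimit F) x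
      (0 : F.obj n) (hx.trans (map_zero _).symm)
    exact hinj n m (leOfHom f) (hfg.trans ((map_zero (F.map g).hom).trans (map_zero _).symm))
  · intro n x
    have := colimit.w F (homOfLE (Nat.le_add_right n 1))
    rw [hF] at this
    exact congrArg (fun t => t.hom x) this
  · exact fun y => Concrete.isColimit_exists_rep F (colimit.isColimit F) y
  · intro Z _ _ g hg
    let t : F ⟶ (Functor.const ℕ).obj (ModuleCat.of Λ Z) :=
      NatTrans.ofSequence (fun n => ModuleCat.ofHom (g n)) (fun n => by
        rw [hF]
        ext x
        exact hg n x)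
    exact ⟨(colimit.desc F ⟨ModuleCat.of Λ Z, t⟩).hom, fun n x =>
      congrArg (fun s => s.hom x) (colimit.ι_desc ⟨ModuleCat.of Λ Z, t⟩ n)⟩

/-- The data needed to attach a generator-relation cell to `X` over `L`. -/
structure AttachingCell (S : Set (ModuleCat.{u} Λ)) {X L : Type u} [AddCommGroup X] [Module Λ X]
    [AddCommGroup L] [Module Λ L] (π : X →ₗ[Λ] L) where
  rank : ℕ
  rel : Submodule Λ (Fin rank → Λ)
  mem : ModuleCat.of Λ ((Fin rank → Λ) ⧸ rel) ∈ S
  map : rel →ₗ[Λ] X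
  target : (Fin rank → Λ) →ₗ[Λ] L
  comm : ∀ x : rel, π (map x) = target x

theorem exists_attach {X L : Type u} [AddCommGroup X] [Module Λ X]
    [AddCommGroup L] [Module Λ L] (π : X →ₗ[Λ] L) :
    ∃ (Y : ModuleCat.{u} Λ) (ι : X →ₗ[Λ] Y) (π' : Y →ₗ[Λ] L)
      (ρ : Y →ₗ[Λ] Π₀ c : AttachingCell S π, ((Fin c.rank → Λ) ⧸ c.rel)),
      Function.Injective ι ∧ Function.Surjective ρ ∧ Function.Exact ι ρ ∧
      (∀ x, π' (ι x) = π x) ∧ ∀ c : AttachingCell S π, ∃ h : (Fin c.rank → Λ) →ₗ[Λ] Y,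
        (∀ x : c.rel, h x = ι (c.map x)) ∧ ∀ x, π' (h x) = c.target x := by
  classical
  let j : (Π₀ c : AttachingCell S π, c.rel) →ₗ[Λ] Π₀ c : AttachingCell S π, (Fin c.rank → Λ) :=
    DFinsupp.mapRange.linearMap fun c => c.rel.subtype
  let r : (Π₀ c : AttachingCell S π, (Fin c.rank → Λ)) →ₗ[Λ]
      Π₀ c : AttachingCell S π, ((Fin c.rank → Λ) ⧸ c.rel) :=
    DFinsupp.mapRange.linearMap fun c => c.rel.mkQ
  have hj : Function.Injective j :=
    (DFinsupp.mapRange_injective _ fun _ => map_zero _).2 fun c => Subtype.val_injective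
  have hr : Function.Surjective r :=
    (DFinsupp.mapRange_surjective _ fun _ => map_zero _).2 fun c => c.rel.mkQ_surjective
  have he : Function.Exact j r := by
    rw [LinearMap.exact_iff, DFinsupp.ker_mapRangeLinearMap, DFinsupp.range_mapRangeLinearMap]
    simp
  obtain ⟨Y, ι, a, ρ, hι, hρ, hex, haj, -, hw⟩ := exists_pushout (Λ := Λ)
    (A := Π₀ c : AttachingCell S π, c.rel) (A' := Π₀ c : AttachingCell S π, (Fin c.rank → Λ))
    (B := X) (C := Π₀ c : AttachingCell S π, ((Fin c.rank → Λ) ⧸ c.rel)) j hj r hr he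
    (DFinsupp.lsum ℕ fun c : AttachingCell S π => c.map)
  obtain ⟨π', hπ', hπa⟩ := hw L π (DFinsupp.lsum ℕ fun c : AttachingCell S π => c.target) (by
    intro x
    have h0 : π ∘ₗ (DFinsupp.lsum ℕ fun c : AttachingCell S π => c.map) =
        (DFinsupp.lsum ℕ fun c : AttachingCell S π => c.target) ∘ₗ j :=
      DFinsupp.lhom_ext fun c y => by simp [j, c.comm]
    exact LinearMap.congr_fun h0 x)
  refine ⟨Y, ι, π', ρ, hι, hρ, hex, hπ', fun c => ⟨a ∘ₗ DFinsupp.lsingle (R := Λ)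
    (M := fun c : AttachingCell S π => Fin c.rank → Λ) c, fun x => ?_,
    fun x => ?_⟩⟩
  · have := haj (DFinsupp.single c x)
    simpa [j] using this
  · simp [hπa]

/-- A countable filtration of `X` whose successive quotients are direct sums of members
of `S`. -/
structure SumFiltration (S : Set (ModuleCat.{u} Λ)) (X : Type u) [AddCommGroup X]
    [Module Λ X] where
  fil : ℕ → Submodule Λ X
  le_succ : ∀ n, fil n ≤ fil (n + 1)
  exists_mem : ∀ x, ∃ n, x ∈ fil n
  cell : ℕ → Type u
  quot : ∀ n, cell n → ModuleCat.{u} Λ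
  quot_mem : ∀ n j, quot n j ∈ S
  gr : ∀ n, fil (n + 1) →ₗ[Λ] Π₀ j : cell n, quot n j
  gr_surjective : ∀ n, Function.Surjective (gr n)
  gr_eq_zero : ∀ n (x : fil (n + 1)), gr n x = 0 ↔ (x : X) ∈ fil n

namespace SumFiltration

variable {X : Type u} [AddCommGroup X] [Module Λ X] (𝓕 : SumFiltration S X)

theorem mono : Monotone 𝓕.fil := monotone_nat_of_le_succ 𝓕.le_succ

theorem exists_fg_le {N : Submodule Λ X} (hN : N.FG) : ∃ n, N ≤ 𝓕.fil n := by
  obtain ⟨T, rfl⟩ := hN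
  choose n hn using 𝓕.exists_mem
  refine ⟨T.sup n, Submodule.span_le.2 fun x hx => 𝓕.mono (Finset.le_sup hx) (hn x)⟩

end SumFiltration

theorem exists_sumFiltration (hS : IsResolvingFP S) {X₀ L : Type u} [AddCommGroup X₀]
    [Module Λ X₀] [AddCommGroup L] [Module Λ L] (π₀ : X₀ →ₗ[Λ] L) :
    ∃ (X : ModuleCat.{u} Λ) (j : X₀ →ₗ[Λ] X) (π : X →ₗ[Λ] L) (𝓕 : SumFiltration S X),
      Function.Injective j ∧ LinearMap.range j = 𝓕.fil 0 ∧ (∀ x, π (j x) = π₀ x) ∧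
      Function.Surjective π ∧ ExtInjective S (LinearMap.ker π) := by
  have hstep : ∀ st : Σ X : ModuleCat.{u} Λ, X →ₗ[Λ] L, _ :=
    fun st => exists_attach (S := S) st.2
  choose Y ι π' ρ hι hρ he hπ' hc using hstep
  let st : ℕ → Σ X : ModuleCat.{u} Λ, X →ₗ[Λ] L := fun n =>
    Nat.rec ⟨ModuleCat.of Λ X₀, π₀⟩ (fun _ s => ⟨Y s, π' s⟩) n
  obtain ⟨X, c, hinj, hcomp, hsurj, hdesc⟩ := exists_seqColimit (fun n => (st n).1)
    (fun n => ι (st n)) (fun n => hι (st n))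
  obtain ⟨π, hπ⟩ := hdesc L (fun n => (st n).2) (fun n x => hπ' (st n) x)
  let e : ∀ n, (st n).1 ≃ₗ[Λ] LinearMap.range (c n) := fun n =>
    LinearEquiv.ofInjective (c n) (hinj n)
  let 𝓕 : SumFiltration S X :=
    { fil := fun n => LinearMap.range (c n)
      le_succ := by
        rintro n _ ⟨x, rfl⟩
        exact ⟨ι (st n) x, hcomp n x⟩
      exists_mem := hsurj
      cell := fun n => AttachingCell S (st n).2
      quot := fun n a => ModuleCat.of Λ ((Fin a.rank → Λ) ⧸ a.rel)
      quot_mem := fun n a => a.mem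
      gr := fun n => ρ (st n) ∘ₗ (e (n + 1)).symm.toLinearMap
      gr_surjective := fun n => (hρ (st n)).comp (e (n + 1)).symm.surjective
      gr_eq_zero := by
        intro n x
        obtain ⟨y, rfl⟩ := (e (n + 1)).surjective x
        have h1 : ρ (st n) y = 0 ↔ y ∈ Set.range (ι (st n)) := he (st n) y
        simp only [LinearMap.comp_apply, LinearEquiv.coe_coe, LinearEquiv.symm_apply_apply]
        refine h1.trans ?_
        constructor
        · rintro ⟨x, rfl⟩
          exact ⟨x, (hcomp n x).symm⟩
        · rintro ⟨x, hx⟩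
          refine ⟨x, hinj (n + 1) ?_⟩
          exact (hcomp n x).trans hx }
  refine ⟨X, c 0, π, 𝓕, hinj 0, rfl, hπ 0, ?_, ?_⟩
  · intro l
    let a : AttachingCell S (st 0).2 :=
      { rank := 1
        rel := ⊥
        mem := hS.mem_of_equiv (Submodule.quotEquivOfEqBot _ rfl).symm (hS.pi_mem 1)
        map := 0
        target := (LinearMap.toSpanSingleton Λ L l) ∘ₗ LinearMap.proj 0
        comm := by
          rintro ⟨x, hx⟩
          simp [(Submodule.mem_bot Λ).1 hx] }
    obtain ⟨h, -, hh⟩ := hc (st 0) a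
    refine ⟨c 1 (h 1), (hπ 1 _).trans ((hh 1).trans ?_)⟩
    simp [a]
  · intro k Ω hΩ f
    have hfin : Module.FinitePresentation Λ Ω := hS.fp _ (hS.ker_mem Ω.subtype Ω.mkQ
      Subtype.val_injective Ω.mkQ_surjective (LinearMap.exact_subtype_mkQ Ω) (hS.pi_mem k) hΩ)
    let f₁ : Ω →ₗ[Λ] X := (LinearMap.ker π).subtype ∘ₗ f
    obtain ⟨n, hn⟩ := 𝓕.exists_fg_le (N := LinearMap.range f₁) (by
      rw [LinearMap.range_eq_map]
      exact Submodule.FG.map _ (Module.Finite.fg_top))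
    let f₂ : Ω →ₗ[Λ] (st n).1 := (e n).symm.toLinearMap ∘ₗ
      f₁.codRestrict (LinearMap.range (c n)) (fun x => hn ⟨x, rfl⟩)
    have hf₂ : ∀ x, c n (f₂ x) = f x := fun x =>
      congrArg Subtype.val ((e n).apply_symm_apply _)
    let a : AttachingCell S (st n).2 :=
      { rank := k
        rel := Ω
        mem := hΩ
        map := f₂
        target := 0
        comm := fun x => by
          rw [← hπ, hf₂]
          exact (f x).2 }
    obtain ⟨h, hh, hh'⟩ := hc (st n) a
    refine ⟨LinearMap.codRestrict (LinearMap.ker π) (c (n + 1) ∘ₗ h)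
      (fun x => LinearMap.mem_ker.2 ((hπ (n + 1) _).trans (hh' x))), fun x => Subtype.ext ?_⟩
    refine (congrArg (c (n + 1)) (hh x)).trans ((hcomp n _).trans (hf₂ x))

/-- `H ≤ H'` with `H' / H` isomorphic to a member of `S`. -/
def QuotMem (S : Set (ModuleCat.{u} Λ)) {X : Type u} [AddCommGroup X] [Module Λ X]
    (H H' : Submodule Λ X) : Prop :=
  H ≤ H' ∧ ∃ T : ModuleCat.{u} Λ, T ∈ S ∧ ∃ φ : H' →ₗ[Λ] T, Function.Surjective φ ∧
    ∀ x, φ x = 0 ↔ (x : X) ∈ H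

namespace QuotMem

variable {X : Type u} [AddCommGroup X] [Module Λ X] (hS : IsResolvingFP S)
include hS

theorem refl (H : Submodule Λ X) : QuotMem S H H :=
  ⟨le_rfl, _, hS.zero_mem, 0, fun _ => ⟨0, rfl⟩, fun x => ⟨fun _ => x.2, fun _ => rfl⟩⟩

theorem trans {H H' H'' : Submodule Λ X} (h₁ : QuotMem S H H') (h₂ : QuotMem S H' H'') :
    QuotMem S H H'' := by
  obtain ⟨hle, T, hT, φ, hφ, hφ0⟩ := h₁
  obtain ⟨hle', T', hT', φ', hφ', hφ0'⟩ := h₂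
  let N : Submodule Λ H'' := H.comap H''.subtype
  have hN : ∀ x : H'', N.mkQ x = 0 ↔ (x : X) ∈ H := fun x => by simp [N]
  obtain ⟨a, ha⟩ := exists_factor φ hφ (N.mkQ ∘ₗ Submodule.inclusion hle') (fun x hx =>
    (hN _).2 ((hφ0 x).1 hx))
  obtain ⟨b, hb⟩ := exists_factor N.mkQ N.mkQ_surjective φ' (fun x hx =>
    (hφ0' x).2 (hle ((hN x).1 hx)))
  refine ⟨hle.trans hle', ModuleCat.of Λ (H'' ⧸ N), ?_, N.mkQ, N.mkQ_surjective, hN⟩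
  refine hS.ext_mem a b ?_ ?_ ?_ hT hT'
  · refine (injective_iff_map_eq_zero a).2 fun t ht => ?_
    obtain ⟨x, rfl⟩ := hφ t
    rw [ha] at ht
    exact (hφ0 x).2 ((hN _).1 ht)
  · intro t
    obtain ⟨x, rfl⟩ := hφ' t
    exact ⟨N.mkQ x, hb x⟩
  · intro e
    obtain ⟨x, rfl⟩ := N.mkQ_surjective e
    rw [hb, hφ0']
    constructor
    · intro hx
      exact ⟨φ ⟨x, hx⟩, ha _⟩
    · rintro ⟨t, ht⟩
      obtain ⟨y, rfl⟩ := hφ t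
      rw [ha, ← sub_eq_zero, LinearMap.comp_apply, ← map_sub, hN] at ht
      have h1 := H'.sub_mem y.2 (hle ht)
      simpa using h1

theorem exists_of_fg {𝓗 : Set (Submodule Λ X)} {W : Submodule Λ X}
    (h : ∀ H ∈ 𝓗, ∀ x ∈ W, ∃ H' ∈ 𝓗, QuotMem S H H' ∧ H' ≤ H ⊔ W ∧ x ∈ H')
    {N : Submodule Λ X} (hN : N.FG) :
    N ≤ W → ∀ H ∈ 𝓗, ∃ H' ∈ 𝓗, QuotMem S H H' ∧ H' ≤ H ⊔ W ∧ N ≤ H' := by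
  induction N, hN using Submodule.fg_induction with
  | singleton x =>
    intro hx H hH
    simp only [Submodule.span_singleton_le_iff_mem] at hx ⊢
    exact h H hH x hx
  | sup N₁ N₂ _ _ h₁ h₂ =>
    intro hN H hH
    obtain ⟨H₁, hH₁, hr₁, hl₁, hN₁⟩ := h₁ (le_sup_left.trans hN) H hH
    obtain ⟨H₂, hH₂, hr₂, hl₂, hN₂⟩ := h₂ (le_sup_right.trans hN) H₁ hH₁
    exact ⟨H₂, hH₂, hr₁.trans hS hr₂, hl₂.trans (sup_le hl₁ le_sup_right),
      sup_le (hN₁.trans hr₂.1) hN₂⟩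

end QuotMem

/-- A Hill family of submodules of `X` above `X₀`: it contains `X₀`, is closed under directed
unions, and every member can be enlarged to contain a given element, with quotient in `S`. -/
structure IsHillFamily (S : Set (ModuleCat.{u} Λ)) {X : Type u} [AddCommGroup X] [Module Λ X]
    (X₀ : Submodule Λ X) (𝓗 : Set (Submodule Λ X)) : Prop where
  base_mem : X₀ ∈ 𝓗
  sSup_mem : ∀ C ⊆ 𝓗, C.Nonempty → DirectedOn (· ≤ ·) C → sSup C ∈ 𝓗
  exists_mem : ∀ H ∈ 𝓗, ∀ x, ∃ H' ∈ 𝓗, QuotMem S H H' ∧ x ∈ H'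

namespace IsHillFamily

variable {X : Type u} [AddCommGroup X] [Module Λ X] {X₀ : Submodule Λ X}
  {𝓗 : Set (Submodule Λ X)} (h𝓗 : IsHillFamily S X₀ 𝓗) (hS : IsResolvingFP S)
include h𝓗 hS

theorem exists_fg_le {N : Submodule Λ X} (hN : N.FG) {H : Submodule Λ X} (hH : H ∈ 𝓗) :
    ∃ H' ∈ 𝓗, QuotMem S H H' ∧ N ≤ H' := by
  obtain ⟨H', hH', hr, -, hle⟩ := QuotMem.exists_of_fg hS (W := ⊤) (fun H hH x _ => by
    obtain ⟨H', hH', hr, hx⟩ := h𝓗.exists_mem H hH x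
    exact ⟨H', hH', hr, by simp, hx⟩) hN le_top H hH
  exact ⟨H', hH', hr, hle⟩

theorem factorsThrough : FactorsThrough S (X ⧸ X₀) := by
  intro P _ _ hP h
  obtain ⟨n, s, hs⟩ := Module.Finite.exists_fin' Λ P
  obtain ⟨l, hl⟩ := Module.projective_lifting_property X₀.mkQ (h ∘ₗ s) X₀.mkQ_surjective
  obtain ⟨H, -, ⟨hle, T, hT, φ, hφ, hφ0⟩, hN⟩ := h𝓗.exists_fg_le hS
    (N := LinearMap.range l) (by
      rw [LinearMap.range_eq_map]
      exact Submodule.FG.map _ Module.Finite.fg_top) h𝓗.base_mem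
  have hX₀ : ∀ x, X₀.mkQ x = 0 ↔ x ∈ X₀ := fun x => by simp
  obtain ⟨b, hb⟩ := exists_factor φ hφ (X₀.mkQ ∘ₗ H.subtype) (fun x hx =>
    (hX₀ _).2 ((hφ0 x).1 hx))
  have hbinj : Function.Injective b := by
    refine (injective_iff_map_eq_zero b).2 fun t ht => ?_
    obtain ⟨x, rfl⟩ := hφ t
    rw [hb] at ht
    exact (hφ0 x).2 ((hX₀ _).1 ht)
  obtain ⟨a, ha⟩ := exists_cofactor b hbinj (LinearMap.range b).mkQ
    (by rw [LinearMap.exact_iff, Submodule.ker_mkQ]) h (by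
      intro x
      obtain ⟨r, rfl⟩ := hs x
      rw [← LinearMap.mem_ker, Submodule.ker_mkQ]
      refine ⟨φ ⟨l r, hN ⟨r, rfl⟩⟩, ?_⟩
      rw [hb]
      exact LinearMap.congr_fun hl r)
  exact ⟨T, hT, a, b, ha⟩

end IsHillFamily

namespace SumFiltration

variable {X : Type u} [AddCommGroup X] [Module Λ X] (𝓕 : SumFiltration S X)

/-- The `j`-th summand of the `n`-th quotient is covered by elements of `H`. -/
def Covers (H : Submodule Λ X) (n : ℕ) (j : 𝓕.cell n) : Prop := by
  classical
  exact ∀ y : 𝓕.quot n j, ∃ z : 𝓕.fil (n + 1), (z : X) ∈ H ∧ 𝓕.gr n z = DFinsupp.single j y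

theorem Covers.mono {H H' : Submodule Λ X} (h : H ≤ H') {n : ℕ} {j : 𝓕.cell n}
    (hH : 𝓕.Covers H n j) : 𝓕.Covers H' n j := fun y => by
  obtain ⟨z, hz, hzy⟩ := hH y
  exact ⟨z, h hz, hzy⟩

/-- The submodules above `fil 0` that are generated by cells. -/
def hill : Set (Submodule Λ X) :=
  {H | 𝓕.fil 0 ≤ H ∧ ∀ n (x : 𝓕.fil (n + 1)), (x : X) ∈ H → ∀ j, 𝓕.gr n x j ≠ 0 →
    𝓕.Covers H n j}

theorem exists_covers (hS : IsResolvingFP S) {n : ℕ}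
    (ih : ∀ H ∈ 𝓕.hill, ∀ x ∈ 𝓕.fil n, ∃ H' ∈ 𝓕.hill, QuotMem S H H' ∧ H' ≤ H ⊔ 𝓕.fil n ∧ x ∈ H')
    {H : Submodule Λ X} (hH : H ∈ 𝓕.hill) (j : 𝓕.cell n) :
    ∃ H' ∈ 𝓕.hill, QuotMem S H H' ∧ H' ≤ H ⊔ 𝓕.fil (n + 1) ∧ 𝓕.Covers H' n j := by
  classical
  by_cases hc : 𝓕.Covers H n j
  · exact ⟨H, hH, QuotMem.refl hS H, le_sup_left, hc⟩
  have hHj : ∀ x : 𝓕.fil (n + 1), (x : X) ∈ H → 𝓕.gr n x j = 0 := fun x hx => by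
    by_contra h0
    exact hc (hH.2 n x hx j h0)
  obtain ⟨k, σ, hσ, hker, -⟩ := hS.exists_presentation (𝓕.quot_mem n j)
  obtain ⟨l, hl⟩ := Module.projective_lifting_property (𝓕.gr n)
    ((DFinsupp.lsingle (R := Λ) (M := fun j => 𝓕.quot n j) j) ∘ₗ σ) (𝓕.gr_surjective n)
  have hl : ∀ r, 𝓕.gr n (l r) = DFinsupp.single j (σ r) := fun r => LinearMap.congr_fun hl r
  let l' : (Fin k → Λ) →ₗ[Λ] X := (𝓕.fil (n + 1)).subtype ∘ₗ l
  have hl' : ∀ r, l' r = l r := fun _ => rfl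
  have hfin : Module.FinitePresentation Λ (LinearMap.ker σ) := hS.fp _ hker
  obtain ⟨H₁, hH₁, hr₁, hle₁, hN₁⟩ := QuotMem.exists_of_fg hS ih
    (N := (LinearMap.ker σ).map l') (Submodule.FG.map _
      (Module.Finite.iff_fg.1 inferInstance)) (by
      rintro _ ⟨r, hr, rfl⟩
      rw [hl', ← 𝓕.gr_eq_zero, hl, LinearMap.mem_ker.1 hr, DFinsupp.single_zero]) H hH
  have hH₁j : ∀ x : 𝓕.fil (n + 1), (x : X) ∈ H₁ → 𝓕.gr n x j = 0 := fun x hx => by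
    obtain ⟨h, hh, w, hw, hx'⟩ := Submodule.mem_sup.1 (hle₁ hx)
    have h1 := hHj (x - ⟨w, 𝓕.le_succ n hw⟩) (by
      simp only [Submodule.coe_sub, ← hx', add_sub_cancel_right]
      exact hh)
    rwa [map_sub, (𝓕.gr_eq_zero n ⟨w, 𝓕.le_succ n hw⟩).2 hw, sub_zero] at h1
  have hlH₁ : ∀ r, l' r ∈ H₁ ↔ σ r = 0 := fun r => by
    constructor
    · intro hr
      have := hH₁j (l r) hr
      rwa [hl, DFinsupp.single_eq_same] at this
    · exact fun hr => hN₁ ⟨r, hr, rfl⟩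
  have hcov : 𝓕.Covers (H₁ ⊔ LinearMap.range l') n j := fun y => by
    obtain ⟨r, rfl⟩ := hσ y
    exact ⟨l r, Submodule.mem_sup_right ⟨r, rfl⟩, hl r⟩
  refine ⟨H₁ ⊔ LinearMap.range l', ⟨hH₁.1.trans le_sup_left, ?_⟩, hr₁.trans hS ⟨le_sup_left,
    𝓕.quot n j, 𝓕.quot_mem n j, ?_⟩, sup_le (hle₁.trans (sup_le_sup_left (𝓕.le_succ n) _))
    (le_sup_of_le_right ?_), hcov⟩
  · intro m x hx i hi
    obtain ⟨h, hh, w, ⟨r, rfl⟩, hx'⟩ := Submodule.mem_sup.1 hx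
    rcases lt_trichotomy m n with hmn | rfl | hmn
    · have hxn : (x : X) ∈ 𝓕.fil n := 𝓕.mono hmn x.2
      have h1 := hH₁j (⟨x, 𝓕.le_succ n hxn⟩ - l r) (by
        simp only [Submodule.coe_sub, ← hx', hl', add_sub_cancel_right]
        exact hh)
      rw [map_sub, (𝓕.gr_eq_zero n ⟨x, 𝓕.le_succ n hxn⟩).2 hxn, zero_sub, hl,
        DFinsupp.neg_apply, DFinsupp.single_eq_same, neg_eq_zero] at h1
      have hxH₁ : (x : X) ∈ H₁ := hx' ▸ H₁.add_mem hh ((hlH₁ r).2 h1)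
      exact (hH₁.2 m x hxH₁ i hi).mono 𝓕 le_sup_left
    · by_cases hij : i = j
      · subst hij
        exact hcov
      · have hxl : ((x - l r : 𝓕.fil (m + 1)) : X) ∈ H₁ := by
          simp only [Submodule.coe_sub, ← hx', hl', add_sub_cancel_right]
          exact hh
        refine (hH₁.2 m _ hxl i ?_).mono 𝓕 le_sup_left
        rw [map_sub, hl, DFinsupp.sub_apply, DFinsupp.single_eq_of_ne hij, sub_zero]
        exact hi
    · have hlm : l' r ∈ 𝓕.fil m := 𝓕.mono hmn (l r).2
      have hxl : ((x - ⟨l' r, 𝓕.le_succ m hlm⟩ : 𝓕.fil (m + 1)) : X) ∈ H₁ := by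
        simp only [Submodule.coe_sub, ← hx', add_sub_cancel_right]
        exact hh
      refine (hH₁.2 m _ hxl i ?_).mono 𝓕 le_sup_left
      rw [map_sub, (𝓕.gr_eq_zero m ⟨l' r, 𝓕.le_succ m hlm⟩).2 hlm, sub_zero]
      exact hi
  · let s : (H₁ × (Fin k → Λ)) →ₗ[Λ] ↥(H₁ ⊔ LinearMap.range l') :=
      (Submodule.inclusion le_sup_left).coprod
        (l'.codRestrict _ (fun r => Submodule.mem_sup_right ⟨r, rfl⟩))
    have hs : ∀ z, (s z : X) = z.1 + l' z.2 := fun z => rfl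
    have hsurj : Function.Surjective s := by
      rintro ⟨x, hx⟩
      obtain ⟨h, hh, w, ⟨r, rfl⟩, hx'⟩ := Submodule.mem_sup.1 hx
      exact ⟨(⟨h, hh⟩, r), Subtype.ext hx'⟩
    obtain ⟨φ, hφ⟩ := exists_factor s hsurj (σ ∘ₗ LinearMap.snd Λ _ _) (by
      rintro ⟨h, r⟩ h0
      have h1 : (h : X) + l' r = 0 := congrArg Subtype.val h0
      refine (hlH₁ r).1 ?_
      rw [← neg_eq_of_add_eq_zero_right h1]
      exact H₁.neg_mem h.2)
    refine ⟨φ, fun y => ?_, fun x => ?_⟩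
    · obtain ⟨r, rfl⟩ := hσ y
      exact ⟨s (0, r), hφ _⟩
    · obtain ⟨⟨h, r⟩, rfl⟩ := hsurj x
      rw [hφ, hs]
      refine (hlH₁ r).symm.trans ?_
      exact (H₁.add_mem_iff_right h.2).symm
  · rintro _ ⟨r, rfl⟩
    exact (l r).2

theorem exists_hill_mem (hS : IsResolvingFP S) (n : ℕ) :
    ∀ H ∈ 𝓕.hill, ∀ x ∈ 𝓕.fil n,
      ∃ H' ∈ 𝓕.hill, QuotMem S H H' ∧ H' ≤ H ⊔ 𝓕.fil n ∧ x ∈ H' := by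
  classical
  induction n with
  | zero => exact fun H hH x hx => ⟨H, hH, QuotMem.refl hS H, le_sup_left, hH.1 hx⟩
  | succ n ih =>
    have key : ∀ v : Π₀ j : 𝓕.cell n, 𝓕.quot n j, ∀ H ∈ 𝓕.hill,
        ∃ H' ∈ 𝓕.hill, QuotMem S H H' ∧ H' ≤ H ⊔ 𝓕.fil (n + 1) ∧
          ∃ z : 𝓕.fil (n + 1), (z : X) ∈ H' ∧ 𝓕.gr n z = v := by
      intro v
      induction v using DFinsupp.induction with
      | h0 =>
        exact fun H hH => ⟨H, hH, QuotMem.refl hS H, le_sup_left, 0, H.zero_mem, map_zero _⟩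
      | ha j b f _ _ hf =>
        intro H hH
        obtain ⟨H₁, hH₁, hr₁, hle₁, z₁, hz₁, hzf⟩ := hf H hH
        obtain ⟨H₂, hH₂, hr₂, hle₂, hcov⟩ := 𝓕.exists_covers hS ih hH₁ j
        obtain ⟨z₂, hz₂, hzb⟩ := hcov b
        refine ⟨H₂, hH₂, hr₁.trans hS hr₂, hle₂.trans (sup_le hle₁ le_sup_right), z₂ + z₁,
          H₂.add_mem hz₂ (hr₂.1 hz₁), ?_⟩
        rw [map_add, hzb, hzf]
    intro H hH x hx
    obtain ⟨H₁, hH₁, hr₁, hle₁, z, hz, hzx⟩ := key (𝓕.gr n ⟨x, hx⟩) H hH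
    have hxz : x - z ∈ 𝓕.fil n := by
      have := (𝓕.gr_eq_zero n (⟨x, hx⟩ - z)).1 (by rw [map_sub, hzx, sub_self])
      exact this
    obtain ⟨H₂, hH₂, hr₂, hle₂, hxz'⟩ := ih H₁ hH₁ _ hxz
    refine ⟨H₂, hH₂, hr₁.trans hS hr₂, hle₂.trans
      (sup_le hle₁ (le_sup_of_le_right (𝓕.le_succ n))), ?_⟩
    have := H₂.add_mem hxz' (hr₂.1 hz)
    rwa [sub_add_cancel] at this

theorem isHillFamily_hill (hS : IsResolvingFP S) : IsHillFamily S (𝓕.fil 0) 𝓕.hill where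
  base_mem := ⟨le_rfl, fun n x hx j hj => by
    rw [(𝓕.gr_eq_zero n x).2 (𝓕.mono (Nat.zero_le n) hx)] at hj
    exact absurd rfl hj⟩
  sSup_mem := by
    intro C hC hne hdir
    obtain ⟨H₀, hH₀⟩ := hne
    refine ⟨(hC hH₀).1.trans (le_sSup hH₀), fun n x hx j hj => ?_⟩
    obtain ⟨H, hH, hxH⟩ := (Submodule.mem_sSup_of_directed ⟨H₀, hH₀⟩ hdir).1 hx
    exact ((hC hH).2 n x hxH j hj).mono 𝓕 (le_sSup hH)
  exists_mem := by
    intro H hH x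
    obtain ⟨n, hn⟩ := 𝓕.exists_mem x
    obtain ⟨H', hH', hr, -, hx⟩ := 𝓕.exists_hill_mem hS n H hH x hn
    exact ⟨H', hH', hr, hx⟩

end SumFiltration

theorem exists_embedding (hS : IsResolvingFP S) (E : Type u) [AddCommGroup E] [Module Λ E] :
    ∃ (J : ModuleCat.{u} Λ) (j : E →ₗ[Λ] J), Function.Injective j ∧ ExtInjective S J ∧
      FactorsThrough S (J ⧸ LinearMap.range j) := by
  obtain ⟨J, j, π, 𝓕, hj, hr, -, -, hπ⟩ := exists_sumFiltration hS (0 : E →ₗ[Λ] PUnit.{u + 1})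
  refine ⟨J, j, hj, hπ.of_equiv (LinearEquiv.ofTop _ ?_), ?_⟩
  · exact eq_top_iff.2 fun x _ => LinearMap.mem_ker.2 rfl
  · rw [hr]
    exact (𝓕.isHillFamily_hill hS).factorsThrough hS

/-- One stage of the coresolution used to solve extension problems along `i : M → L`. -/
structure CoresolutionStage (S : Set (ModuleCat.{u} Λ)) {M L : Type u} [AddCommGroup M]
    [Module Λ M] [AddCommGroup L] [Module Λ L] (p : L →ₗ[Λ] M) where
  obj : ModuleCat.{u} Λ
  coker : ModuleCat.{u} Λ
  q : obj →ₗ[Λ] coker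
  f : L →ₗ[Λ] obj
  g : M →ₗ[Λ] coker
  comm : ∀ x, q (f x) = g (p x)
  obj_injective : ExtInjective S obj
  coker_injective : ExtInjective S coker
  lift : ∀ (P : Type u) [AddCommGroup P] [Module Λ P], Module.FinitePresentation Λ P →
    ∀ h : P →ₗ[Λ] coker, ∃ h' : P →ₗ[Λ] obj, ∀ x, q (h' x) = h x

theorem CoresolutionStage.exists_next (hS : IsResolvingFP S) {M L : Type u} [AddCommGroup M]
    [Module Λ M] [AddCommGroup L] [Module Λ L] (i : M →ₗ[Λ] L) (p : L →ₗ[Λ] M)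
    (hi : Function.Injective i) (hp : Function.Surjective p) (he : Function.Exact i p)
    (hM : FactorsThrough S M) (s : CoresolutionStage S p) :
    ∃ (t : CoresolutionStage S p) (ι : s.coker →ₗ[Λ] t.obj), Function.Injective ι ∧
      Function.Exact ι t.q ∧ ∀ x, t.f (i x) = ι (s.g x) := by
  obtain ⟨E, i', a, p', hi', hp', he', hai, -, -⟩ := exists_pushout i hi p hp he s.g
  obtain ⟨J, j, hj, hJ, hJE⟩ := exists_embedding hS E
  let ι : s.coker →ₗ[Λ] J := j ∘ₗ i'
  have hι : Function.Injective ι := hj.comp hi'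
  let q : J →ₗ[Λ] J ⧸ LinearMap.range ι := (LinearMap.range ι).mkQ
  have hq : Function.Surjective q := Submodule.mkQ_surjective _
  have hιq : Function.Exact ι q := LinearMap.exact_map_mkQ_range ι
  have hq0 : ∀ x, q (ι x) = 0 := fun x => (hιq _).2 ⟨x, rfl⟩
  have hK : ExtInjective S (J ⧸ LinearMap.range ι) :=
    s.coker_injective.coker hS hJ ι q hι hq hιq
  obtain ⟨g, hg⟩ := exists_factor p hp (q ∘ₗ j ∘ₗ a) (fun x hx => by
    obtain ⟨y, rfl⟩ := (he x).1 hx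
    simp only [LinearMap.comp_apply, hai]
    exact hq0 _)
  have hfac : FactorsThrough S (J ⧸ LinearMap.range ι) := by
    obtain ⟨b, hb⟩ := exists_factor p' hp' (q ∘ₗ j) (fun x hx => by
      obtain ⟨y, rfl⟩ := (he' x).1 hx
      exact hq0 y)
    have hj0 : ∀ x, (LinearMap.range j).mkQ x = 0 ↔ x ∈ LinearMap.range j := fun x => by simp
    obtain ⟨c, hc⟩ := exists_factor q hq (LinearMap.range j).mkQ (fun x hx => by
      obtain ⟨y, rfl⟩ := (hιq x).1 hx
      exact (hj0 _).2 ⟨i' y, rfl⟩)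
    refine FactorsThrough.extension hS b c ?_ ?_ ?_ hM hJE
    · refine (injective_iff_map_eq_zero b).2 fun t ht => ?_
      obtain ⟨x, rfl⟩ := hp' t
      rw [hb] at ht
      obtain ⟨y, hy⟩ := (hιq _).1 ht
      exact (he' x).2 ⟨y, hj hy⟩
    · intro t
      obtain ⟨x, rfl⟩ := (LinearMap.range j).mkQ_surjective t
      exact ⟨q x, hc x⟩
    · intro t
      obtain ⟨x, rfl⟩ := hq t
      rw [hc, hj0]
      constructor
      · rintro ⟨y, rfl⟩
        exact ⟨p' y, hb y⟩
      · rintro ⟨y, hy⟩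
        obtain ⟨z, rfl⟩ := hp' y
        rw [hb] at hy
        obtain ⟨k, hk⟩ := (hιq (j z - x)).1 (by
          rw [map_sub, sub_eq_zero]
          exact hy)
        refine ⟨z - i' k, ?_⟩
        have hk : j (i' k) = j z - x := hk
        rw [map_sub, hk, sub_sub_cancel]
  exact ⟨{
    obj := J
    coker := ModuleCat.of Λ (J ⧸ LinearMap.range ι)
    q := q
    f := j ∘ₗ a
    g := g
    comm := fun x => (hg x).symm
    obj_injective := hJ
    coker_injective := hK
    lift := fun P _ _ hP h =>
      hfac.exists_lift hS s.coker_injective ι q hι hq hιq hP h }, ι, hι, hιq,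
      fun x => congrArg j (hai x)⟩

/-- A cochain complex of `ExtInjective` modules, exact after applying `Hom(P, -)` for finitely
presented `P`. -/
structure PureExactComplex (S : Set (ModuleCat.{u} Λ)) where
  X : ℕ → ModuleCat.{u} Λ
  δ : ∀ n, X n →ₗ[Λ] X (n + 1)
  δ_δ : ∀ n x, δ (n + 1) (δ n x) = 0
  injective : ∀ n, ExtInjective S (X n)
  lift : ∀ n (P : Type u) [AddCommGroup P] [Module Λ P], Module.FinitePresentation Λ P →
    ∀ h : P →ₗ[Λ] X (n + 1), (∀ x, δ (n + 1) (h x) = 0) → ∃ h' : P →ₗ[Λ] X n,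
      ∀ x, δ n (h' x) = h x

theorem exists_pureExactComplex (hS : IsResolvingFP S) {M L B : Type u} [AddCommGroup M]
    [Module Λ M] [AddCommGroup L] [Module Λ L] [AddCommGroup B] [Module Λ B] (i : M →ₗ[Λ] L)
    (p : L →ₗ[Λ] M) (hi : Function.Injective i) (hp : Function.Surjective p)
    (he : Function.Exact i p) (hM : FactorsThrough S M) (hB : ExtInjective S B)
    (g : M →ₗ[Λ] B) :
    ∃ (C : PureExactComplex S) (f : ∀ n, L →ₗ[Λ] C.X n) (β : C.X 1 →ₗ[Λ] B),
      (∀ n x, f (n + 1) (i (p x)) = C.δ n (f n x)) ∧ (∀ x, C.δ 0 x = 0) ∧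
      ∀ x, β (f 1 x) = g (p x) := by
  choose next ι hι hex hf using
    fun s : CoresolutionStage S p => s.exists_next hS i p hi hp he hM
  let s₀ : CoresolutionStage S p :=
    { obj := ModuleCat.of Λ B
      coker := ModuleCat.of Λ B
      q := LinearMap.id
      f := g ∘ₗ p
      g := g
      comm := fun _ => rfl
      obj_injective := hB
      coker_injective := hB
      lift := fun P _ _ _ h => ⟨h, fun _ => rfl⟩ }
  let s : ℕ → CoresolutionStage S p := fun n => Nat.rec s₀ (fun _ t => next t) n
  let X : ℕ → ModuleCat.{u} Λ
    | 0 => ModuleCat.of Λ PUnit.{u + 1}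
    | n + 1 => (s n).obj
  let δ : ∀ n : ℕ, X n →ₗ[Λ] X (n + 1)
    | 0 => 0
    | n + 1 => ι (s n) ∘ₗ (s n).q
  let f : ∀ n : ℕ, L →ₗ[Λ] X n
    | 0 => 0
    | n + 1 => (s n).f
  have hpi : ∀ x, p (i x) = 0 := fun x => (he _).2 ⟨x, rfl⟩
  refine ⟨{
    X := X
    δ := δ
    δ_δ := ?_
    injective := ?_
    lift := ?_ }, f, LinearMap.id, ?_, fun _ => rfl, fun _ => rfl⟩
  · rintro (_ | n) x
    · exact map_zero (δ 1)
    · change ι (s (n + 1)) ((s (n + 1)).q (ι (s n) ((s n).q x))) = 0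
      have h0 : (s (n + 1)).q (ι (s n) ((s n).q x)) = 0 := (hex (s n) _).2 ⟨_, rfl⟩
      rw [h0, map_zero]
  · rintro (_ | n)
    · exact fun k Ω hΩ f => ⟨0, fun x => rfl⟩
    · exact (s n).obj_injective
  · rintro (_ | n) P _ _ hP h hh
    · refine ⟨0, fun x => ?_⟩
      exact (hι s₀ ((hh x).trans (map_zero (ι s₀)).symm)).symm
    · have h0 : ∀ x, (s (n + 1)).q (h x) = 0 := fun x =>
        hι (s (n + 1)) ((hh x).trans (map_zero (ι (s (n + 1)))).symm)
      obtain ⟨a, ha⟩ := exists_cofactor (ι (s n)) (hι _) (s (n + 1)).q (hex (s n)) h h0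
      obtain ⟨b, hb⟩ := (s n).lift P hP a
      exact ⟨b, fun x => (congrArg (ι (s n)) (hb x)).trans (ha x)⟩
  · rintro (_ | n) x
    · change g (p (i (p x))) = 0
      rw [hpi, map_zero]
    · exact (hf (s n) (p x)).trans (congrArg (ι (s n)) ((s n).comm x).symm)

theorem finitePresentation_quotient {P : Type u} [AddCommGroup P] [Module Λ P]
    (hP : Module.FinitePresentation Λ P) {N : Submodule Λ P} (hN : N.FG) :
    Module.FinitePresentation Λ (P ⧸ N) :=
  Module.finitePresentation_of_surjective N.mkQ N.mkQ_surjective (by rwa [Submodule.ker_mkQ])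

namespace PureExactComplex

variable (C : PureExactComplex S)

/-- Chain maps (of degree one) from complexes of finitely presented modules are null-homotopic. -/
theorem exists_homotopy (P : ℕ → ModuleCat.{u} Λ)
    (hP : ∀ n, Module.FinitePresentation Λ (P n)) (d : ∀ n, P n →ₗ[Λ] P (n + 1))
    (hd : ∀ n x, d (n + 1) (d n x) = 0) (φ : ∀ n, P n →ₗ[Λ] C.X (n + 1))
    (hφ : ∀ n x, φ (n + 1) (d n x) = C.δ (n + 1) (φ n x)) :
    ∃ t : ∀ n, P n →ₗ[Λ] C.X n, ∀ n x, φ n x = C.δ n (t n x) + t (n + 1) (d n x) := by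
  let D : ∀ n : ℕ, Submodule Λ (P n)
    | 0 => ⊥
    | n + 1 => LinearMap.range (d n)
  have hDfg : ∀ n, (D n).FG := by
    rintro (_ | n)
    · exact Submodule.fg_bot
    · change (LinearMap.range (d n)).FG
      have := hP n
      rw [LinearMap.range_eq_map]
      exact Submodule.FG.map _ Module.Finite.fg_top
  have hDd : ∀ n, ∀ x ∈ D n, d n x = 0 := by
    rintro (_ | n) x hx
    · rw [(Submodule.mem_bot Λ).1 hx, map_zero]
    · obtain ⟨y, rfl⟩ := hx
      exact hd n y
  have step : ∀ n (u : {u : P n →ₗ[Λ] C.X n // ∀ x ∈ D n, C.δ n (u x) = φ n x}),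
      ∃ (u' : {u : P (n + 1) →ₗ[Λ] C.X (n + 1) // ∀ x ∈ D (n + 1), C.δ (n + 1) (u x) = φ (n + 1) x})
        (v : P n →ₗ[Λ] C.X n), (∀ x ∈ D n, v x = 0) ∧
          ∀ x, φ n x = C.δ n (u.1 x) + C.δ n (v x) + u'.1 (d n x) := by
    rintro n ⟨u, hu⟩
    have hfp : ∀ m, Module.FinitePresentation Λ (P m ⧸ D m) := fun m =>
      finitePresentation_quotient (hP m) (hDfg m)
    have hmk : ∀ m x, (D m).mkQ x = 0 → x ∈ D m := fun m x hx => by simpa using hx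
    obtain ⟨h, hh⟩ := exists_factor (D (n + 1)).mkQ (Submodule.mkQ_surjective _)
      (C.δ (n + 2) ∘ₗ φ (n + 1)) (fun x hx => by
        obtain ⟨y, rfl⟩ := hmk _ x hx
        rw [LinearMap.comp_apply, hφ, C.δ_δ])
    obtain ⟨τ, hτ⟩ := C.lift (n + 2) _ (hfp (n + 1)) h (fun x => by
      obtain ⟨y, rfl⟩ := (D (n + 1)).mkQ_surjective x
      rw [hh, LinearMap.comp_apply, C.δ_δ])
    obtain ⟨u', hu'⟩ := C.lift (n + 1) _ (hP (n + 1)) (φ (n + 1) - τ ∘ₗ (D (n + 1)).mkQ)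
      (fun x => by
        rw [LinearMap.sub_apply, LinearMap.comp_apply, map_sub, hτ, hh, LinearMap.comp_apply,
          sub_self])
    have hu'd : ∀ x ∈ D (n + 1), C.δ (n + 1) (u' x) = φ (n + 1) x := fun x hx => by
      have h0 : (D (n + 1)).mkQ x = 0 := by simpa using hx
      rw [hu', LinearMap.sub_apply, LinearMap.comp_apply, h0, map_zero, sub_zero]
    obtain ⟨w, hw⟩ := exists_factor (D n).mkQ (Submodule.mkQ_surjective _)
      (φ n - C.δ n ∘ₗ u - u' ∘ₗ d n) (fun x hx => by
        have hx := hmk _ x hx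
        simp [hu x hx, hDd n x hx])
    obtain ⟨v, hv⟩ := C.lift n _ (hfp n) w (fun x => by
      obtain ⟨y, rfl⟩ := (D n).mkQ_surjective x
      have h1 : C.δ (n + 1) (u' (d n y)) = φ (n + 1) (d n y) := hu'd _ ⟨y, rfl⟩
      rw [hw]
      simp [C.δ_δ, h1, hφ])
    refine ⟨⟨u', hu'd⟩, v ∘ₗ (D n).mkQ, fun x hx => ?_, fun x => ?_⟩
    · have h0 : (D n).mkQ x = 0 := by simpa using hx
      rw [LinearMap.comp_apply, h0, map_zero]
    · rw [LinearMap.comp_apply, hv, hw]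
      simp only [LinearMap.sub_apply, LinearMap.comp_apply]
      abel
  choose next v hv hnext using step
  let u : ∀ n, {u : P n →ₗ[Λ] C.X n // ∀ x ∈ D n, C.δ n (u x) = φ n x} := fun n =>
    Nat.rec ⟨0, fun x hx => by rw [(Submodule.mem_bot Λ).1 hx]; simp⟩ next n
  refine ⟨fun n => (u n).1 + v n (u n), fun n x => ?_⟩
  have h0 : v (n + 1) (u (n + 1)) (d n x) = 0 := hv (n + 1) _ _ ⟨x, rfl⟩
  rw [LinearMap.add_apply, LinearMap.add_apply, h0, map_add, add_zero]
  exact hnext n (u n) x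

end PureExactComplex

theorem QuotMem.exists_fg (hS : IsResolvingFP S) {X : Type u} [AddCommGroup X] [Module Λ X]
    {H H' : Submodule Λ X} (h : QuotMem S H H') :
    ∃ N : Submodule Λ X, N.FG ∧ H' ≤ H ⊔ N := by
  obtain ⟨hle, T, hT, φ, hφ, hφ0⟩ := h
  have := hS.fp T hT
  obtain ⟨n, s, hs⟩ := Module.Finite.exists_fin' Λ T
  obtain ⟨l, hl⟩ := Module.projective_lifting_property φ s hφ
  have hl : ∀ x, φ (l x) = s x := fun x => LinearMap.congr_fun hl x
  refine ⟨LinearMap.range (H'.subtype ∘ₗ l), ?_, fun x hx => ?_⟩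
  · rw [LinearMap.range_eq_map]
    exact Submodule.FG.map _ Module.Finite.fg_top
  · obtain ⟨r, hr⟩ := hs (φ ⟨x, hx⟩)
    have h0 : φ (⟨x, hx⟩ - l r) = 0 := by rw [map_sub, hl, hr, sub_self]
    exact Submodule.mem_sup.2 ⟨_, (hφ0 _).1 h0, _, ⟨r, rfl⟩, by simp⟩

theorem IsHillFamily.exists_subcomplex (hS : IsResolvingFP S) {F : Type u} [AddCommGroup F]
    [Module Λ F] {X₀ : Submodule Λ F} {𝓗 : Set (Submodule Λ F)} (h𝓗 : IsHillFamily S X₀ 𝓗)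
    (d : F →ₗ[Λ] F) (H : ℕ → Submodule Λ F) (hH : ∀ n, H n ∈ 𝓗)
    (hd : ∀ n, ∀ x ∈ H n, d x ∈ H (n + 1)) (y : ℕ → F) :
    ∃ H' : ℕ → Submodule Λ F, (∀ n, H' n ∈ 𝓗) ∧ (∀ n, QuotMem S (H n) (H' n)) ∧
      (∀ n, y n ∈ H' n) ∧ ∀ n, ∀ x ∈ H' n, d x ∈ H' (n + 1) := by
  have base : ∃ K, K ∈ 𝓗 ∧ QuotMem S (H 0) K ∧ y 0 ∈ K := by
    obtain ⟨K, hK, hq, hy⟩ := h𝓗.exists_mem _ (hH 0) (y 0)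
    exact ⟨K, hK, hq, hy⟩
  have step : ∀ n (K : {K // K ∈ 𝓗 ∧ QuotMem S (H n) K ∧ y n ∈ K}),
      ∃ K' : {K // K ∈ 𝓗 ∧ QuotMem S (H (n + 1)) K ∧ y (n + 1) ∈ K},
        ∀ x ∈ K.1, d x ∈ K'.1 := by
    rintro n ⟨K, hK, hq, -⟩
    obtain ⟨N, hN, hle⟩ := hq.exists_fg hS
    obtain ⟨K', hK', hq', hle'⟩ := h𝓗.exists_fg_le hS
      ((hN.map d).sup (Submodule.fg_span_singleton (y (n + 1)))) (hH (n + 1))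
    refine ⟨⟨K', hK', hq', hle' (Submodule.mem_sup_right (Submodule.mem_span_singleton_self _))⟩,
      fun x hx => ?_⟩
    obtain ⟨a, ha, b, hb, rfl⟩ := Submodule.mem_sup.1 (hle hx)
    rw [map_add]
    exact K'.add_mem (hq'.1 (hd n a ha))
      (hle' (Submodule.mem_sup_left (Submodule.mem_map_of_mem hb)))
  choose next hnext using step
  let K : ∀ n, {K // K ∈ 𝓗 ∧ QuotMem S (H n) K ∧ y n ∈ K} := fun n =>
    Nat.rec ⟨base.choose, base.choose_spec⟩ next n
  exact ⟨fun n => (K n).1, fun n => (K n).2.1, fun n => (K n).2.2.1, fun n => (K n).2.2.2,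
    fun n x hx => hnext n (K n) x hx⟩

namespace PureExactComplex

variable (C : PureExactComplex S) {F : Type u} [AddCommGroup F] [Module Λ F]

/-- A homotopy from `f` to zero, defined on submodules belonging to `𝓗`. -/
structure IsPartialHomotopy (𝓗 : Set (Submodule Λ F)) (d : F →ₗ[Λ] F)
    (f : ∀ n, F →ₗ[Λ] C.X n) (s : ∀ n, F →ₗ.[Λ] C.X n) : Prop where
  domain_mem : ∀ n, (s n).domain ∈ 𝓗
  map_mem : ∀ n, ∀ x ∈ (s n).domain, d x ∈ (s (n + 1)).domain
  eq : ∀ n (x : (s n).domain) (y : (s (n + 1)).domain), (y : F) = d x →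
    f (n + 1) x = C.δ n (s n x) + s (n + 1) y

variable {C} {𝓗 : Set (Submodule Λ F)} {d : F →ₗ[Λ] F} {f : ∀ n, F →ₗ[Λ] C.X n}

theorem IsPartialHomotopy.bot (h𝓗 : IsHillFamily S ⊥ 𝓗) :
    C.IsPartialHomotopy 𝓗 d f (fun _ => ⊥) where
  domain_mem _ := h𝓗.base_mem
  map_mem n x hx := by
    rw [(Submodule.mem_bot Λ).1 hx, map_zero]
    exact Submodule.zero_mem _
  eq n x y _ := by
    have hx : x = 0 := Subtype.ext ((Submodule.mem_bot Λ).1 x.2)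
    have hy : y = 0 := Subtype.ext ((Submodule.mem_bot Λ).1 y.2)
    simp [hx, hy]

theorem IsPartialHomotopy.exists_upperBound {X₀ : Submodule Λ F} (h𝓗 : IsHillFamily S X₀ 𝓗)
    {c : Set (∀ n, F →ₗ.[Λ] C.X n)} (hc : ∀ s ∈ c, C.IsPartialHomotopy 𝓗 d f s)
    (hchain : IsChain (· ≤ ·) c) (hne : c.Nonempty) :
    ∃ t, C.IsPartialHomotopy 𝓗 d f t ∧ ∀ s ∈ c, s ≤ t := by
  have hdir : ∀ n, DirectedOn (· ≤ ·) ((fun s : ∀ n, F →ₗ.[Λ] C.X n => s n) '' c) := by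
    rintro n _ ⟨s, hs, rfl⟩ _ ⟨t, ht, rfl⟩
    rcases hchain.total hs ht with h | h
    · exact ⟨t n, ⟨t, ht, rfl⟩, h n, le_rfl⟩
    · exact ⟨s n, ⟨s, hs, rfl⟩, le_rfl, h n⟩
  let t : ∀ n, F →ₗ.[Λ] C.X n := fun n => LinearPMap.sSup _ (hdir n)
  have hle : ∀ s ∈ c, ∀ n, s n ≤ t n := fun s hs n => LinearPMap.le_sSup (hdir n) ⟨s, hs, rfl⟩
  have hmem : ∀ n x, x ∈ (t n).domain → ∃ s ∈ c, x ∈ (s n).domain := fun n x hx => by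
    obtain ⟨_, ⟨s, hs, rfl⟩, h⟩ :=
      (LinearPMap.mem_domain_sSup_iff (hne.image _) (hdir n)).1 hx
    exact ⟨s, hs, h⟩
  refine ⟨t, ⟨fun n => ?_, fun n x hx => ?_, fun n x y hxy => ?_⟩, hle⟩
  · refine h𝓗.sSup_mem _ ?_ ((hne.image _).image _) ?_
    · rintro _ ⟨_, ⟨s, hs, rfl⟩, rfl⟩
      exact (hc s hs).domain_mem n
    · rintro _ ⟨a, ha, rfl⟩ _ ⟨b, hb, rfl⟩
      obtain ⟨e, he, hae, hbe⟩ := hdir n a ha b hb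
      exact ⟨_, ⟨e, he, rfl⟩, hae.1, hbe.1⟩
  · obtain ⟨s, hs, h⟩ := hmem n x hx
    exact (hle s hs (n + 1)).1 ((hc s hs).map_mem n x h)
  · obtain ⟨s, hs, h⟩ := hmem n x x.2
    have hy : (y : F) ∈ (s (n + 1)).domain := by
      rw [hxy]
      exact (hc s hs).map_mem n x h
    have h1 := (hc s hs).eq n ⟨x, h⟩ ⟨y, hy⟩ hxy
    rw [(hle s hs n).2 (x := ⟨x, h⟩) (y := x) rfl,
      (hle s hs (n + 1)).2 (x := ⟨y, hy⟩) (y := y) rfl] at h1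
    exact h1

theorem IsPartialHomotopy.exists_le (hS : IsResolvingFP S) {X₀ : Submodule Λ F}
    (h𝓗 : IsHillFamily S X₀ 𝓗) (hdd : ∀ x, d (d x) = 0)
    (hf : ∀ n x, f (n + 1) (d x) = C.δ n (f n x)) {s : ∀ n, F →ₗ.[Λ] C.X n}
    (hs : C.IsPartialHomotopy 𝓗 d f s) (y : ℕ → F) :
    ∃ s', C.IsPartialHomotopy 𝓗 d f s' ∧ s ≤ s' ∧ ∀ n, y n ∈ (s' n).domain := by
  obtain ⟨H, hH, hq, hy, hHd⟩ := h𝓗.exists_subcomplex hS d (fun n => (s n).domain)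
    hs.domain_mem hs.map_mem y
  choose hle T hT φ hφ hφ0 using hq
  let d' : ∀ n, H n →ₗ[Λ] H (n + 1) := fun n => d.restrict (hHd n)
  have hd' : ∀ n x, (d' n x : F) = d x := fun n x => rfl
  have hdT : ∀ n, ∃ e : T n →ₗ[Λ] T (n + 1), ∀ x, e (φ n x) = φ (n + 1) (d' n x) := fun n => by
    refine exists_factor (φ n) (hφ n) (φ (n + 1) ∘ₗ d' n) fun x hx => ?_
    exact (hφ0 _ _).2 (hs.map_mem n x ((hφ0 n x).1 hx))
  choose dT hdT using hdT
  have hext : ∀ n, ∃ r : H n →ₗ[Λ] C.X n, ∀ x, r (Submodule.inclusion (hle n) x) = s n x :=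
    fun n => (C.injective n).exists_extend hS (Submodule.inclusion (hle n)) (φ n)
      (Submodule.inclusion_injective _) (hφ n) (fun x => by
        rw [hφ0]
        exact ⟨fun h => ⟨⟨x, h⟩, rfl⟩, fun ⟨z, hz⟩ => hz ▸ z.2⟩) (hT n) (s n).toFun
  choose r hr using hext
  have hr : ∀ n (x : H n) (h : (x : F) ∈ (s n).domain), r n x = s n ⟨x, h⟩ :=
    fun n x h => hr n ⟨x, h⟩
  have hψ : ∀ n, ∃ ψ : T n →ₗ[Λ] C.X (n + 1), ∀ x, ψ (φ n x) =
      f (n + 1) x - C.δ n (r n x) - r (n + 1) (d' n x) := fun n => by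
    refine exists_factor (φ n) (hφ n)
      (f (n + 1) ∘ₗ (H n).subtype - C.δ n ∘ₗ r n - r (n + 1) ∘ₗ d' n) fun x hx => ?_
    have hx := (hφ0 n x).1 hx
    have hdx := hs.map_mem n x hx
    have h1 := hs.eq n ⟨x, hx⟩ ⟨d x, hdx⟩ rfl
    simp only [LinearMap.sub_apply, LinearMap.comp_apply, Submodule.subtype_apply]
    rw [hr n x hx, hr (n + 1) (d' n x) hdx, h1]
    change _ - _ - s (n + 1) ⟨d x, hdx⟩ = 0
    abel
  choose ψ hψ using hψ
  have hdd' : ∀ n x, d' (n + 1) (d' n x) = 0 := fun n x => Subtype.ext (hdd x)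
  obtain ⟨t, ht⟩ := C.exists_homotopy T (fun n => hS.fp _ (hT n)) dT (fun n z => by
    obtain ⟨x, rfl⟩ := hφ n z
    rw [hdT, hdT, hdd', map_zero]) ψ (fun n z => by
    obtain ⟨x, rfl⟩ := hφ n z
    rw [hdT, hψ, hψ, hdd', hd', hf]
    simp [C.δ_δ])
  refine ⟨fun n => ⟨H n, r n + t n ∘ₗ φ n⟩, ⟨hH, hHd, fun n x z hxz => ?_⟩, fun n => ?_, hy⟩
  · have hz : z = d' n x := Subtype.ext hxz
    have h1 := ht n (φ n x)
    rw [hψ, hdT] at h1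
    change f (n + 1) x = C.δ n (r n x + t n (φ n x)) + (r (n + 1) z + t (n + 1) (φ (n + 1) z))
    rw [hz, map_add, ← sub_eq_zero]
    rw [← sub_eq_zero] at h1
    rw [← h1]
    abel
  · refine ⟨hle n, fun x z hxz => ?_⟩
    have hz : (z : F) ∈ (s n).domain := hxz ▸ x.2
    have h0 : φ n z = 0 := (hφ0 n z).2 hz
    change s n x = r n z + t n (φ n z)
    rw [h0, map_zero, add_zero, hr n z hz]
    exact congrArg (s n) (Subtype.ext hxz)

theorem exists_homotopy_of_isHillFamily (hS : IsResolvingFP S) (h𝓗 : IsHillFamily S ⊥ 𝓗)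
    (hdd : ∀ x, d (d x) = 0) (hf : ∀ n x, f (n + 1) (d x) = C.δ n (f n x)) :
    ∃ s : ∀ n, F →ₗ[Λ] C.X n, ∀ n x, f (n + 1) x = C.δ n (s n x) + s (n + 1) (d x) := by
  obtain ⟨s, -, hs⟩ := zorn_le_nonempty₀ {s | C.IsPartialHomotopy 𝓗 d f s}
    (fun c hc hchain y hy => IsPartialHomotopy.exists_upperBound h𝓗 hc hchain ⟨y, hy⟩) _
    (IsPartialHomotopy.bot h𝓗)
  have hdom : ∀ n x, x ∈ (s n).domain := fun n x => by
    obtain ⟨s', hs', hle, hx⟩ := hs.prop.exists_le hS h𝓗 hdd hf (fun _ => x)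
    exact (hs.le_of_ge hs' hle n).1 (hx n)
  exact ⟨fun n => (s n).toFun ∘ₗ LinearMap.id.codRestrict _ (hdom n),
    fun n x => hs.prop.eq n ⟨x, hdom n x⟩ ⟨d x, hdom (n + 1) (d x)⟩ rfl⟩

end PureExactComplex

/-- Maps from a module in `leftPerp (rightPerp S)` lift along surjections with kernel in
`rightPerp S`. -/
theorem exists_lift_of_mem_leftPerp {L : ModuleCat.{u} Λ} {B E M : Type u} [AddCommGroup B]
    [Module Λ B] [AddCommGroup E] [Module Λ E] [AddCommGroup M] [Module Λ M]
    (hL : L ∈ leftPerp (rightPerp S)) (hB : ModuleCat.of Λ B ∈ rightPerp S) (ι : B →ₗ[Λ] E)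
    (q : E →ₗ[Λ] M) (hι : Function.Injective ι) (hq : Function.Surjective q)
    (he : Function.Exact ι q) (p : L →ₗ[Λ] M) : ∃ r : L →ₗ[Λ] E, ∀ x, q (r x) = p x := by
  let W : Submodule Λ (E × L) :=
    LinearMap.ker (q ∘ₗ LinearMap.fst Λ E L - p ∘ₗ LinearMap.snd Λ E L)
  have hW : ∀ x : E × L, x ∈ W ↔ q x.1 = p x.2 := fun x => by simp [W, sub_eq_zero]
  let a : B →ₗ[Λ] W := (LinearMap.inl Λ E L ∘ₗ ι).codRestrict W fun x =>
    (hW _).2 (by simpa using (he _).2 ⟨x, rfl⟩)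
  let b : W →ₗ[Λ] L := LinearMap.snd Λ E L ∘ₗ W.subtype
  obtain ⟨w, hw⟩ := shortExact_of a b
    (fun x y h => hι (congrArg (fun z : W => (z : E × L).1) h))
    (fun x => by
      obtain ⟨e, he⟩ := hq (p x)
      exact ⟨⟨(e, x), (hW _).2 he⟩, rfl⟩)
    (by
      rintro ⟨⟨e, x⟩, hx⟩
      constructor
      · intro (h : x = 0)
        subst h
        obtain ⟨y, rfl⟩ := (he e).1 (by simpa using (hW _).1 hx)
        exact ⟨y, rfl⟩
      · rintro ⟨y, hy⟩
        exact (congrArg (fun z : W => (z : E × L).2) hy).symm)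
  obtain ⟨s, hs⟩ := hL _ hB _ _ _ w hw
  have hs : ∀ x, b (s.hom x) = x := fun x => congrArg (fun t => t.hom x) hs
  refine ⟨LinearMap.fst Λ E L ∘ₗ W.subtype ∘ₗ s.hom, fun x => ?_⟩
  exact ((hW _).1 (s.hom x).2).trans (congrArg p (hs x))

/-- Maps into modules in `rightPerp S` extend along `i : M → L` when `M` is a periodic module. -/
theorem exists_extend_of_periodic (hS : IsResolvingFP S) {M L : ModuleCat.{u} Λ}
    {B : Type u} [AddCommGroup B] [Module Λ B] (i : M →ₗ[Λ] L) (p : L →ₗ[Λ] M)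
    (hi : Function.Injective i) (hp : Function.Surjective p) (he : Function.Exact i p)
    (hM : FactorsThrough S M) (hL : L ∈ leftPerp (rightPerp S)) (hB : ExtInjective S B)
    (g : M →ₗ[Λ] B) : ∃ g' : L →ₗ[Λ] B, ∀ x, g' (i x) = g x := by
  obtain ⟨C, f, β, hf, hδ, hβ⟩ := exists_pureExactComplex hS i p hi hp he hM hB g
  obtain ⟨F, j, π, 𝓕, hj, hr, -, hπ, hK⟩ :=
    exists_sumFiltration hS (0 : PUnit.{u + 1} →ₗ[Λ] L)
  have hbot : 𝓕.fil 0 = ⊥ := by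
    rw [← hr, eq_bot_iff]
    rintro _ ⟨x, rfl⟩
    rw [Submodule.mem_bot, Subsingleton.elim x 0, map_zero]
  have hill := 𝓕.isHillFamily_hill hS
  rw [hbot] at hill
  obtain ⟨σ, hσ⟩ := exists_lift_of_mem_leftPerp hL ((mem_rightPerp_iff hS _).2 hK)
    (LinearMap.ker π).subtype π Subtype.val_injective hπ (LinearMap.exact_subtype_ker_map π)
    LinearMap.id
  have hσ : ∀ x, π (σ x) = x := hσ
  have hpi : ∀ x, p (i x) = 0 := fun x => (he _).2 ⟨x, rfl⟩
  obtain ⟨s, hs⟩ := PureExactComplex.exists_homotopy_of_isHillFamily (C := C)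
    (d := σ ∘ₗ i ∘ₗ p ∘ₗ π) (f := fun n => f n ∘ₗ π) hS hill
    (fun x => by simp [hσ, hpi]) (fun n x => by simp [hσ, hf])
  refine ⟨β ∘ₗ s 1 ∘ₗ σ, fun x => ?_⟩
  obtain ⟨l, rfl⟩ := hp x
  have h1 := hs 0 (σ l)
  rw [hδ] at h1
  simp only [LinearMap.comp_apply, hσ] at h1
  rw [← hβ, h1]
  exact (congrArg β (zero_add _)).symm

theorem mem_leftPerp_of_periodic (hS : IsResolvingFP S) {M L : ModuleCat.{u} Λ}
    (i : M →ₗ[Λ] L) (p : L →ₗ[Λ] M) (hi : Function.Injective i) (hp : Function.Surjective p)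
    (he : Function.Exact i p) (hM : FactorsThrough S M) (hL : L ∈ leftPerp (rightPerp S)) :
    M ∈ leftPerp (rightPerp S) := by
  intro B hB E ι q w hse
  obtain ⟨hι, hq, hex⟩ := (shortExact_iff ι q w).1 hse
  obtain ⟨r, hr⟩ := exists_lift_of_mem_leftPerp hL hB ι.hom q.hom hι hq hex p
  obtain ⟨g, hg⟩ := exists_cofactor ι.hom hι q.hom hex (r ∘ₗ i) (fun x => by
    rw [LinearMap.comp_apply, hr]
    exact (he _).2 ⟨x, rfl⟩)
  obtain ⟨g', hg'⟩ := exists_extend_of_periodic hS i p hi hp he hM hL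
    ((mem_rightPerp_iff hS B).1 hB) g
  obtain ⟨s, hs⟩ := exists_factor p hp (r - ι.hom ∘ₗ g') (fun x hx => by
    obtain ⟨y, rfl⟩ := (he x).1 hx
    simp [hg', hg])
  refine ⟨ModuleCat.ofHom s, ModuleCat.hom_ext (LinearMap.ext fun x => ?_)⟩
  obtain ⟨l, rfl⟩ := hp x
  change q.hom (s (p l)) = p l
  have h0 : q.hom (ι.hom (g' l)) = 0 := (hex _).2 ⟨_, rfl⟩
  rw [hs, LinearMap.sub_apply, LinearMap.comp_apply, map_sub, h0, hr, sub_zero]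
end Modules

theorem statement0 {R : Type u} [Ring R] (S : Set (ModuleCat.{u} Rᵐᵒᵖ))
    (hfp : ∀ M ∈ S, Module.FinitePresentation Rᵐᵒᵖ M)
    (hfree : ModuleCat.of Rᵐᵒᵖ Rᵐᵒᵖ ∈ S)
    (hext : ClosedUnderExtensions S)
    (hker : ClosedUnderKernelsOfEpis S)
    (B A C : Set (ModuleCat.{u} Rᵐᵒᵖ))
    (hB : B = rightPerp S) (hA : A = leftPerp B) (hC : C = limClosure S)
    (M L : ModuleCat.{u} Rᵐᵒᵖ) (i : M ⟶ L) (p : L ⟶ M) (w : i ≫ p = 0)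
    (hse : (ShortComplex.mk i p w).ShortExact)
    (hL : L ∈ A) (hM : M ∈ C) :
    M ∈ A := by
  subst hB hA hC
  obtain ⟨hi, hp, he⟩ := (shortExact_iff i p w).1 hse
  have hS : IsResolvingFP S := ⟨hfp, hfree, hext, hker⟩
  exact mem_leftPerp_of_periodic hS i.hom p.hom hi hp he (FactorsThrough.of_mem_limClosure hM) hL

end GenPeriodicity
end

section
/- Let R be a ring and S a class of finitely presented right R-modules containing the free module R and closed under extensions and kernels of epimorphisms. Put B = S^{⊥₁}, A = ^{⊥₁}B, and C = lim→ S. Then in any acyclic (doubly unbounded) complex of right R-modules whose terms belong to A and whose modules of cocycles belong to C, the modules of cocycles actually belong to A. -/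
open CategoryTheory CategoryTheory.Limits

universe w v u

namespace GenPeriodicity

variable {K : Type u} [Category.{v} K]

section Modules

variable {R : Type u} [Ring R]

/-- The hypotheses on the class `S`: finitely presented modules, containing `R`, closed under
extensions and kernels of epimorphisms. -/
structure IsResolvingFP_s1 (S : Set (ModuleCat.{u} R)) : Prop where
  fp : ∀ M ∈ S, Module.FinitePresentation R M
  free : ModuleCat.of R R ∈ S
  ext : ClosedUnderExtensions S
  ker : ClosedUnderKernelsOfEpis S

/-- Membership of an unbundled module in a class of objects of `ModuleCat R`. -/
def Mem (S : Set (ModuleCat.{u} R)) (M : Type u) [AddCommGroup M] [Module R M] : Prop :=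
  ModuleCat.of R M ∈ S

variable {S : Set (ModuleCat.{u} R)}
variable {M N P Q : Type u} [AddCommGroup M] [Module R M] [AddCommGroup N] [Module R N]
  [AddCommGroup P] [Module R P] [AddCommGroup Q] [Module R Q]

lemma comp_eq_zero_of_exact {f : M →ₗ[R] N} {g : N →ₗ[R] P} (h : Function.Exact f g) :
    ModuleCat.ofHom f ≫ ModuleCat.ofHom g = 0 := by
  rw [← ModuleCat.ofHom_comp, h.linearMap_comp_eq_zero]; rfl

lemma shortExact_of_s1 {f : M →ₗ[R] N} {g : N →ₗ[R] P} (hf : Function.Injective f)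
    (hg : Function.Surjective g) (h : Function.Exact f g) :
    (ShortComplex.mk (ModuleCat.ofHom f) (ModuleCat.ofHom g)
      (comp_eq_zero_of_exact h)).ShortExact where
  exact := by
    rw [ShortComplex.moduleCat_exact_iff]
    intro x hx
    exact (h x).1 hx
  mono_f := (ModuleCat.mono_iff_injective _).2 hf
  epi_g := (ModuleCat.epi_iff_surjective _).2 hg

namespace IsResolvingFP_s1

lemma mem_middle (hS : IsResolvingFP_s1 S) {f : M →ₗ[R] N} {g : N →ₗ[R] P}
    (hf : Function.Injective f) (hg : Function.Surjective g) (h : Function.Exact f g)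
    (hM : Mem S M) (hP : Mem S P) : Mem S N :=
  hS.ext _ (shortExact_of_s1 hf hg h) hM hP

lemma mem_left (hS : IsResolvingFP_s1 S) {f : M →ₗ[R] N} {g : N →ₗ[R] P}
    (hf : Function.Injective f) (hg : Function.Surjective g) (h : Function.Exact f g)
    (hN : Mem S N) (hP : Mem S P) : Mem S M :=
  hS.ker _ (shortExact_of_s1 hf hg h) hN hP

lemma mem_of_subsingleton_s1 (hS : IsResolvingFP_s1 S) [Subsingleton M] : Mem S M := by
  refine hS.mem_left (f := (0 : M →ₗ[R] R)) (g := LinearMap.id (R := R) (M := R))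
    (Function.injective_of_subsingleton _) Function.surjective_id ?_ hS.free hS.free
  intro x
  simp [eq_comm]

lemma mem_congr (hS : IsResolvingFP_s1 S) (e : M ≃ₗ[R] N) (hM : Mem S M) : Mem S N := by
  refine hS.mem_middle (f := e.toLinearMap) (g := (0 : N →ₗ[R] PUnit.{u + 1})) e.injective
    (fun x => ⟨0, rfl⟩) ?_ hM hS.mem_of_subsingleton_s1
  intro x
  simp

lemma mem_pi (hS : IsResolvingFP_s1 S) (n : ℕ) : Mem S (Fin n → R) := by
  induction n with
  | zero => exact hS.mem_of_subsingleton_s1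
  | succ n ih =>
    refine hS.mem_congr (Fin.consLinearEquiv R (fun _ => R)) ?_
    refine hS.mem_middle (f := LinearMap.inl R R (Fin n → R)) (g := LinearMap.snd R R (Fin n → R))
      LinearMap.inl_injective LinearMap.snd_surjective ?_ hS.free ih
    exact LinearMap.exact_iff.2 (LinearMap.range_inl R R (Fin n → R)).symm

lemma finitePresentation (hS : IsResolvingFP_s1 S) (hM : Mem S M) : Module.FinitePresentation R M :=
  hS.fp _ hM

lemma mem_ker (hS : IsResolvingFP_s1 S) (g : M →ₗ[R] N) (hg : Function.Surjective g)
    (hM : Mem S M) (hN : Mem S N) : Mem S (LinearMap.ker g) :=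
  hS.mem_left (LinearMap.ker g).injective_subtype hg (LinearMap.exact_subtype_ker_map g) hM hN

end IsResolvingFP_s1

/-- A linear map vanishing on the kernel of a surjection factors through it. -/
lemma exists_factor_s1 (p : M →ₗ[R] N) (hp : Function.Surjective p) (q : M →ₗ[R] P)
    (h : ∀ x, p x = 0 → q x = 0) : ∃ r : N →ₗ[R] P, ∀ x, r (p x) = q x := by
  have h' : LinearMap.ker p ≤ LinearMap.ker q := fun x hx => h x hx
  refine ⟨(LinearMap.ker p).liftQ q h' ∘ₗ (p.quotKerEquivOfSurjective hp).symm.toLinearMap, ?_⟩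
  intro x
  have : (p.quotKerEquivOfSurjective hp).symm (p x) = (LinearMap.ker p).mkQ x := by
    rw [LinearEquiv.symm_apply_eq]; rfl
  simp [this]

/-- A linear map with values in the range of an injection factors through it. -/
lemma exists_lift_of_injective (κ : M →ₗ[R] N) (hκ : Function.Injective κ) (q : P →ₗ[R] N)
    (h : ∀ x, q x ∈ LinearMap.range κ) : ∃ r : P →ₗ[R] M, ∀ x, κ (r x) = q x := by
  refine ⟨(LinearEquiv.ofInjective κ hκ).symm.toLinearMap ∘ₗ q.codRestrict _ h, fun x => ?_⟩
  exact congrArg Subtype.val ((LinearEquiv.ofInjective κ hκ).apply_symm_apply ⟨q x, h x⟩)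

/-- `N` is injective with respect to all inclusions `K → Rⁿ` with cokernel in `S`. -/
def IsB (S : Set (ModuleCat.{u} R)) (N : Type u) [AddCommGroup N] [Module R N] : Prop :=
  ∀ (n : ℕ) (K : Submodule R (Fin n → R)), Mem S ((Fin n → R) ⧸ K) → ∀ g : K →ₗ[R] N,
    ∃ e : (Fin n → R) →ₗ[R] N, ∀ k : K, e k = g k

lemma exists_fin_cover [Module.Finite R M] :
    ∃ (n : ℕ) (p : (Fin n → R) →ₗ[R] M), Function.Surjective p :=
  Module.Finite.exists_fin' R M

/-- Linear maps out of a finite free module lift along surjections. -/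
lemma exists_lift_pi {n : ℕ} (p : M →ₗ[R] N) (hp : Function.Surjective p)
    (q : (Fin n → R) →ₗ[R] N) : ∃ r : (Fin n → R) →ₗ[R] M, ∀ x, p (r x) = q x := by
  obtain ⟨r, hr⟩ := Module.projective_lifting_property p q hp
  exact ⟨r, fun x => LinearMap.congr_fun hr x⟩

lemma IsB.extend (hS : IsResolvingFP_s1 S) (hN : IsB S N) {i : M →ₗ[R] P} {π : P →ₗ[R] Q}
    (hi : Function.Injective i) (hπ : Function.Surjective π) (hex : Function.Exact i π)
    (hQ : Mem S Q) (g : M →ₗ[R] N) : ∃ e : P →ₗ[R] N, ∀ x, e (i x) = g x := by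
  have := hS.finitePresentation hQ
  obtain ⟨n, p, hp⟩ := exists_fin_cover (R := R) (M := Q)
  obtain ⟨t, ht⟩ := exists_lift_pi π hπ p
  have hK : Mem S ((Fin n → R) ⧸ LinearMap.ker p) :=
    hS.mem_congr (p.quotKerEquivOfSurjective hp).symm hQ
  have hmem : ∀ k : LinearMap.ker p, t k ∈ LinearMap.range i := fun k =>
    (hex _).1 (by rw [ht]; exact k.2)
  obtain ⟨s, hs⟩ : ∃ s : LinearMap.ker p →ₗ[R] M, ∀ k, i (s k) = t k :=
    exists_lift_of_injective i hi (t ∘ₗ (LinearMap.ker p).subtype) hmem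
  obtain ⟨e, he⟩ := hN n _ hK (g ∘ₗ s)
  have hsurj : Function.Surjective (i.coprod t) := by
    intro x
    obtain ⟨y, hy⟩ := hp (π x)
    obtain ⟨m, hm⟩ := (hex (x - t y)).1 (by rw [map_sub, ht, hy, sub_self])
    exact ⟨(m, y), by simp [hm]⟩
  obtain ⟨r, hr⟩ := exists_factor_s1 (i.coprod t) hsurj (g.coprod e) (by
    rintro ⟨m, y⟩ h
    simp only [LinearMap.coprod_apply] at h ⊢
    have hy : y ∈ LinearMap.ker p := by
      have := congrArg π h
      simpa [ht, hex.apply_apply_eq_zero] using this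
    have h2 : s ⟨y, hy⟩ = - m := hi (by
      rw [hs, map_neg]; exact eq_neg_of_add_eq_zero_right h)
    have := he ⟨y, hy⟩
    simp only [LinearMap.comp_apply, h2, map_neg] at this
    rw [this, add_neg_cancel])
  exact ⟨r, fun x => by simpa using hr (x, 0)⟩

lemma IsB.lift (hS : IsResolvingFP_s1 S) {κ : N →ₗ[R] M} {π : M →ₗ[R] P} (hN : IsB S N)
    (hκ : Function.Injective κ) (hπ : Function.Surjective π) (hex : Function.Exact κ π)
    (hQ : Mem S Q) (q : Q →ₗ[R] P) : ∃ l : Q →ₗ[R] M, ∀ x, π (l x) = q x := by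
  have := hS.finitePresentation hQ
  obtain ⟨n, p, hp⟩ := exists_fin_cover (R := R) (M := Q)
  obtain ⟨t, ht⟩ := exists_lift_pi π hπ (q ∘ₗ p)
  have hK : Mem S ((Fin n → R) ⧸ LinearMap.ker p) :=
    hS.mem_congr (p.quotKerEquivOfSurjective hp).symm hQ
  have hmem : ∀ k : LinearMap.ker p, t k ∈ LinearMap.range κ := fun k =>
    (hex _).1 (by rw [ht, LinearMap.comp_apply, k.2, map_zero])
  obtain ⟨s, hs⟩ : ∃ s : LinearMap.ker p →ₗ[R] N, ∀ k, κ (s k) = t k :=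
    exists_lift_of_injective κ hκ (t ∘ₗ (LinearMap.ker p).subtype) hmem
  obtain ⟨e, he⟩ := hN n _ hK s
  obtain ⟨r, hr⟩ := exists_factor_s1 p hp (t - κ ∘ₗ e) (by
    intro x hx
    have := he ⟨x, hx⟩
    simp only at this
    simp [this, hs])
  refine ⟨r, fun x => ?_⟩
  obtain ⟨y, rfl⟩ := hp x
  simp [hr, ht, hex.apply_apply_eq_zero]

/-- Every linear map from a finitely presented module to `M` factors through a module in `S`. -/
def FactorsFP (S : Set (ModuleCat.{u} R)) (M : Type u) [AddCommGroup M] [Module R M] : Prop :=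
  ∀ (W : Type u) [AddCommGroup W] [Module R W], Module.FinitePresentation R W →
    ∀ w : W →ₗ[R] M, ∃ (Q : ModuleCat.{u} R) (_ : Q ∈ S) (a : W →ₗ[R] Q) (b : Q →ₗ[R] M),
      ∀ x, b (a x) = w x

lemma FactorsFP.lift (hS : IsResolvingFP_s1 S) {κ : N →ₗ[R] M} {π : M →ₗ[R] P} (hP : FactorsFP S P)
    (hN : IsB S N) (hκ : Function.Injective κ) (hπ : Function.Surjective π)
    (hex : Function.Exact κ π) (hQ : Module.FinitePresentation R Q) (q : Q →ₗ[R] P) :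
    ∃ l : Q →ₗ[R] M, ∀ x, π (l x) = q x := by
  obtain ⟨T, hT, a, b, hab⟩ := hP Q hQ q
  obtain ⟨l, hl⟩ := hN.lift hS hκ hπ hex (Q := T) hT b
  exact ⟨l ∘ₗ a, fun x => by simp [hl, hab]⟩

/-- Extensions of modules in `S` by modules with `FactorsFP` have `FactorsFP`. -/
lemma FactorsFP.extension (hS : IsResolvingFP_s1 S) {i : M →ₗ[R] N} {π : N →ₗ[R] P}
    (hM : FactorsFP S M) (hi : Function.Injective i) (hπ : Function.Surjective π)
    (hex : Function.Exact i π) (hP : Mem S P) : FactorsFP S N := by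
  intro W _ _ hW w
  have := hS.finitePresentation hP
  obtain ⟨n, p, hp⟩ := exists_fin_cover (R := R) (M := W)
  obtain ⟨m, p', hp'⟩ := exists_fin_cover (R := R) (M := P)
  obtain ⟨t, ht⟩ := exists_lift_pi π hπ p'
  have hF : Mem S ((Fin n → R) × (Fin m → R)) :=
    hS.mem_middle LinearMap.inl_injective LinearMap.snd_surjective
      (LinearMap.exact_iff.2 (LinearMap.range_inl R _ _).symm) (hS.mem_pi n) (hS.mem_pi m)
  set c : (Fin n → R) × (Fin m → R) →ₗ[R] N := (w ∘ₗ p).coprod t with hc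
  have hcs : Function.Surjective (π ∘ₗ c) := by
    intro x
    obtain ⟨y, rfl⟩ := hp' x
    exact ⟨(0, y), by simp [hc, ht]⟩
  have hK := hS.mem_ker (π ∘ₗ c) hcs hF hP
  set K := LinearMap.ker (π ∘ₗ c) with hKdef
  have hmem : ∀ k : K, c k ∈ LinearMap.range i := fun k => (hex _).1 k.2
  obtain ⟨s, hs⟩ : ∃ s : K →ₗ[R] M, ∀ k, i (s k) = c k :=
    exists_lift_of_injective i hi (c ∘ₗ K.subtype) hmem
  -- the relations of `W`, as a submodule of `K`
  have hrel : ∀ x : LinearMap.ker p, (LinearMap.inl R (Fin n → R) (Fin m → R)) x ∈ K := by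
    intro x
    have hx : p x = 0 := x.2
    simp [hKdef, hc, hx]
  set ρ : LinearMap.ker p →ₗ[R] K :=
    ((LinearMap.inl R (Fin n → R) (Fin m → R)) ∘ₗ (LinearMap.ker p).subtype).codRestrict K hrel
    with hρ
  have hρa : ∀ x, (ρ x : (Fin n → R) × (Fin m → R)) = ((x : Fin n → R), 0) := fun _ => rfl
  have hkerfg : (LinearMap.ker p).FG := Module.FinitePresentation.fg_ker p hp
  have hKfp : Module.FinitePresentation R K := hS.finitePresentation hK
  have : Module.Finite R (LinearMap.ker p) := Module.Finite.iff_fg.2 hkerfg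
  have hfg : (LinearMap.range ρ).FG := Module.Finite.iff_fg.1 inferInstance
  have hquot : Module.FinitePresentation R (K ⧸ LinearMap.range ρ) :=
    Module.finitePresentation_of_surjective (LinearMap.range ρ).mkQ
      (Submodule.mkQ_surjective _) (by rwa [Submodule.ker_mkQ])
  obtain ⟨Q, hQ, a, b, hab⟩ := hM _ hquot ((LinearMap.range ρ).liftQ s (by
    rintro _ ⟨x, rfl⟩
    apply hi
    have hx : p x = 0 := x.2
    rw [hs, map_zero]
    simp [hρa, hc, hx]))
  -- the pushout of `K → Rⁿ × Rᵐ` along `K → Q`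
  set a' : K →ₗ[R] Q := a ∘ₗ (LinearMap.range ρ).mkQ with ha'
  have hab' : ∀ k, b (a' k) = s k := fun k => by
    rw [ha', LinearMap.comp_apply, hab]; rfl
  set θ : K →ₗ[R] Q × ((Fin n → R) × (Fin m → R)) := a'.prod (-K.subtype) with hθ
  have hθa : ∀ k, θ k = (a' k, -(k : (Fin n → R) × (Fin m → R))) := fun _ => rfl
  let T := (Q × ((Fin n → R) × (Fin m → R))) ⧸ LinearMap.range θ
  let mk : Q × ((Fin n → R) × (Fin m → R)) →ₗ[R] T := (LinearMap.range θ).mkQ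
  have hmk : Function.Surjective mk := Submodule.mkQ_surjective _
  have hmk0 : ∀ x, mk x = 0 ↔ ∃ k, θ k = x := fun x =>
    (Submodule.Quotient.mk_eq_zero _).trans LinearMap.mem_range
  have hT : Mem S T := by
    obtain ⟨ψ, hψ⟩ := exists_factor_s1 mk hmk ((π ∘ₗ c) ∘ₗ LinearMap.snd R Q _) (by
      intro x hx
      obtain ⟨k, rfl⟩ := (hmk0 x).1 hx
      have : (π ∘ₗ c) k = 0 := k.2
      rw [hθa, LinearMap.comp_apply, LinearMap.snd_apply, map_neg, this, neg_zero])
    refine hS.mem_middle (f := mk ∘ₗ LinearMap.inl R Q _) (g := ψ) ?_ ?_ ?_ hQ hP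
    · rw [← LinearMap.ker_eq_bot, LinearMap.ker_eq_bot']
      intro x hx
      obtain ⟨k, hk⟩ := (hmk0 _).1 hx
      rw [hθa, LinearMap.inl_apply, Prod.mk.injEq, neg_eq_zero] at hk
      have : k = 0 := Subtype.ext hk.2
      rw [← hk.1, this, map_zero]
    · intro x
      obtain ⟨y, rfl⟩ := hcs x
      exact ⟨mk (0, y), by rw [hψ]; rfl⟩
    · intro x
      obtain ⟨⟨q, y⟩, rfl⟩ := hmk x
      rw [hψ]
      constructor
      · intro hy
        let k : K := ⟨y, hy⟩
        refine ⟨q + a' k, ?_⟩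
        rw [← sub_eq_zero, LinearMap.comp_apply, ← map_sub, hmk0]
        exact ⟨k, by simp [hθa, k]⟩
      · rintro ⟨q', hq'⟩
        rw [LinearMap.comp_apply, ← sub_eq_zero, ← map_sub, hmk0] at hq'
        obtain ⟨k, hk⟩ := hq'
        have h2 := congrArg Prod.snd hk
        rw [hθa, LinearMap.inl_apply, Prod.mk_sub_mk, zero_sub, neg_inj] at h2
        have : (π ∘ₗ c) k = 0 := k.2
        rw [← this, h2]; rfl
  obtain ⟨β, hβ⟩ := exists_factor_s1 mk hmk ((i ∘ₗ b).coprod c) (by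
    intro x hx
    obtain ⟨k, rfl⟩ := (hmk0 x).1 hx
    simp [hθa, hab', hs])
  obtain ⟨α, hα⟩ := exists_factor_s1 p hp (mk ∘ₗ LinearMap.inr R Q _ ∘ₗ LinearMap.inl R _ _) (by
    intro x hx
    rw [LinearMap.comp_apply, hmk0]
    refine ⟨-ρ ⟨x, hx⟩, ?_⟩
    have : a' (ρ ⟨x, hx⟩) = 0 := by
      rw [ha', LinearMap.comp_apply, Submodule.mkQ_apply,
        (Submodule.Quotient.mk_eq_zero _).2 (LinearMap.mem_range_self ρ _), map_zero]
    rw [map_neg, hθa, this, Prod.neg_mk, neg_neg, neg_zero]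
    rfl)
  refine ⟨ModuleCat.of R T, hT, α, β, fun x => ?_⟩
  obtain ⟨y, rfl⟩ := hp x
  rw [hα, LinearMap.comp_apply, hβ]
  simp [hc]

section Cells

variable {E : Type u} [AddCommGroup E] [Module R E]

/-- The submodule generated by `D` and the `A i` with `i ∈ I`. -/
def cellSpan {ι : Type u} (D : Submodule R E) (A : ι → Submodule R E) (I : Set ι) :
    Submodule R E :=
  D ⊔ ⨆ i ∈ I, A i

section

variable {ι : Type u} {D : Submodule R E} {A : ι → Submodule R E}

lemma le_cellSpan (I : Set ι) : D ≤ cellSpan D A I := le_sup_left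

lemma cell_le_cellSpan {I : Set ι} {i : ι} (hi : i ∈ I) : A i ≤ cellSpan D A I :=
  le_sup_of_le_right (le_iSup₂_of_le i hi le_rfl)

lemma cellSpan_le {I : Set ι} {N : Submodule R E} (hD : D ≤ N) (h : ∀ i ∈ I, A i ≤ N) :
    cellSpan D A I ≤ N :=
  sup_le hD (iSup₂_le h)

lemma cellSpan_mono {I J : Set ι} (h : I ⊆ J) : cellSpan D A I ≤ cellSpan D A J :=
  cellSpan_le (le_cellSpan J) fun _ hi => cell_le_cellSpan (h hi)

lemma cellSpan_insert (I : Set ι) (i : ι) :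
    cellSpan D A (insert i I) = cellSpan D A I ⊔ A i := by
  apply le_antisymm
  · refine cellSpan_le (le_sup_of_le_left (le_cellSpan I)) ?_
    rintro j (rfl | hj)
    · exact le_sup_right
    · exact le_sup_of_le_left (cell_le_cellSpan hj)
  · exact sup_le (cellSpan_mono (Set.subset_insert _ _)) (cell_le_cellSpan (Set.mem_insert _ _))

lemma exists_finset_of_mem_cellSpan {I : Set ι} {x : E} (hx : x ∈ cellSpan D A I) :
    ∃ G : Finset ι, (G : Set ι) ⊆ I ∧ x ∈ cellSpan D A (G : Set ι) := by
  classical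
  let T : Submodule R E :=
    { carrier := {x | ∃ G : Finset ι, (G : Set ι) ⊆ I ∧ x ∈ cellSpan D A (G : Set ι)}
      zero_mem' := ⟨∅, by simp, zero_mem _⟩
      add_mem' := by
        rintro x y ⟨G, hG, hx⟩ ⟨G', hG', hy⟩
        refine ⟨G ∪ G', by simp [hG, hG'], add_mem ?_ ?_⟩
        · exact cellSpan_mono (by simp) hx
        · exact cellSpan_mono (by simp) hy
      smul_mem' := by
        rintro r x ⟨G, hG, hx⟩
        exact ⟨G, hG, Submodule.smul_mem _ r hx⟩ }
  have : cellSpan D A I ≤ T := cellSpan_le (fun x hx => ⟨∅, by simp, le_cellSpan _ hx⟩)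
    fun i hi x hx => ⟨{i}, by simpa using hi, cell_le_cellSpan (by simp) hx⟩
  exact this hx

lemma exists_finset_of_fg_le_cellSpan {I : Set ι} {F : Submodule R E} (hF : F.FG)
    (h : F ≤ cellSpan D A I) :
    ∃ G : Finset ι, (G : Set ι) ⊆ I ∧ F ≤ cellSpan D A (G : Set ι) := by
  classical
  obtain ⟨s, rfl⟩ := hF
  have hx : ∀ x : s, ∃ G : Finset ι, (G : Set ι) ⊆ I ∧ (x : E) ∈ cellSpan D A (G : Set ι) :=
    fun x => exists_finset_of_mem_cellSpan (h (Submodule.subset_span x.2))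
  choose G hG hGx using hx
  refine ⟨Finset.univ.biUnion G, ?_, ?_⟩
  · intro i hi
    simp only [Finset.coe_biUnion, Set.mem_iUnion] at hi
    obtain ⟨x, -, hi⟩ := hi
    exact hG x hi
  · rw [Submodule.span_le]
    intro x hx
    refine cellSpan_mono ?_ (hGx ⟨x, hx⟩)
    intro i hi
    simp only [Finset.coe_biUnion, Set.mem_iUnion]
    exact ⟨⟨x, hx⟩, by simp, hi⟩

variable [LinearOrder ι]

/-- Sets of cells which contain all cells needed to attach their members. -/
def CellClosed (D : Submodule R E) (A : ι → Submodule R E) (I : Set ι) : Prop :=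
  ∀ i ∈ I, A i ⊓ cellSpan D A (Set.Iio i) ≤ cellSpan D A (I ∩ Set.Iio i)

lemma CellClosed.sUnion {c : Set (Set ι)} (h : ∀ I ∈ c, CellClosed D A I) :
    CellClosed D A (⋃₀ c) := by
  rintro i ⟨I, hI, hi⟩
  exact (h I hI i hi).trans
    (cellSpan_mono (Set.inter_subset_inter_left _ (Set.subset_sUnion_of_mem hI)))

lemma CellClosed.union {I J : Set ι} (hI : CellClosed D A I) (hJ : CellClosed D A J) :
    CellClosed D A (I ∪ J) := by
  rw [← Set.sUnion_pair]
  refine CellClosed.sUnion ?_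
  rintro K (rfl | rfl)
  exacts [hI, hJ]

/-- For closed `K`, an element of `cellSpan D A K` lying in the part generated up to `i ∉ K`
is generated below `i`. -/
lemma CellClosed.mem_of_notMem [WellFoundedLT ι] {K : Set ι} (hK : CellClosed D A K) {i : ι}
    (hi : i ∉ K) {x : E} (hx : x ∈ cellSpan D A K) (hx' : x ∈ cellSpan D A (Set.Iic i)) :
    x ∈ cellSpan D A (Set.Iio i) := by
  have key : ∀ j : ι, x ∈ cellSpan D A (K ∩ Set.Iic j) → x ∈ cellSpan D A (Set.Iio i) := by
    intro j
    induction j using WellFoundedLT.induction with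
    | ind j ih =>
    intro hxj
    rcases le_or_gt j i with hji | hij
    · refine cellSpan_mono ?_ hxj
      rintro k ⟨hkK, hkj⟩
      exact lt_of_le_of_ne (le_trans hkj hji) (by rintro rfl; exact hi hkK)
    · have hlt : x ∈ cellSpan D A (K ∩ Set.Iio j) := by
        by_cases hjK : j ∈ K
        · have heq : K ∩ Set.Iic j = insert j (K ∩ Set.Iio j) := by
            ext k
            simp only [Set.mem_inter_iff, Set.mem_Iic, Set.mem_insert_iff, Set.mem_Iio,
              le_iff_lt_or_eq]
            constructor
            · rintro ⟨h1, h2 | h2⟩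
              exacts [Or.inr ⟨h1, h2⟩, Or.inl h2]
            · rintro (rfl | ⟨h1, h2⟩)
              exacts [⟨hjK, Or.inr rfl⟩, ⟨h1, Or.inl h2⟩]
          rw [heq, cellSpan_insert, Submodule.mem_sup] at hxj
          obtain ⟨y, hy, a, ha, rfl⟩ := hxj
          refine add_mem hy (hK j hjK ⟨ha, ?_⟩)
          have h1 : y + a ∈ cellSpan D A (Set.Iio j) :=
            cellSpan_mono (fun k hk => lt_of_le_of_lt hk hij) hx'
          have h2 : y ∈ cellSpan D A (Set.Iio j) :=
            cellSpan_mono Set.inter_subset_right hy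
          simpa using sub_mem h1 h2
        · refine cellSpan_mono ?_ hxj
          rintro k ⟨hkK, hkj⟩
          exact ⟨hkK, lt_of_le_of_ne hkj (by rintro rfl; exact hjK hkK)⟩
      obtain ⟨G, hG, hxG⟩ := exists_finset_of_mem_cellSpan hlt
      rcases G.eq_empty_or_nonempty with rfl | hne
      · exact cellSpan_mono (by simp) hxG
      · refine ih (G.max' hne) (hG (G.max'_mem hne)).2 (cellSpan_mono ?_ hxG)
        exact fun k hk => ⟨(hG hk).1, G.le_max' k hk⟩
  obtain ⟨G, hG, hxG⟩ := exists_finset_of_mem_cellSpan hx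
  rcases G.eq_empty_or_nonempty with rfl | hne
  · exact cellSpan_mono (by simp) hxG
  · exact key (G.max' hne) (cellSpan_mono (fun k hk => And.intro (hG hk) (G.le_max' k hk)) hxG)

end

/-- `E` is obtained from the submodule `D` by successively attaching finitely generated
submodules along a well-order, with successive quotients in `S`. -/
def IsCellular (S : Set (ModuleCat.{u} R)) (D : Submodule R E) : Prop :=
  ∃ (ι : Type u) (_ : LinearOrder ι) (_ : WellFoundedLT ι) (A : ι → Submodule R E),
    (∀ i, (A i).FG) ∧
    (∀ i, Mem S (A i ⧸ (cellSpan D A (Set.Iio i)).submoduleOf (A i))) ∧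
    cellSpan D A Set.univ = ⊤

/-- A family of submodules between `D` and `E` as in the Hill lemma: `H` is the family,
`H₀` consists of its members which are finitely generated over `D`. -/
structure HillFamily (S : Set (ModuleCat.{u} R)) (D : Submodule R E) where
  H : Submodule R E → Prop
  H₀ : Submodule R E → Prop
  sSup_mem : ∀ c : Set (Submodule R E), (∀ N ∈ c, H N) → H (D ⊔ sSup c)
  le_of_mem : ∀ N, H N → D ≤ N
  H₀_base : H₀ D
  H_of_H₀ : ∀ N, H₀ N → H N
  exists_fg : ∀ N, H₀ N → ∃ F : Submodule R E, F.FG ∧ N = D ⊔ F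
  exists_H₀ : ∀ F : Submodule R E, F.FG → ∃ N, H₀ N ∧ F ≤ N
  quot_mem : ∀ N L, H N → H₀ L → Mem S (↥(N ⊔ L) ⧸ N.submoduleOf (N ⊔ L))

/-- Second isomorphism theorem, and third isomorphism theorem, for membership in `S`. -/
lemma IsResolvingFP_s1.mem_sup_quot (hS : IsResolvingFP_s1 S) {N A L : Submodule R E}
    (h : ∀ x ∈ A, x ∈ N ↔ x ∈ L) (hA : Mem S (A ⧸ L.submoduleOf A)) :
    Mem S (↥(N ⊔ A) ⧸ N.submoduleOf (N ⊔ A)) := by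
  have : L.submoduleOf A = N.submoduleOf A := by
    ext x
    exact (h x x.2).symm
  rw [this] at hA
  rw [sup_comm]
  refine hS.mem_congr ?_ hA
  have e := LinearMap.quotientInfEquivSupQuotient A N
  have h1 : Submodule.comap A.subtype (A ⊓ N) = N.submoduleOf A := by
    ext x
    simp [Submodule.submoduleOf]
  exact (Submodule.quotEquivOfEq _ _ h1).symm ≪≫ₗ e

lemma IsResolvingFP_s1.mem_quot_trans (hS : IsResolvingFP_s1 S) {N L T : Submodule R E} (h1 : N ≤ L)
    (h2 : L ≤ T) (hL : Mem S (L ⧸ N.submoduleOf L)) (hT : Mem S (T ⧸ L.submoduleOf T)) :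
    Mem S (T ⧸ N.submoduleOf T) := by
  have c1 : N.submoduleOf L ≤ (N.submoduleOf T).comap (Submodule.inclusion h2) :=
    fun x hx => hx
  have c2 : N.submoduleOf T ≤ (L.submoduleOf T).comap LinearMap.id := fun x hx => h1 hx
  refine hS.mem_middle (f := Submodule.mapQ _ _ (Submodule.inclusion h2) c1)
    (g := Submodule.mapQ _ _ LinearMap.id c2) ?_ ?_ ?_ hL hT
  · rw [← LinearMap.ker_eq_bot, LinearMap.ker_eq_bot']
    intro x hx
    obtain ⟨x, rfl⟩ := Submodule.Quotient.mk_surjective _ x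
    rw [Submodule.mapQ_apply, Submodule.Quotient.mk_eq_zero] at hx
    exact (Submodule.Quotient.mk_eq_zero _).2 hx
  · intro x
    obtain ⟨x, rfl⟩ := Submodule.Quotient.mk_surjective _ x
    exact ⟨Submodule.Quotient.mk x, rfl⟩
  · intro x
    obtain ⟨x, rfl⟩ := Submodule.Quotient.mk_surjective _ x
    rw [Submodule.mapQ_apply, Submodule.Quotient.mk_eq_zero]
    constructor
    · intro hx
      exact ⟨Submodule.Quotient.mk ⟨x, hx⟩, rfl⟩
    · rintro ⟨y, hy⟩
      obtain ⟨y, rfl⟩ := Submodule.Quotient.mk_surjective _ y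
      rw [Submodule.mapQ_apply, Submodule.Quotient.eq] at hy
      have h3 : (y : E) - x ∈ L := h1 hy
      have h4 : (x : E) ∈ L := by simpa using sub_mem y.2 h3
      exact h4

/-- The Hill lemma. -/
theorem IsCellular.nonempty_hillFamily (hS : IsResolvingFP_s1 S) {D : Submodule R E}
    (h : IsCellular S D) : Nonempty (HillFamily S D) := by
  classical
  obtain ⟨ι, _, _, A, hfg, hquot, htop⟩ := h
  have hrel : ∀ i, (A i ⊓ cellSpan D A (Set.Iio i)).FG := by
    intro i
    have := hS.finitePresentation (hquot i)
    have : Module.Finite R (A i) := Module.Finite.iff_fg.2 (hfg i)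
    have h1 := Module.FinitePresentation.fg_ker
      ((cellSpan D A (Set.Iio i)).submoduleOf (A i)).mkQ (Submodule.mkQ_surjective _)
    rw [Submodule.ker_mkQ] at h1
    have h2 := h1.map (A i).subtype
    rwa [Submodule.submoduleOf, Submodule.map_comap_subtype] at h2
  have hfin : ∀ i, ∃ F : Finset ι, i ∈ F ∧ CellClosed D A (F : Set ι) := by
    intro i
    induction i using WellFoundedLT.induction with
    | ind i ih =>
    obtain ⟨G, hG, hGle⟩ := exists_finset_of_fg_le_cellSpan (hrel i) inf_le_right
    have : ∀ j : G, ∃ F : Finset ι, (j : ι) ∈ F ∧ CellClosed D A (F : Set ι) :=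
      fun j => ih j (hG j.2)
    choose F hF hFc using this
    have hU : CellClosed D A (⋃₀ Set.range fun j => (F j : Set ι)) :=
      CellClosed.sUnion (by rintro _ ⟨j, rfl⟩; exact hFc j)
    refine ⟨insert i (Finset.univ.biUnion F), by simp, ?_⟩
    have hcoe : ((insert i (Finset.univ.biUnion F) : Finset ι) : Set ι)
        = insert i (⋃₀ Set.range fun j => (F j : Set ι)) := by
      ext k; simp
    rw [hcoe]
    rintro k (rfl | hk)
    · refine hGle.trans (cellSpan_mono fun j hj => ⟨Or.inr ?_, hG hj⟩)
      exact ⟨_, ⟨⟨j, hj⟩, rfl⟩, hF ⟨j, hj⟩⟩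
    · exact (hU k hk).trans
        (cellSpan_mono (Set.inter_subset_inter_left _ (Set.subset_insert _ _)))
  have hstep : ∀ (I : Set ι), CellClosed D A I → ∀ F : Finset ι, CellClosed D A (F : Set ι) →
      Mem S (↥(cellSpan D A (I ∪ F)) ⧸ (cellSpan D A I).submoduleOf (cellSpan D A (I ∪ F))) := by
    intro I hI F
    induction F using Finset.induction_on_max with
    | empty =>
      intro _
      have hI0 : I ∪ ((∅ : Finset ι) : Set ι) = I := by simp
      rw [hI0, Submodule.submoduleOf_self]
      have := Submodule.Quotient.subsingleton_iff.2
        (rfl : (⊤ : Submodule R (cellSpan D A I)) = ⊤)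
      exact hS.mem_of_subsingleton_s1
    | insert i F hlt ih =>
      intro hF
      have hF' : CellClosed D A (F : Set ι) := by
        intro j hj
        refine (hF j (by simp [show j ∈ F from hj])).trans (cellSpan_mono ?_)
        rintro k ⟨hk, hkj⟩
        rw [Finset.coe_insert] at hk
        rcases hk with rfl | hk
        · exact absurd hkj (not_lt.2 (hlt j hj).le)
        · exact ⟨hk, hkj⟩
      have ih' := ih hF'
      have hK : CellClosed D A (I ∪ F) := hI.union hF'
      have hins : I ∪ ((insert i F : Finset ι) : Set ι) = insert i (I ∪ F) := by
        rw [Finset.coe_insert, Set.union_insert]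
      rw [hins]
      by_cases hi : i ∈ I ∪ (F : Set ι)
      · rwa [Set.insert_eq_of_mem hi]
      · refine hS.mem_quot_trans (cellSpan_mono Set.subset_union_left)
          (cellSpan_mono (Set.subset_insert _ _)) ih' ?_
        rw [cellSpan_insert]
        refine hS.mem_sup_quot (L := cellSpan D A (Set.Iio i)) ?_ (hquot i)
        intro x hx
        constructor
        · intro hxK
          exact hK.mem_of_notMem hi hxK (cell_le_cellSpan (Set.mem_Iic.2 le_rfl) hx)
        · intro hxi
          have := hF i (by simp) ⟨hx, hxi⟩
          refine cellSpan_mono ?_ this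
          rintro k ⟨hk, hki⟩
          rw [Finset.coe_insert] at hk
          rcases hk with rfl | hk
          · exact absurd hki (lt_irrefl _)
          · exact Or.inr hk
  have hunion : ∀ I J : Set ι, cellSpan D A I ⊔ cellSpan D A J = cellSpan D A (I ∪ J) := by
    intro I J
    apply le_antisymm
    · exact sup_le (cellSpan_mono Set.subset_union_left) (cellSpan_mono Set.subset_union_right)
    · refine cellSpan_le (le_sup_of_le_left (le_cellSpan I)) ?_
      rintro i (hi | hi)
      · exact le_sup_of_le_left (cell_le_cellSpan hi)
      · exact le_sup_of_le_right (cell_le_cellSpan hi)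
  refine ⟨{
    H := fun N => ∃ I : Set ι, CellClosed D A I ∧ N = cellSpan D A I
    H₀ := fun N => ∃ I : Finset ι, CellClosed D A (I : Set ι) ∧ N = cellSpan D A (I : Set ι)
    sSup_mem := ?_
    le_of_mem := by
      rintro _ ⟨I, -, rfl⟩
      exact le_cellSpan I
    H_of_H₀ := fun N ⟨I, h1, h2⟩ => ⟨I, h1, h2⟩
    H₀_base := ⟨∅, by simp [CellClosed], by simp [cellSpan]⟩
    exists_fg := by
      rintro _ ⟨I, -, rfl⟩
      refine ⟨⨆ i ∈ I, A i, Submodule.fg_biSup I A fun i _ => hfg i, rfl⟩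
    exists_H₀ := ?_
    quot_mem := by
      rintro _ _ ⟨I, hI, rfl⟩ ⟨F, hF, rfl⟩
      rw [hunion]
      exact hstep I hI F hF }⟩
  · intro c hc
    refine ⟨⋃₀ {I | CellClosed D A I ∧ cellSpan D A I ∈ c},
      CellClosed.sUnion fun I hI => hI.1, ?_⟩
    apply le_antisymm
    · refine sup_le (le_cellSpan _) (sSup_le fun N hN => ?_)
      obtain ⟨I, hI, rfl⟩ := hc N hN
      exact cellSpan_mono (Set.subset_sUnion_of_mem ⟨hI, hN⟩)
    · refine cellSpan_le le_sup_left ?_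
      rintro i ⟨I, ⟨-, hI⟩, hi⟩
      exact le_sup_of_le_right (le_trans (cell_le_cellSpan hi) (le_sSup hI))
  · intro F hF
    obtain ⟨G, -, hG⟩ := exists_finset_of_fg_le_cellSpan hF (htop ▸ le_top)
    choose F hF hFc using hfin
    refine ⟨_, ⟨G.biUnion F, ?_, rfl⟩, hG.trans (cellSpan_mono ?_)⟩
    · have : ((G.biUnion F : Finset ι) : Set ι) = ⋃₀ ((fun j => (F j : Set ι)) '' G) := by
        ext k; simp
      rw [this]
      refine CellClosed.sUnion ?_
      rintro _ ⟨j, -, rfl⟩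
      exact hFc j
    · intro i hi
      simp only [Finset.coe_biUnion, Set.mem_iUnion]
      exact ⟨i, hi, hF i⟩

end Cells

namespace HillFamily

variable {E : Type u} [AddCommGroup E] [Module R E] {D : Submodule R E}

lemma bot_mem (F : HillFamily S D) : F.H D := by
  simpa using F.sSup_mem ∅ (by simp)

lemma sup_mem (F : HillFamily S D) {L L' : Submodule R E} (h : F.H L) (h' : F.H L') :
    F.H (L ⊔ L') := by
  have := F.sSup_mem {L, L'} (by rintro _ (rfl | rfl) <;> assumption)
  rwa [sSup_pair, sup_eq_right.2 (le_sup_of_le_left (F.le_of_mem _ h))] at this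

lemma sSup_mem_of_nonempty (F : HillFamily S D) {c : Set (Submodule R E)} (hc : c.Nonempty)
    (h : ∀ L ∈ c, F.H L) : F.H (sSup c) := by
  obtain ⟨L, hL⟩ := hc
  have := F.sSup_mem c h
  rwa [sup_eq_right.2 ((F.le_of_mem L (h L hL)).trans (le_sSup hL))] at this

/-- Partial maps into a module in `S^{⊥₁}`, defined on a member of the family, extend. -/
lemma exists_extension (F : HillFamily S D) (hS : IsResolvingFP_s1 S) (hN : IsB S N)
    (f : E →ₗ.[R] N) (hf : F.H f.domain) {L : Submodule R E} (hL : F.H₀ L) :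
    ∃ f' : E →ₗ.[R] N, f ≤ f' ∧ f'.domain = f.domain ⊔ L := by
  have hle : f.domain ≤ f.domain ⊔ L := le_sup_left
  obtain ⟨e, he⟩ := hN.extend hS (i := Submodule.inclusion hle)
    (π := (f.domain.submoduleOf (f.domain ⊔ L)).mkQ) (Submodule.inclusion_injective hle)
    (Submodule.mkQ_surjective _) (by
      intro x
      rw [← LinearMap.mem_ker, Submodule.ker_mkQ, ← LinearMap.coe_range, Submodule.range_inclusion]
      rfl) (F.quot_mem _ _ hf hL) f.toFun
  refine ⟨⟨f.domain ⊔ L, e⟩, ⟨hle, ?_⟩, rfl⟩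
  intro x y hxy
  have : y = Submodule.inclusion hle x := Subtype.ext hxy.symm
  rw [this]
  exact (he x).symm

/-- The Eklof lemma. -/
theorem extend (F : HillFamily S D) (hS : IsResolvingFP_s1 S) (hN : IsB S N) (g : D →ₗ[R] N) :
    ∃ e : E →ₗ[R] N, ∀ d : D, e d = g d := by
  obtain ⟨m, hgm, hm⟩ := zorn_le_nonempty₀ {f : E →ₗ.[R] N | F.H f.domain}
    (fun c hcs hc y hy => by
      refine ⟨LinearPMap.sSup c hc.directedOn, ?_, fun z hz => LinearPMap.le_sSup hc.directedOn hz⟩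
      change F.H (sSup (LinearPMap.domain '' c))
      refine F.sSup_mem_of_nonempty ⟨_, y, hy, rfl⟩ ?_
      rintro _ ⟨f, hf, rfl⟩
      exact hcs hf) ⟨D, g⟩ F.bot_mem
  have htop : ∀ x, x ∈ m.domain := by
    intro x
    obtain ⟨L, hL, hxL⟩ := F.exists_H₀ (R ∙ x) (Submodule.fg_span_singleton x)
    obtain ⟨f', hle, hdom⟩ := F.exists_extension hS hN m hm.1 hL
    have hf' : F.H f'.domain := by
      rw [hdom]
      exact F.sup_mem hm.1 (F.H_of_H₀ _ hL)
    have hle' : f'.domain ≤ m.domain := (hm.2 hf' hle).1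
    rw [hdom] at hle'
    exact hle' (le_sup_right (a := m.domain) (hxL (Submodule.mem_span_singleton_self x)))
  refine ⟨m.toFun ∘ₗ LinearMap.codRestrict m.domain LinearMap.id htop, fun d => ?_⟩
  exact (hgm.2 rfl).symm

theorem factorsFP (F : HillFamily S D) (hS : IsResolvingFP_s1 S) (hD : FactorsFP S D) :
    FactorsFP S E := by
  intro W _ _ hW w
  have hfg : (LinearMap.range w).FG := by
    rw [LinearMap.range_eq_map]
    exact Module.Finite.fg_top.map w
  obtain ⟨L, hL, hwL⟩ := F.exists_H₀ (LinearMap.range w) hfg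
  have hDL : D ≤ L := F.le_of_mem _ (F.H_of_H₀ _ hL)
  have hq := F.quot_mem D L F.bot_mem hL
  rw [sup_eq_right.2 hDL] at hq
  have hLf : FactorsFP S L := hD.extension hS (i := Submodule.inclusion hDL)
    (π := (D.submoduleOf L).mkQ) (Submodule.inclusion_injective hDL)
    (Submodule.mkQ_surjective _) (by
      intro x
      rw [← LinearMap.mem_ker, Submodule.ker_mkQ, ← LinearMap.coe_range, Submodule.range_inclusion]
      rfl) hq
  obtain ⟨T, hT, a, b, hab⟩ := hLf W hW
    (w.codRestrict L fun x => hwL (LinearMap.mem_range_self w x))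
  refine ⟨T, hT, a, L.subtype ∘ₗ b, fun x => ?_⟩
  simp [hab]

end HillFamily

section SequentialColimit

variable {G : ℕ → Type u} [∀ k, AddCommGroup (G k)] [∀ k, Module R (G k)]

/-- The transition maps of a sequence of linear maps. -/
def seqMap (s : ∀ k, G k →ₗ[R] G (k + 1)) (i j : ℕ) (h : i ≤ j) : G i →ₗ[R] G j :=
  Nat.leRec (motive := fun j _ => G i →ₗ[R] G j) LinearMap.id (fun j _ φ => s j ∘ₗ φ) h

lemma seqMap_self (s : ∀ k, G k →ₗ[R] G (k + 1)) (i : ℕ) (h : i ≤ i) :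
    seqMap s i i h = LinearMap.id :=
  Nat.leRec_self _ _

lemma seqMap_succ (s : ∀ k, G k →ₗ[R] G (k + 1)) {i j : ℕ} (h : i ≤ j) (h' : i ≤ j + 1) :
    seqMap s i (j + 1) h' = s j ∘ₗ seqMap s i j h :=
  Nat.leRec_succ _ _ h

lemma seqMap_trans (s : ∀ k, G k →ₗ[R] G (k + 1)) {i j k : ℕ} (h : i ≤ j) (h' : j ≤ k) (x : G i) :
    seqMap s j k h' (seqMap s i j h x) = seqMap s i k (h.trans h') x := by
  induction k, h' using Nat.le_induction with
  | base => simp [seqMap_self]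
  | succ k h' ih => simp [seqMap_succ s h', seqMap_succ s (h.trans h'), ih]

lemma seqMap_injective (s : ∀ k, G k →ₗ[R] G (k + 1)) (hs : ∀ k, Function.Injective (s k))
    {i j : ℕ} (h : i ≤ j) : Function.Injective (seqMap s i j h) := by
  induction j, h using Nat.le_induction with
  | base => simpa [seqMap_self] using Function.injective_id
  | succ k h' ih => simpa [seqMap_succ s h'] using (hs k).comp ih

/-- The union of an increasing sequence of modules. -/
theorem exists_sequential_colimit (s : ∀ k, G k →ₗ[R] G (k + 1))
    (hs : ∀ k, Function.Injective (s k)) :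
    ∃ (E : Type u) (_ : AddCommGroup E) (_ : Module R E) (c : ∀ k, G k →ₗ[R] E),
      (∀ k, Function.Injective (c k)) ∧ (∀ k x, c (k + 1) (s k x) = c k x) ∧
      (∀ x, ∃ k y, c k y = x) ∧
      ∀ (A : Type u) [AddCommGroup A] [Module R A] (φ : ∀ k, G k →ₗ[R] A),
        (∀ k x, φ (k + 1) (s k x) = φ k x) → ∃ p : E →ₗ[R] A, ∀ k x, p (c k x) = φ k x := by
  have : DirectedSystem G (seqMap s · · ·) :=
    { map_self := fun i x => by rw [seqMap_self]; rfl
      map_map := fun i j k h h' x => seqMap_trans s h h' x }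
  refine ⟨Module.DirectLimit G (seqMap s), inferInstance, inferInstance,
    fun k => Module.DirectLimit.of R ℕ G (seqMap s) k, ?_, ?_, ?_, ?_⟩
  · intro k
    rw [← LinearMap.ker_eq_bot, LinearMap.ker_eq_bot']
    intro x hx
    obtain ⟨j, hj, h⟩ := Module.DirectLimit.of.zero_exact hx
    exact seqMap_injective s hs hj (by simpa using h)
  · intro k x
    have := Module.DirectLimit.of_f (f := seqMap s) (hij := k.le_succ) (x := x)
    rwa [seqMap_succ s le_rfl, seqMap_self] at this
  · intro x
    exact Module.DirectLimit.exists_of x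
  · intro A _ _ φ hφ
    have hφ' : ∀ i j hij x, φ j (seqMap s i j hij x) = φ i x := by
      intro i j hij x
      induction j, hij using Nat.le_induction with
      | base => simp [seqMap_self]
      | succ k h' ih => simp [seqMap_succ s h', hφ, ih]
    exact ⟨Module.DirectLimit.lift R ℕ G (seqMap s) φ hφ', fun k x => by simp⟩

end SequentialColimit

section OneStep

variable {A : Type u} [AddCommGroup A] [Module R A]

/-- A lifting problem against `f` for an inclusion `K ≤ Rⁿ` with cokernel in `S`. -/
structure LiftingProblem (S : Set (ModuleCat.{u} R)) (f : M →ₗ[R] A) : Type u where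
  n : ℕ
  K : Submodule R (Fin n → R)
  mem : Mem S ((Fin n → R) ⧸ K)
  g : K →ₗ[R] M
  e : (Fin n → R) →ₗ[R] A
  comm : ∀ k : K, f (g k) = e k

variable (S) in
/-- Simultaneous pushout solving all lifting problems against `f`. -/
theorem exists_attach_s1 (f : M →ₗ[R] A) :
    ∃ (M₁ : Type u) (_ : AddCommGroup M₁) (_ : Module R M₁) (s : M →ₗ[R] M₁) (f₁ : M₁ →ₗ[R] A)
      (a : ∀ j : LiftingProblem S f, (Fin j.n → R) →ₗ[R] M₁),
      Function.Injective s ∧ (∀ x, f₁ (s x) = f x) ∧ (∀ j (k : j.K), a j k = s (j.g k)) ∧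
      (∀ j r, f₁ (a j r) = j.e r) ∧
      (LinearMap.range s ⊔ ⨆ j, LinearMap.range (a j) = ⊤) ∧
      ∀ j r, a j r ∈ LinearMap.range s ⊔ ⨆ (i) (_ : i ≠ j), LinearMap.range (a i) → r ∈ j.K := by
  classical
  let T := Π₀ j : LiftingProblem S f, (Fin j.n → R)
  let T₀ := Π₀ j : LiftingProblem S f, j.K
  let γ : T₀ →ₗ[R] M := DFinsupp.lsum ℕ fun j => j.g
  let σ : T₀ →ₗ[R] T := DFinsupp.mapRange.linearMap fun j => j.K.subtype
  let ε : T →ₗ[R] A := DFinsupp.lsum ℕ fun j => j.e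
  let L (j : LiftingProblem S f) : (Fin j.n → R) →ₗ[R] T :=
    DFinsupp.lsingle (M := fun j : LiftingProblem S f => Fin j.n → R) j
  let L₀ (j : LiftingProblem S f) : j.K →ₗ[R] T₀ :=
    DFinsupp.lsingle (M := fun j : LiftingProblem S f => j.K) j
  have hσa : ∀ x j, (σ x) j = (x j : Fin j.n → R) := fun x j => rfl
  have hσL : ∀ j k, σ (L₀ j k) = L j k := fun j k =>
    DFinsupp.mapRange_single (hf := fun _ => rfl)
  have hγL : ∀ j k, γ (L₀ j k) = j.g k := fun j k => by
    exact DFinsupp.lsum_single ℕ (fun j : LiftingProblem S f => j.g) j k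
  have hεL : ∀ j r, ε (L j r) = j.e r := fun j r => by
    exact DFinsupp.lsum_single ℕ (fun j : LiftingProblem S f => j.e) j r
  have hL : ∀ j r, L j r j = r := fun j r => DFinsupp.single_eq_same
  have hL' : ∀ i j r, i ≠ j → L i r j = 0 := fun i j r h => DFinsupp.single_eq_of_ne h.symm
  have hε : ∀ x, f (γ x) = ε (σ x) := by
    have : f ∘ₗ γ = ε ∘ₗ σ := by
      refine DFinsupp.lhom_ext' fun j => LinearMap.ext fun k => ?_
      change f (γ (L₀ j k)) = ε (σ (L₀ j k))
      rw [hσL, hγL, hεL, j.comm]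
    exact fun x => LinearMap.congr_fun this x
  have hσ : ∀ x, σ x = 0 → x = 0 := by
    intro x hx
    ext1 j
    have := DFunLike.congr_fun hx j
    rw [hσa] at this
    exact Subtype.ext this
  let θ : T₀ →ₗ[R] M × T := LinearMap.prod γ (-σ)
  have hθ : ∀ x, θ x = (γ x, -σ x) := fun _ => rfl
  let q := (LinearMap.range θ).mkQ
  have hq : ∀ m t, q (m, t) = 0 ↔ ∃ x, γ x = m ∧ -σ x = t := by
    intro m t
    rw [Submodule.mkQ_apply, Submodule.Quotient.mk_eq_zero, LinearMap.mem_range]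
    simp [hθ]
  let f₁ : ((M × T) ⧸ LinearMap.range θ) →ₗ[R] A :=
    (LinearMap.range θ).liftQ (LinearMap.coprod f ε) (by
    rintro _ ⟨x, rfl⟩
    simp [hθ, hε])
  have hf₁ : ∀ m t, f₁ (q (m, t)) = f m + ε t := fun m t => by
    simp only [f₁, q, Submodule.mkQ_apply, Submodule.liftQ_apply, LinearMap.coprod_apply]
  let pr (j : LiftingProblem S f) : ((M × T) ⧸ LinearMap.range θ) →ₗ[R] (Fin j.n → R) ⧸ j.K :=
    (LinearMap.range θ).liftQ (j.K.mkQ ∘ₗ DFinsupp.lapply j ∘ₗ LinearMap.snd R M T) (by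
      rintro _ ⟨x, rfl⟩
      refine (Submodule.Quotient.mk_eq_zero _).2 ?_
      exact neg_mem (x j).2)
  have hpr : ∀ j m t, pr j (q (m, t)) = j.K.mkQ (t j) := fun j m t => rfl
  refine ⟨(M × T) ⧸ LinearMap.range θ, inferInstance, inferInstance, q ∘ₗ LinearMap.inl R M T, f₁,
    fun j => q ∘ₗ LinearMap.inr R M T ∘ₗ L j, ?_, ?_, ?_, ?_, ?_, ?_⟩
  · rw [← LinearMap.ker_eq_bot, LinearMap.ker_eq_bot']
    intro m hm
    obtain ⟨x, rfl, hx⟩ := (hq _ _).1 hm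
    rw [hσ x (neg_eq_zero.1 hx), map_zero]
  · intro x
    simp [hf₁]
  · intro j k
    rw [← sub_eq_zero]
    change q (0, L j k) - q (j.g k, 0) = 0
    rw [← map_sub, Prod.mk_sub_mk]
    refine (hq _ _).2 ⟨L₀ j (-k), ?_, ?_⟩
    · rw [hγL, map_neg, zero_sub]
    · rw [hσL, Submodule.coe_neg, map_neg, neg_neg, sub_zero]
  · intro j r
    simp [hf₁, hεL]
  · rw [eq_top_iff]
    rintro x -
    obtain ⟨⟨m, t⟩, rfl⟩ := Submodule.mkQ_surjective _ x
    have h1 : ∀ t : T, q (0, t) ∈ ⨆ j, LinearMap.range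
        (q ∘ₗ LinearMap.inr R M T ∘ₗ
          DFinsupp.lsingle (M := fun j : LiftingProblem S f => Fin j.n → R) j) := by
      intro t
      induction t using DFinsupp.induction with
      | h0 => exact (map_zero q).symm ▸ zero_mem _
      | ha j b t _ _ ih =>
        have : q (0, DFinsupp.single j b + t) = q (0, DFinsupp.single j b) + q (0, t) := by
          rw [← map_add]; simp
        rw [this]
        exact add_mem (Submodule.mem_iSup_of_mem j ⟨b, rfl⟩) ih
    have : q (m, t) = q (m, 0) + q (0, t) := by rw [← map_add]; simp
    change q (m, t) ∈ _
    rw [this]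
    exact Submodule.add_mem_sup ⟨m, rfl⟩ (h1 t)
  · intro j r h
    have h1 : LinearMap.range (q ∘ₗ LinearMap.inl R M T) ⊔ ⨆ (i) (_ : i ≠ j), LinearMap.range
        (q ∘ₗ LinearMap.inr R M T ∘ₗ L i)
        ≤ LinearMap.ker (pr j) := by
      refine sup_le ?_ (iSup₂_le fun i hi => ?_)
      · rintro _ ⟨m, rfl⟩
        change pr j (q (m, 0)) = 0
        rw [hpr]
        exact map_zero _
      · rintro _ ⟨b, rfl⟩
        change pr j (q (0, L i b)) = 0
        rw [hpr, hL' i j _ hi]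
        exact map_zero _
    have h2 : pr j (q (0, L j r)) = 0 := h1 h
    rw [hpr, hL] at h2
    exact (Submodule.Quotient.mk_eq_zero _).1 h2

end OneStep

section Stages

variable {A : Type u} [AddCommGroup A] [Module R A]

variable (R A) in
/-- A module over `A`. -/
structure Stage : Type (u + 1) where
  carrier : Type u
  [grp : AddCommGroup carrier]
  [mod : Module R carrier]
  f : carrier →ₗ[R] A

attribute [instance] Stage.grp Stage.mod

/-- The data provided by `exists_attach`. -/
structure Attachment (S : Set (ModuleCat.{u} R)) (X : Stage R A) : Type (u + 1) where
  next : Stage R A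
  s : X.carrier →ₗ[R] next.carrier
  a : ∀ j : LiftingProblem S X.f, (Fin j.n → R) →ₗ[R] next.carrier
  injective : Function.Injective s
  f_s : ∀ x, next.f (s x) = X.f x
  a_eq : ∀ j (k : j.K), a j k = s (j.g k)
  f_a : ∀ j r, next.f (a j r) = j.e r
  span : LinearMap.range s ⊔ ⨆ j, LinearMap.range (a j) = ⊤
  mem_of_mem : ∀ j r,
    a j r ∈ LinearMap.range s ⊔ ⨆ (i) (_ : i ≠ j), LinearMap.range (a i) → r ∈ j.K

variable (S) in
lemma nonempty_attachment (X : Stage R A) : Nonempty (Attachment S X) := by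
  obtain ⟨M₁, _, _, s, f₁, a, h1, h2, h3, h4, h5, h6⟩ := exists_attach_s1 S X.f
  exact ⟨⟨⟨M₁, f₁⟩, s, a, h1, h2, h3, h4, h5, h6⟩⟩

variable (S) in
/-- A chosen attachment. -/
noncomputable def attachment (X : Stage R A) : Attachment S X :=
  Classical.choice (nonempty_attachment S X)

variable (S) in
/-- The iterated attachments. -/
noncomputable def stages (X : Stage R A) : ℕ → Stage R A
  | 0 => X
  | k + 1 => (attachment S (stages X k)).next

end Stages

lemma exists_wellOrder_of_rank (J : Type u) (κ : J → ℕ) :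
    ∃ (_ : LinearOrder J) (_ : WellFoundedLT J),
      (∀ i j : J, i < j → κ i ≤ κ j) ∧ ∀ i j : J, κ i < κ j → i < j := by
  obtain ⟨o, ho⟩ := exists_wellFoundedLT J
  let φ : J → ℕ ×ₗ J := fun j => toLex (κ j, j)
  have hφ : Function.Injective φ := fun i j h => congrArg (fun x => (ofLex x).2) h
  have hwf : WellFounded fun i j : J => φ i < φ j := InvImage.wf φ wellFounded_lt
  have h1 : ∀ i j : J, φ i < φ j → κ i ≤ κ j := fun i j h => by
    rcases Prod.Lex.toLex_lt_toLex.1 h with h1 | h1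
    exacts [h1.le, h1.1.le]
  have h2 : ∀ i j : J, κ i < κ j → φ i < φ j := fun i j h =>
    Prod.Lex.toLex_lt_toLex.2 (Or.inl h)
  exact ⟨LinearOrder.lift' φ hφ, ⟨hwf⟩, h1, h2⟩

lemma exists_le_of_fg {E : Type u} [AddCommGroup E] [Module R E] {U : ℕ → Submodule R E}
    (hU : Monotone U) (h : ∀ x, ∃ k, x ∈ U k) {F : Submodule R E} (hF : F.FG) :
    ∃ k, F ≤ U k := by
  obtain ⟨s, rfl⟩ := hF
  choose k hk using h
  refine ⟨s.sup k, Submodule.span_le.2 fun x hx => hU (Finset.le_sup hx) (hk x)⟩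

/-- `p` has the right lifting property with respect to inclusions `K ≤ Rⁿ` with cokernel
in `S`. -/
def HasRLP (S : Set (ModuleCat.{u} R)) (p : M →ₗ[R] N) : Prop :=
  ∀ (n : ℕ) (K : Submodule R (Fin n → R)), Mem S ((Fin n → R) ⧸ K) → ∀ (g : K →ₗ[R] M)
    (e : (Fin n → R) →ₗ[R] N), (∀ k : K, p (g k) = e k) →
    ∃ h : (Fin n → R) →ₗ[R] M, (∀ k : K, h k = g k) ∧ ∀ r, p (h r) = e r

/-- The small object argument. -/
theorem exists_factorization (hS : IsResolvingFP_s1 S) {A : Type u} [AddCommGroup A] [Module R A]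
    (f : M →ₗ[R] A) :
    ∃ (E : Type u) (_ : AddCommGroup E) (_ : Module R E) (i : M →ₗ[R] E) (p : E →ₗ[R] A),
      Function.Injective i ∧ (∀ x, p (i x) = f x) ∧ HasRLP S p ∧
      IsCellular S (LinearMap.range i) := by
  let X := stages S (⟨M, f⟩ : Stage R A)
  let T := fun k => attachment S (X k)
  let s : ∀ k, (X k).carrier →ₗ[R] (X (k + 1)).carrier := fun k => (T k).s
  let a : ∀ k (j : LiftingProblem S (X k).f), (Fin j.n → R) →ₗ[R] (X (k + 1)).carrier :=
    fun k => (T k).a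
  have ha : ∀ k j (x : j.K), a k j x = s k (j.g x) := fun k => (T k).a_eq
  have hsp : ∀ k, LinearMap.range (s k) ⊔ ⨆ j, LinearMap.range (a k j) = ⊤ :=
    fun k => (T k).span
  obtain ⟨E, _, _, c, hc, hcs, hcE, hlift⟩ := exists_sequential_colimit s
    fun k => (T k).injective
  obtain ⟨p, hp⟩ := hlift A (fun k => (X k).f) fun k => (T k).f_s
  have hmono : Monotone fun k => LinearMap.range (c k) := by
    refine monotone_nat_of_le_succ fun k => ?_
    rintro _ ⟨x, rfl⟩
    exact ⟨s k x, hcs k x⟩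
  refine ⟨E, inferInstance, inferInstance, c 0, p, hc 0, hp 0, ?_, ?_⟩
  · intro n K hK g e hge
    have := hS.finitePresentation hK
    have hKfg := Module.FinitePresentation.fg_ker K.mkQ K.mkQ_surjective
    rw [Submodule.ker_mkQ] at hKfg
    have : Module.Finite R K := Module.Finite.iff_fg.2 hKfg
    have hg : (LinearMap.range g).FG := by
      rw [LinearMap.range_eq_map]
      exact Module.Finite.fg_top.map g
    obtain ⟨k, hk⟩ := exists_le_of_fg hmono hcE hg
    obtain ⟨g', hg'⟩ := exists_lift_of_injective (c k) (hc k) g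
      fun x => hk (LinearMap.mem_range_self g x)
    let j : LiftingProblem S (X k).f := ⟨n, K, hK, g', e, fun x => by rw [← hp, hg', hge]⟩
    refine ⟨c (k + 1) ∘ₗ a k j, fun x => ?_, fun r => ?_⟩
    · rw [LinearMap.comp_apply, ha k j, hcs]
      exact hg' x
    · rw [LinearMap.comp_apply, hp]
      exact (T k).f_a j r
  · obtain ⟨o, ho, ho1, ho2⟩ := exists_wellOrder_of_rank
      (Σ k, LiftingProblem S (X k).f) Sigma.fst
    let A : (Σ k, LiftingProblem S (X k).f) → Submodule R E :=
      fun j => LinearMap.range (c (j.1 + 1) ∘ₗ a j.1 j.2)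
    have hspan : ∀ k, LinearMap.range (c k) ≤ cellSpan (LinearMap.range (c 0)) A {j | j.1 < k} := by
      intro k
      induction k with
      | zero => exact le_cellSpan _
      | succ k ih =>
        rw [LinearMap.range_eq_map, ← hsp k, Submodule.map_sup, Submodule.map_iSup]
        refine sup_le ?_ (iSup_le fun j => ?_)
        · rw [← LinearMap.range_comp]
          have : c (k + 1) ∘ₗ s k = c k := LinearMap.ext (hcs k)
          rw [this]
          exact ih.trans (cellSpan_mono fun i hi => Nat.lt_succ_of_lt hi)
        · rw [← LinearMap.range_comp]
          exact cell_le_cellSpan (A := A) (i := ⟨k, j⟩) (Nat.lt_succ_self k)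
    refine ⟨_, o, ho, A, fun j => ?_, ?_, ?_⟩
    · rw [show A j = LinearMap.range _ from rfl, LinearMap.range_eq_map]
      exact Module.Finite.fg_top.map _
    · rintro ⟨k, j⟩
      let L := cellSpan (LinearMap.range (c 0)) A (Set.Iio ⟨k, j⟩)
      let φ : (Fin j.n → R) →ₗ[R] A ⟨k, j⟩ := (c (k + 1) ∘ₗ a k j).rangeRestrict
      let ψ := (L.submoduleOf (A ⟨k, j⟩)).mkQ ∘ₗ φ
      have hψ : Function.Surjective ψ :=
        (Submodule.mkQ_surjective _).comp (LinearMap.surjective_rangeRestrict _)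
      have hker : j.K = LinearMap.ker ψ := by
        ext r
        have h1 : r ∈ LinearMap.ker ψ ↔ c (k + 1) (a k j r) ∈ L := by
          rw [LinearMap.mem_ker, LinearMap.comp_apply, Submodule.mkQ_apply,
            Submodule.Quotient.mk_eq_zero]
          rfl
        rw [h1]
        constructor
        · intro hr
          rw [ha k j ⟨r, hr⟩, hcs]
          refine cellSpan_mono ?_ (hspan k (LinearMap.mem_range_self _ _))
          exact fun i hi => ho2 _ _ hi
        · intro hr
          have hle : L ≤ (LinearMap.range (s k) ⊔
              ⨆ (i) (_ : i ≠ j), LinearMap.range (a k i)).map (c (k + 1)) := by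
            have hk : LinearMap.range (c k) ≤ (LinearMap.range (s k)).map (c (k + 1)) := by
              rintro _ ⟨x, rfl⟩
              exact ⟨s k x, ⟨x, rfl⟩, hcs k x⟩
            rw [Submodule.map_sup]
            refine cellSpan_le ?_ ?_
            · exact le_sup_of_le_left ((hmono (Nat.zero_le k)).trans hk)
            · rintro ⟨l, i⟩ hi
              have hlt : (⟨l, i⟩ : Σ k, LiftingProblem S (X k).f) < ⟨k, j⟩ := hi
              rcases (ho1 _ _ hlt).lt_or_eq with hl | hl
              · refine le_sup_of_le_left (le_trans ?_ ((hmono (Nat.succ_le_of_lt hl)).trans hk))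
                rintro _ ⟨x, rfl⟩
                exact LinearMap.mem_range_self _ _
              · obtain rfl : l = k := hl
                have hij : i ≠ j := by
                  rintro rfl
                  exact lt_irrefl _ hlt
                refine le_sup_of_le_right ?_
                change LinearMap.range (c (l + 1) ∘ₗ a l i) ≤ _
                rw [LinearMap.range_comp]
                exact Submodule.map_mono (le_iSup₂_of_le i hij le_rfl)
          obtain ⟨y, hy, hyr⟩ := hle hr
          rw [hc (k + 1) hyr] at hy
          exact (T k).mem_of_mem j r hy
      refine hS.mem_congr ?_ j.mem
      exact Submodule.quotEquivOfEq _ _ hker ≪≫ₗ ψ.quotKerEquivOfSurjective hψ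
    · rw [eq_top_iff]
      rintro x -
      obtain ⟨k, y, rfl⟩ := hcE x
      exact cellSpan_mono (Set.subset_univ _) (hspan k (LinearMap.mem_range_self _ _))

lemma HasRLP.isB_ker {p : M →ₗ[R] N} (hp : HasRLP S p) : IsB S (LinearMap.ker p) := by
  intro n K hK g
  obtain ⟨h, h1, h2⟩ := hp n K hK ((LinearMap.ker p).subtype ∘ₗ g) 0 fun k => (g k).2
  exact ⟨h.codRestrict _ fun r => h2 r, fun k => Subtype.ext (h1 k)⟩

lemma HasRLP.isB [Subsingleton N] {p : M →ₗ[R] N} (hp : HasRLP S p) : IsB S M := by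
  intro n K hK g
  obtain ⟨h, h1, -⟩ := hp n K hK g 0 fun k => Subsingleton.elim _ _
  exact ⟨h, h1⟩

lemma HasRLP.surjective (hS : IsResolvingFP_s1 S) {p : M →ₗ[R] N} (hp : HasRLP S p) :
    Function.Surjective p := by
  intro x
  have hmem : Mem S ((Fin 1 → R) ⧸ (⊥ : Submodule R (Fin 1 → R))) :=
    hS.mem_congr (Submodule.quotEquivOfEqBot _ rfl).symm (hS.mem_pi 1)
  obtain ⟨h, -, h2⟩ := hp 1 ⊥ hmem 0 (LinearMap.toSpanSingleton R N x ∘ₗ LinearMap.proj 0)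
    fun k => by
      rw [Subsingleton.elim k 0]
      simp
  exact ⟨h fun _ => 1, by simp [h2]⟩

lemma FactorsFP.congr (e : M ≃ₗ[R] N) (hM : FactorsFP S M) : FactorsFP S N := by
  intro W _ _ hW w
  obtain ⟨T, hT, a, b, hab⟩ := hM W hW (e.symm.toLinearMap ∘ₗ w)
  exact ⟨T, hT, a, e.toLinearMap ∘ₗ b, fun x => by simp [hab]⟩

variable (M) in
/-- Special preenvelopes. -/
theorem exists_preenvelope (hS : IsResolvingFP_s1 S) :
    ∃ (B : Type u) (_ : AddCommGroup B) (_ : Module R B) (i : M →ₗ[R] B),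
      Function.Injective i ∧ IsB S B ∧ (FactorsFP S M → FactorsFP S B) ∧
      ∀ (N : Type u) [AddCommGroup N] [Module R N], IsB S N → ∀ g : M →ₗ[R] N,
        ∃ e : B →ₗ[R] N, ∀ x, e (i x) = g x := by
  obtain ⟨B, _, _, i, p, hi, -, hp, hcell⟩ := exists_factorization hS (0 : M →ₗ[R] PUnit.{u + 1})
  obtain ⟨F⟩ := hcell.nonempty_hillFamily hS
  let e := LinearEquiv.ofInjective i hi
  refine ⟨B, inferInstance, inferInstance, i, hi, hp.isB, fun h => F.factorsFP hS (h.congr e), ?_⟩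
  intro N _ _ hN g
  obtain ⟨g', hg'⟩ := F.extend hS hN (g ∘ₗ e.symm.toLinearMap)
  refine ⟨g', fun x => (hg' (e x)).trans ?_⟩
  simp

variable (M) in
/-- Special precovers. -/
theorem exists_precover (hS : IsResolvingFP_s1 S) :
    ∃ (E : Type u) (_ : AddCommGroup E) (_ : Module R E) (p : E →ₗ[R] M),
      Function.Surjective p ∧ IsB S (LinearMap.ker p) ∧
      Nonempty (HillFamily S (⊥ : Submodule R E)) := by
  obtain ⟨E, _, _, i, p, hi, -, hp, hcell⟩ := exists_factorization hS (0 : PUnit.{u + 1} →ₗ[R] M)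
  have : LinearMap.range i = ⊥ := by
    rw [eq_bot_iff]
    rintro _ ⟨x, rfl⟩
    exact map_zero i
  rw [this] at hcell
  exact ⟨E, inferInstance, inferInstance, p, hp.surjective hS, hp.isB_ker,
    hcell.nonempty_hillFamily hS⟩

lemma Ext1Zero.exists_section (h : Ext1Zero (ModuleCat.of R P) (ModuleCat.of R M))
    {i : M →ₗ[R] N} {π : N →ₗ[R] P} (hi : Function.Injective i) (hπ : Function.Surjective π)
    (hex : Function.Exact i π) : ∃ s : P →ₗ[R] N, ∀ x, π (s x) = x := by
  obtain ⟨s, hs⟩ := h _ _ _ _ (shortExact_of_s1 hi hπ hex)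
  refine ⟨s.hom, fun x => ?_⟩
  exact LinearMap.congr_fun (congrArg ModuleCat.Hom.hom hs) x

lemma IsB.mem_rightPerp (hS : IsResolvingFP_s1 S) (hN : IsB S N) : Mem (rightPerp S) N := by
  intro X hX E i p w hsh
  obtain ⟨l, hl⟩ := hN.lift hS (κ := i.hom) (π := p.hom) hsh.moduleCat_injective_f
    hsh.moduleCat_surjective_g
    ((ShortComplex.ShortExact.moduleCat_exact_iff_function_exact _).1 hsh.exact) hX LinearMap.id
  exact ⟨ModuleCat.ofHom l, ModuleCat.hom_ext (LinearMap.ext hl)⟩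

lemma IsB.of_mem_rightPerp (hN : Mem (rightPerp S) N) : IsB S N := by
  intro n K hK g
  let θ : K →ₗ[R] N × (Fin n → R) := LinearMap.prod g (-K.subtype)
  have hθ : ∀ k, θ k = (g k, -(k : Fin n → R)) := fun _ => rfl
  let q := (LinearMap.range θ).mkQ
  have hq : ∀ x, q x = 0 ↔ ∃ k, θ k = x := fun x => by
    rw [Submodule.mkQ_apply, Submodule.Quotient.mk_eq_zero]; rfl
  let i := q ∘ₗ LinearMap.inl R N (Fin n → R)
  have hi : Function.Injective i := by
    rw [← LinearMap.ker_eq_bot, LinearMap.ker_eq_bot']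
    intro m hm
    obtain ⟨k, hk⟩ := (hq _).1 hm
    rw [hθ] at hk
    obtain ⟨h1, h2⟩ := Prod.mk.inj hk
    have : k = 0 := Subtype.ext (neg_eq_zero.1 h2)
    exact (h1.symm.trans (congrArg g this)).trans (map_zero g)
  let π : ((N × (Fin n → R)) ⧸ LinearMap.range θ) →ₗ[R] (Fin n → R) ⧸ K :=
    (LinearMap.range θ).liftQ (K.mkQ ∘ₗ LinearMap.snd R N (Fin n → R)) (by
      rintro _ ⟨k, rfl⟩
      refine (Submodule.Quotient.mk_eq_zero _).2 ?_
      exact neg_mem k.2)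
  have hπq : ∀ x, π (q x) = K.mkQ x.2 := fun _ => rfl
  have hqK : ∀ k : K, q (0, k) = i (g k) := by
    intro k
    rw [← sub_eq_zero]
    change q _ - q _ = 0
    rw [← map_sub, hq]
    refine ⟨-k, ?_⟩
    rw [map_neg, hθ]
    ext <;> simp
  have hex : Function.Exact i π := by
    intro x
    obtain ⟨⟨m, r⟩, rfl⟩ := Submodule.mkQ_surjective _ x
    change π (q _) = 0 ↔ _
    rw [hπq, Submodule.mkQ_apply, Submodule.Quotient.mk_eq_zero]
    constructor
    · intro hr
      refine ⟨m + g ⟨r, hr⟩, ?_⟩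
      rw [map_add, ← hqK]
      change q _ + q _ = q _
      rw [← map_add]
      simp
    · rintro ⟨m', hm'⟩
      have := congrArg π hm'
      change π (q _) = π (q _) at this
      rw [hπq, hπq] at this
      exact (Submodule.Quotient.mk_eq_zero _).1 (this.symm.trans (map_zero _))
  obtain ⟨s, hs⟩ := (hN _ hK).exists_section hi (fun x => by
    obtain ⟨r, rfl⟩ := Submodule.mkQ_surjective _ x
    exact ⟨q (0, r), rfl⟩) hex
  obtain ⟨e, he⟩ := exists_lift_of_injective i hi
    (q ∘ₗ LinearMap.inr R N (Fin n → R) - s ∘ₗ K.mkQ) (fun r => by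
      refine (hex _).1 ?_
      rw [LinearMap.sub_apply, map_sub, LinearMap.comp_apply s, hs, sub_eq_zero]
      rfl)
  refine ⟨e, fun k => hi ?_⟩
  rw [he, ← hqK, LinearMap.sub_apply, LinearMap.comp_apply s, Submodule.mkQ_apply,
    (Submodule.Quotient.mk_eq_zero _).2 k.2, map_zero, sub_zero]
  rfl

/-- Maps from modules in `^{⊥₁}(S^{⊥₁})` lift along surjections with kernel in `S^{⊥₁}`. -/
lemma exists_lift_of_mem_leftPerp_s1 (hS : IsResolvingFP_s1 S) (hM : Mem (leftPerp (rightPerp S)) M)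
    (π : N →ₗ[R] P) (hπ : Function.Surjective π) (hker : IsB S (LinearMap.ker π))
    (q : M →ₗ[R] P) : ∃ l : M →ₗ[R] N, ∀ x, π (l x) = q x := by
  let L : Submodule R (N × M) := LinearMap.ker (LinearMap.coprod π (-q))
  have hL : ∀ x : N × M, x ∈ L ↔ π x.1 = q x.2 := fun x => by
    rw [LinearMap.mem_ker, LinearMap.coprod_apply, LinearMap.neg_apply, ← sub_eq_add_neg,
      sub_eq_zero]
  let i : LinearMap.ker π →ₗ[R] L :=
    (LinearMap.inl R N M ∘ₗ (LinearMap.ker π).subtype).codRestrict L fun x =>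
      (hL _).2 (x.2.trans (map_zero q).symm)
  have hi : Function.Injective i := fun x y h =>
    Subtype.ext (congrArg (fun z : L => z.1.1) h)
  let ρ : L →ₗ[R] M := LinearMap.snd R N M ∘ₗ L.subtype
  have hρ : Function.Surjective ρ := fun m => by
    obtain ⟨x, hx⟩ := hπ (q m)
    exact ⟨⟨(x, m), (hL _).2 hx⟩, rfl⟩
  have hex : Function.Exact i ρ := by
    rintro ⟨⟨x, m⟩, h⟩
    constructor
    · intro hm
      obtain rfl : m = 0 := hm
      exact ⟨⟨x, ((hL _).1 h).trans (map_zero q)⟩, rfl⟩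
    · rintro ⟨y, hy⟩
      exact congrArg (fun z : L => z.1.2) hy.symm
  obtain ⟨s, hs⟩ := (hM _ (hker.mem_rightPerp hS)).exists_section hi hρ hex
  refine ⟨LinearMap.fst R N M ∘ₗ L.subtype ∘ₗ s, fun x => ?_⟩
  exact ((hL _).1 (s x).2).trans (congrArg q (hs x))

section NullHomotopic

variable {Y : ℤ → Type u} [∀ n, AddCommGroup (Y n)] [∀ n, Module R (Y n)]

/-- All maps from finitely presented modules into the cocycles lift along the differential. -/
def PureAcyclic (d : ∀ n, Y n →ₗ[R] Y (n + 1)) : Prop :=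
  ∀ (m : ℤ) (W : Type u) [AddCommGroup W] [Module R W], Module.FinitePresentation R W →
    ∀ w : W →ₗ[R] Y (m + 1), (∀ x, d (m + 1) (w x) = 0) → ∃ l : W →ₗ[R] Y m, ∀ x, d m (l x) = w x

lemma PureAcyclic.exists_lift_of_vanishing {d : ∀ n, Y n →ₗ[R] Y (n + 1)} (hd : PureAcyclic d)
    {P : ℤ → Type u} [∀ n, AddCommGroup (P n)] [∀ n, Module R (P n)]
    (hP : ∀ n, Module.FinitePresentation R (P n)) (dP : ∀ n, P n →ₗ[R] P (n + 1))
    (m : ℤ) (j : ℤ) (w : P (j + 1) →ₗ[R] Y (m + 1)) (hw : ∀ y, w (dP j y) = 0)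
    (hdw : ∀ x, d (m + 1) (w x) = 0) :
    ∃ l : P (j + 1) →ₗ[R] Y m, (∀ y, l (dP j y) = 0) ∧ ∀ x, d m (l x) = w x := by
  let p := (LinearMap.range (dP j)).mkQ
  have hp : Function.Surjective p := Submodule.mkQ_surjective _
  have hp0 : ∀ y, p (dP j y) = 0 := fun y =>
    (Submodule.Quotient.mk_eq_zero _).2 (LinearMap.mem_range_self _ y)
  have hfg : (LinearMap.range (dP j)).FG := by
    rw [LinearMap.range_eq_map]
    exact Module.Finite.fg_top.map _
  have hW := Module.finitePresentation_of_surjective p hp (by rwa [Submodule.ker_mkQ])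
  obtain ⟨w', hw'⟩ := exists_factor_s1 p hp w (by
    intro x hx
    obtain ⟨y, rfl⟩ := (Submodule.Quotient.mk_eq_zero _).1 hx
    exact hw y)
  obtain ⟨l, hl⟩ := hd m _ hW w' (by
    intro x
    obtain ⟨x, rfl⟩ := hp x
    rw [hw', hdw])
  refine ⟨l ∘ₗ p, fun y => ?_, fun x => ?_⟩
  · rw [LinearMap.comp_apply, hp0, map_zero]
  · rw [LinearMap.comp_apply, hl, hw']

/-- A chain map (of degree one) from a complex of finitely presented modules to a pure acyclic
complex is null-homotopic. -/
theorem PureAcyclic.exists_homotopy_of_fp {d : ∀ n, Y n →ₗ[R] Y (n + 1)} (hd : PureAcyclic d)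
    (hdd : ∀ n x, d (n + 1) (d n x) = 0)
    {P : ℤ → Type u} [∀ n, AddCommGroup (P n)] [∀ n, Module R (P n)]
    (hP : ∀ n, Module.FinitePresentation R (P n)) (dP : ∀ n, P n →ₗ[R] P (n + 1))
    (hdP : ∀ n x, dP (n + 1) (dP n x) = 0) (g : ∀ n, P n →ₗ[R] Y (n + 1))
    (hg : ∀ n x, d (n + 1) (g n x) = g (n + 1) (dP n x)) :
    ∃ k : ∀ n, P n →ₗ[R] Y n, ∀ n x, g n x = d n (k n x) + k (n + 1) (dP n x) := by
  have hq : ∀ n, ∃ q : P n →ₗ[R] Y (n + 1), (∀ j (h : j + 1 = n) y, q (h ▸ dP j y) = 0) ∧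
      ∀ x, d (n + 1) (q x) = d (n + 1) (g n x) := by
    intro n
    obtain ⟨j, rfl⟩ : ∃ j, n = j + 1 := ⟨n - 1, by omega⟩
    obtain ⟨l, h1, h2⟩ := hd.exists_lift_of_vanishing hP dP (j + 1 + 1) j
      (d (j + 1 + 1) ∘ₗ g (j + 1))
      (fun y => by rw [LinearMap.comp_apply, ← hg, hdd]) (fun x => hdd _ _)
    refine ⟨l, ?_, h2⟩
    intro i hi y
    obtain rfl : i = j := by omega
    exact h1 y
  choose q hq0 hq using hq
  have hq0' : ∀ n y, q (n + 1) (dP n y) = 0 := fun n y => hq0 (n + 1) n rfl y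
  have hl : ∀ n, ∃ l : P n →ₗ[R] Y n, ∀ x, d n (l x) = g n x - q n x := fun n =>
    hd n _ (hP n) (g n - q n) fun x => by rw [LinearMap.sub_apply, map_sub, hq, sub_self]
  choose l hl using hl
  have hk : ∀ n, ∃ k : P n →ₗ[R] Y n, (∀ j (h : j + 1 = n) y, k (h ▸ dP j y) = 0) ∧
      ∀ x, d n (k x) = q n x - l (n + 1) (dP n x) := by
    intro n
    obtain ⟨j, rfl⟩ : ∃ j, n = j + 1 := ⟨n - 1, by omega⟩
    obtain ⟨k, h1, h2⟩ := hd.exists_lift_of_vanishing hP dP (j + 1) j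
      (q (j + 1) - l (j + 1 + 1) ∘ₗ dP (j + 1))
      (fun y => by simp [hq0', hdP]) (fun x => by
        simp [hl, hq, hq0', hg])
    refine ⟨k, ?_, h2⟩
    intro i hi y
    obtain rfl : i = j := by omega
    exact h1 y
  choose k hk0 hk using hk
  have hk0' : ∀ n y, k (n + 1) (dP n y) = 0 := fun n y => hk0 (n + 1) n rfl y
  refine ⟨fun n => l n + k n, fun n x => ?_⟩
  simp [hl, hk, hk0']

end NullHomotopic

section Homotopy

variable {E Y : ℤ → Type u} [∀ n, AddCommGroup (E n)] [∀ n, Module R (E n)]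
  [∀ n, AddCommGroup (Y n)] [∀ n, Module R (Y n)]

/-- A null-homotopy of `f` defined on a subcomplex of `E`. -/
structure IsPartialHomotopy (dE : ∀ n, E n →ₗ[R] E (n + 1)) (dY : ∀ n, Y n →ₗ[R] Y (n + 1))
    (f : ∀ n, E n →ₗ[R] Y (n + 1)) (h : ∀ n, E n →ₗ.[R] Y n) : Prop where
  map_mem : ∀ n x, x ∈ (h n).domain → dE n x ∈ (h (n + 1)).domain
  eq : ∀ n (x : (h n).domain) (y : (h (n + 1)).domain), (y : E (n + 1)) = dE n x →
    f n x = dY n (h n x) + h (n + 1) y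

variable {dE : ∀ n, E n →ₗ[R] E (n + 1)} {dY : ∀ n, Y n →ₗ[R] Y (n + 1)}
  {f : ∀ n, E n →ₗ[R] Y (n + 1)}

lemma directedOn_image_eval {c : Set (∀ n, E n →ₗ.[R] Y n)} (hc : IsChain (· ≤ ·) c) (n : ℤ) :
    DirectedOn (· ≤ ·) ((fun h : ∀ n, E n →ₗ.[R] Y n => h n) '' c) := by
  rintro _ ⟨a, ha, rfl⟩ _ ⟨b, hb, rfl⟩
  obtain ⟨z, hz, haz, hbz⟩ := hc.directedOn a ha b hb
  exact ⟨z n, ⟨z, hz, rfl⟩, haz n, hbz n⟩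

lemma IsPartialHomotopy.sSup {c : Set (∀ n, E n →ₗ.[R] Y n)} (hc : IsChain (· ≤ ·) c)
    (hne : c.Nonempty) (h : ∀ z ∈ c, IsPartialHomotopy dE dY f z) :
    IsPartialHomotopy dE dY f fun n => LinearPMap.sSup _ (directedOn_image_eval hc n) where
  map_mem n x hx := by
    obtain ⟨_, ⟨z, hz, rfl⟩, hxz⟩ := (LinearPMap.mem_domain_sSup_iff (hne.image _) _).1 hx
    exact (LinearPMap.mem_domain_sSup_iff (hne.image _) _).2
      ⟨_, ⟨z, hz, rfl⟩, (h z hz).map_mem n x hxz⟩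
  eq n x y hxy := by
    obtain ⟨_, ⟨z, hz, rfl⟩, hxz⟩ := (LinearPMap.mem_domain_sSup_iff (hne.image _) _).1 x.2
    have hyz : (y : E (n + 1)) ∈ (z (n + 1)).domain := hxy ▸ (h z hz).map_mem n x hxz
    have h1 := (LinearPMap.le_sSup (directedOn_image_eval hc n) ⟨z, hz, rfl⟩).2
      (x := ⟨x, hxz⟩) (y := x) rfl
    have h2 := (LinearPMap.le_sSup (directedOn_image_eval hc (n + 1)) ⟨z, hz, rfl⟩).2
      (x := ⟨y, hyz⟩) (y := y) rfl
    rw [← h1, ← h2]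
    exact (h z hz).eq n ⟨x, hxz⟩ ⟨y, hyz⟩ hxy

/-- Every element of a complex with fine enough families of submodules lies in a small
subcomplex. -/
lemma exists_subcomplex (F : ∀ n, HillFamily S (⊥ : Submodule R (E n)))
    (m : ℤ) (x : E m) :
    ∃ L : ∀ n, Submodule R (E n), (∀ n, (F n).H₀ (L n)) ∧
      (∀ n y, y ∈ L n → dE n y ∈ L (n + 1)) ∧ x ∈ L m := by
  have hfg : ∀ n (N : Submodule R (E n)), (F n).H₀ N → N.FG := by
    intro n N hN
    obtain ⟨G, hG, rfl⟩ := (F n).exists_fg N hN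
    simpa using hG
  obtain ⟨L₀, hL₀, hx⟩ := (F m).exists_H₀ (R ∙ x) (Submodule.fg_span_singleton x)
  have hs : ∀ n (N : Submodule R (E n)), (F n).H₀ N → ∃ N', (F (n + 1)).H₀ N' ∧ N.map (dE n) ≤ N' :=
    fun n N hN => (F (n + 1)).exists_H₀ _ ((hfg n N hN).map _)
  choose s hs hs' using hs
  let L : ∀ n, {N : Submodule R (E n) // (F n).H₀ N} := fun n =>
    Int.inductionOn' (motive := fun n => {N : Submodule R (E n) // (F n).H₀ N}) n m ⟨L₀, hL₀⟩
      (fun k _ N => ⟨s k N.1 N.2, hs k N.1 N.2⟩) (fun k _ _ => ⟨⊥, (F (k - 1)).H₀_base⟩)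
  have hLm : L m = ⟨L₀, hL₀⟩ := Int.inductionOn'_self
  have hLs : ∀ n, m ≤ n → L (n + 1) = ⟨s n (L n).1 (L n).2, hs n (L n).1 (L n).2⟩ :=
    fun n hn => Int.inductionOn'_add_one hn
  have hLp : ∀ n, n < m → (L n).1 = ⊥ := by
    intro n hn
    obtain ⟨k, rfl⟩ : ∃ k, n = k - 1 := ⟨n + 1, by omega⟩
    have : L (k - 1) = ⟨⊥, (F (k - 1)).H₀_base⟩ := Int.inductionOn'_sub_one (by omega)
    rw [this]
  refine ⟨fun n => (L n).1, fun n => (L n).2, fun n y hy => ?_, ?_⟩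
  · change _ ∈ (L (n + 1)).1
    change _ ∈ (L n).1 at hy
    by_cases hn : m ≤ n
    · rw [hLs n hn]
      exact hs' n _ _ (Submodule.mem_map_of_mem hy)
    · rw [hLp n (by omega), Submodule.mem_bot] at hy
      rw [hy, map_zero]
      exact zero_mem _
  · change _ ∈ (L m).1
    rw [hLm]
    exact hx (Submodule.mem_span_singleton_self x)

lemma IsPartialHomotopy.exists_extension (hS : IsResolvingFP_s1 S)
    (F : ∀ n, HillFamily S (⊥ : Submodule R (E n))) (hE : ∀ n x, dE (n + 1) (dE n x) = 0)
    (hYB : ∀ n, IsB S (Y n)) (hY : PureAcyclic dY) (hYY : ∀ n x, dY (n + 1) (dY n x) = 0)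
    (hf : ∀ n x, dY (n + 1) (f n x) = f (n + 1) (dE n x)) {h : ∀ n, E n →ₗ.[R] Y n}
    (hh : IsPartialHomotopy dE dY f h) (hH : ∀ n, (F n).H (h n).domain)
    {L : ∀ n, Submodule R (E n)} (hL : ∀ n, (F n).H₀ (L n))
    (hdL : ∀ n y, y ∈ L n → dE n y ∈ L (n + 1)) :
    ∃ h' : ∀ n, E n →ₗ.[R] Y n, h ≤ h' ∧ IsPartialHomotopy dE dY f h' ∧
      ∀ n, (h' n).domain = (h n).domain ⊔ L n := by
  choose e he hdom using fun n => (F n).exists_extension hS (hYB n) (h n) (hH n) (hL n)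
  let T : ∀ n, Submodule R (E n) := fun n => (e n).domain
  let U : ∀ n, Submodule R (T n) := fun n => (h n).domain.submoduleOf (T n)
  have hdT : ∀ n x, x ∈ T n → dE n x ∈ T (n + 1) := by
    intro n x hx
    change x ∈ (e n).domain at hx
    change _ ∈ (e (n + 1)).domain
    rw [hdom] at hx ⊢
    obtain ⟨a, ha, b, hb, rfl⟩ := Submodule.mem_sup.1 hx
    rw [map_add]
    exact add_mem (Submodule.mem_sup_left (hh.map_mem n a ha))
      (Submodule.mem_sup_right (hdL n b hb))
  let dT : ∀ n, T n →ₗ[R] T (n + 1) := fun n => (dE n).restrict (hdT n)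
  let P : ℤ → Type u := fun n => T n ⧸ U n
  have hP : ∀ n, Module.FinitePresentation R (P n) := by
    intro n
    have := (F n).quot_mem _ _ (hH n) (hL n)
    rw [← hdom n] at this
    exact hS.finitePresentation this
  let dP : ∀ n, P n →ₗ[R] P (n + 1) := fun n =>
    (U n).mapQ (U (n + 1)) (dT n) fun x hx => hh.map_mem n x hx
  have hmk : ∀ n, Function.Surjective (U n).mkQ := fun n => Submodule.mkQ_surjective _
  have hdP : ∀ n x, dP (n + 1) (dP n x) = 0 := by
    intro n x
    obtain ⟨x, rfl⟩ := hmk n x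
    change (U (n + 1 + 1)).mkQ (dT (n + 1) (dT n x)) = 0
    have : dT (n + 1) (dT n x) = 0 := Subtype.ext (hE n x)
    rw [this, map_zero]
  have hg : ∀ n, ∃ g : P n →ₗ[R] Y (n + 1), ∀ x : T n,
      g ((U n).mkQ x) = f n x - dY n (e n x) - e (n + 1) (dT n x) := by
    intro n
    refine exists_factor_s1 (U n).mkQ (hmk n)
      (f n ∘ₗ (T n).subtype - dY n ∘ₗ (e n).toFun - (e (n + 1)).toFun ∘ₗ dT n) ?_
    intro x hx
    have hx' : (x : E n) ∈ (h n).domain := (Submodule.Quotient.mk_eq_zero (U n)).1 hx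
    have h1 := (he n).2 (x := ⟨x, hx'⟩) (y := x) rfl
    have h2 := (he (n + 1)).2 (x := ⟨dE n x, hh.map_mem n x hx'⟩) (y := dT n x) rfl
    change f n x - dY n (e n x) - e (n + 1) (dT n x) = 0
    rw [← h1, ← h2, hh.eq n ⟨x, hx'⟩ ⟨dE n x, hh.map_mem n x hx'⟩ rfl]
    abel
  choose g hg using hg
  obtain ⟨k, hk⟩ := hY.exists_homotopy_of_fp hYY hP dP hdP g (by
    intro n x
    obtain ⟨x, rfl⟩ := hmk n x
    change _ = g (n + 1) ((U (n + 1)).mkQ (dT n x))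
    have h0 : dT (n + 1) (dT n x) = 0 := Subtype.ext (hE n x)
    rw [hg, hg, h0, map_sub, map_sub, hYY, hf, LinearPMap.map_zero]
    change _ = f (n + 1) (dE n x) - _ - _
    abel)
  refine ⟨fun n => ⟨T n, (e n).toFun + k n ∘ₗ (U n).mkQ⟩, fun n => ⟨(he n).1, ?_⟩, ⟨hdT, ?_⟩, hdom⟩
  · intro x y hxy
    have h1 := (he n).2 (x := x) (y := y) hxy
    have h0 : (U n).mkQ y = 0 := (Submodule.Quotient.mk_eq_zero _).2 (by
      change (y : E n) ∈ (h n).domain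
      rw [← hxy]
      exact x.2)
    change h n x = e n y + k n ((U n).mkQ y)
    rw [h1, h0, map_zero, add_zero]
  · intro n x y hxy
    obtain rfl : y = dT n x := Subtype.ext hxy
    have := hk n ((U n).mkQ x)
    rw [hg] at this
    change _ = dY n (e n x + k n ((U n).mkQ x)) +
      (e (n + 1) (dT n x) + k (n + 1) (dP n ((U n).mkQ x)))
    rw [map_add]
    rw [sub_sub, sub_eq_iff_eq_add] at this
    rw [this]
    abel

/-- Chain maps (of degree one) from a complex of modules filtered by `S` to a pure acyclic complex
with terms in `S^{⊥₁}` are null-homotopic. -/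
theorem exists_homotopy (hS : IsResolvingFP_s1 S)
    (F : ∀ n, HillFamily S (⊥ : Submodule R (E n))) (hE : ∀ n x, dE (n + 1) (dE n x) = 0)
    (hYB : ∀ n, IsB S (Y n)) (hY : PureAcyclic dY) (hYY : ∀ n x, dY (n + 1) (dY n x) = 0)
    (hf : ∀ n x, dY (n + 1) (f n x) = f (n + 1) (dE n x)) :
    ∃ h : ∀ n, E n →ₗ[R] Y n, ∀ n x, f n x = dY n (h n x) + h (n + 1) (dE n x) := by
  obtain ⟨m, -, hm⟩ := zorn_le_nonempty₀
    {h : ∀ n, E n →ₗ.[R] Y n | IsPartialHomotopy dE dY f h ∧ ∀ n, (F n).H (h n).domain}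
    (fun c hcs hc y hy => by
      refine ⟨_, ⟨IsPartialHomotopy.sSup hc ⟨y, hy⟩ fun z hz => (hcs hz).1, fun n => ?_⟩,
        fun z hz n => LinearPMap.le_sSup (directedOn_image_eval hc n) ⟨z, hz, rfl⟩⟩
      change (F n).H (sSup (LinearPMap.domain '' _))
      refine (F n).sSup_mem_of_nonempty ⟨_, _, ⟨y, hy, rfl⟩, rfl⟩ ?_
      rintro _ ⟨_, ⟨z, hz, rfl⟩, rfl⟩
      exact (hcs hz).2 n) (fun n => ⟨⊥, 0⟩) ⟨⟨fun n x hx => by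
        rw [(Submodule.mem_bot R).1 hx, map_zero]
        exact zero_mem _, fun n x y hxy => by
        have hx : x = 0 := Subtype.ext ((Submodule.mem_bot R).1 x.2)
        have hy : y = 0 := Subtype.ext ((Submodule.mem_bot R).1 y.2)
        subst hx hy
        rw [LinearPMap.map_zero, LinearPMap.map_zero]
        simp⟩, fun n => (F n).bot_mem⟩
  have htop : ∀ n x, x ∈ (m n).domain := by
    intro n x
    obtain ⟨L, hL, hdL, hx⟩ := exists_subcomplex (dE := dE) F n x
    obtain ⟨m', hle, hm', hdom⟩ :=
      hm.1.1.exists_extension hS F hE hYB hY hYY hf hm.1.2 hL hdL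
    have hle' := (hm.2 ⟨hm', fun i => by
      rw [hdom]
      exact (F i).sup_mem (hm.1.2 i) ((F i).H_of_H₀ _ (hL i))⟩ hle n).1
    rw [hdom] at hle'
    exact hle' (Submodule.mem_sup_right hx)
  refine ⟨fun n => (m n).toFun ∘ₗ LinearMap.codRestrict (m n).domain LinearMap.id (htop n),
    fun n x => ?_⟩
  exact hm.1.1.eq n ⟨x, htop n x⟩ ⟨dE n x, htop _ _⟩ rfl

end Homotopy

variable (M) in
lemma exists_injective_embedding : ∃ (I : Type u) (_ : AddCommGroup I) (_ : Module R I)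
    (j : M →ₗ[R] I), Function.Injective j ∧ Module.Injective R I := by
  obtain ⟨⟨I, hI, j, hj⟩⟩ := EnoughInjectives.presentation (ModuleCat.of R M)
  exact ⟨I, inferInstance, inferInstance, j.hom, (ModuleCat.mono_iff_injective j).1 hj,
    Module.injective_module_of_injective_object R I⟩

lemma IsB.middle {i : M →ₗ[R] N} {π : N →ₗ[R] P} (hi : Function.Injective i)
    (hπ : Function.Surjective π) (hex : Function.Exact i π) (hM : IsB S M) (hP : IsB S P) :
    IsB S N := by
  intro n K hK g
  obtain ⟨e, he⟩ := hP n K hK (π ∘ₗ g)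
  obtain ⟨e', he'⟩ := exists_lift_pi π hπ e
  obtain ⟨r, hr⟩ := exists_lift_of_injective i hi (g - e' ∘ₗ K.subtype) fun k => (hex _).1 (by
    simp [he', he])
  obtain ⟨r', hr'⟩ := hM n K hK r
  refine ⟨e' + i ∘ₗ r', fun k => ?_⟩
  simp [hr', hr]

lemma IsB.of_injective (hS : IsResolvingFP_s1 S) {i : M →ₗ[R] N} {π : N →ₗ[R] P}
    (hi : Function.Injective i) (hπ : Function.Surjective π) (hex : Function.Exact i π)
    (hM : IsB S M) (hN : Module.Injective R N) : IsB S P := by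
  intro n K hK g
  have hKS : Mem S K := hS.mem_left (f := K.subtype) (g := K.mkQ) K.injective_subtype
    K.mkQ_surjective (LinearMap.exact_subtype_mkQ K) (hS.mem_pi n) hK
  obtain ⟨l, hl⟩ := hM.lift hS hi hπ hex hKS g
  obtain ⟨e, he⟩ := hN.out K.subtype K.injective_subtype l
  refine ⟨π ∘ₗ e, fun k => ?_⟩
  rw [LinearMap.comp_apply, ← hl, ← he]
  rfl

section Embedding

variable {X : ℤ → Type u} [∀ n, AddCommGroup (X n)] [∀ n, Module R (X n)]

/-- An acyclic complex whose cocycles are locally in `S` embeds into a pure acyclic complex with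
terms in `S^{⊥₁}`, in such a way that the maps on cocycles are preenvelopes. -/
theorem exists_pureAcyclic_embedding (hS : IsResolvingFP_s1 S) (d : ∀ n, X n →ₗ[R] X (n + 1))
    (hdd : ∀ n x, d (n + 1) (d n x) = 0) (hd : ∀ n x, d (n + 1) x = 0 → ∃ y, d n y = x)
    (hZ : ∀ n, FactorsFP S (LinearMap.ker (d n))) :
    ∃ (B : ℤ → Type u) (_ : ∀ n, AddCommGroup (B n)) (_ : ∀ n, Module R (B n))
      (f : ∀ n, LinearMap.ker (d n) →ₗ[R] B n)
      (Y : ℤ → Type u) (_ : ∀ n, AddCommGroup (Y n)) (_ : ∀ n, Module R (Y n))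
      (dY : ∀ n, Y n →ₗ[R] Y (n + 1)) (φ : ∀ n, X n →ₗ[R] Y n) (π : ∀ n, Y n →ₗ[R] B (n + 1)),
      (∀ n (N : Type u) [AddCommGroup N] [Module R N], IsB S N →
        ∀ g : LinearMap.ker (d n) →ₗ[R] N, ∃ e : B n →ₗ[R] N, ∀ x, e (f n x) = g x) ∧
      (∀ n, IsB S (Y n)) ∧ PureAcyclic dY ∧ (∀ n x, dY (n + 1) (dY n x) = 0) ∧
      (∀ n x, dY n (φ n x) = φ (n + 1) (d n x)) ∧
      ∀ n (x : LinearMap.ker (d (n + 1))) (y : Y n), φ (n + 1) x = dY n y →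
        f (n + 1) x = π n y := by
  choose B iB mB f hf hBB hBF hBe using fun n => exists_preenvelope (LinearMap.ker (d n)) hS
  choose I iI mI j hj hI using fun n => exists_injective_embedding (R := R) (B n)
  let dz : ∀ n, X n →ₗ[R] LinearMap.ker (d (n + 1)) := fun n =>
    (d n).codRestrict _ fun x => hdd n x
  have hdz : ∀ n, Function.Surjective (dz n) := by
    intro n x
    obtain ⟨y, hy⟩ := hd n x x.2
    exact ⟨y, Subtype.ext hy⟩
  choose a ha using fun n =>
    (hI n).out (LinearMap.ker (d n)).subtype (Submodule.injective_subtype _) (j n ∘ₗ f n)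
  let q := fun n => (LinearMap.range (j n)).mkQ
  have hq : ∀ n, Function.Surjective (q n) := fun n => Submodule.mkQ_surjective _
  have hjq : ∀ n, Function.Exact (j n) (q n) := fun n => LinearMap.exact_map_mkQ_range (j n)
  have hD : ∀ n, IsB S (I n ⧸ LinearMap.range (j n)) := fun n =>
    IsB.of_injective hS (hj n) (hq n) (hjq n) (hBB n) (hI n)
  have hb : ∀ n, ∃ b : B (n + 1) →ₗ[R] I n ⧸ LinearMap.range (j n),
      ∀ x, b (f (n + 1) (dz n x)) = q n (a n x) := by
    intro n
    obtain ⟨r, hr⟩ := exists_factor_s1 (dz n) (hdz n) (q n ∘ₗ a n) (by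
      intro x hx
      have hx' : d n x = 0 := congrArg Subtype.val hx
      exact (hjq n _).2 ⟨f n ⟨x, hx'⟩, (ha n ⟨x, hx'⟩).symm⟩)
    obtain ⟨e, he⟩ := hBe (n + 1) _ (hD n) r
    exact ⟨e, fun x => by rw [he, hr]; rfl⟩
  choose b hb using hb
  let Y : ∀ n, Submodule R (I n × B (n + 1)) := fun n =>
    LinearMap.ker ((q n).coprod (-b n))
  have hY : ∀ n y, y ∈ Y n ↔ q n y.1 = b n y.2 := fun n y => by
    rw [LinearMap.mem_ker, LinearMap.coprod_apply, LinearMap.neg_apply, ← sub_eq_add_neg,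
      sub_eq_zero]
  let π : ∀ n, Y n →ₗ[R] B (n + 1) := fun n => LinearMap.snd R _ _ ∘ₗ (Y n).subtype
  let κ : ∀ n, B n →ₗ[R] Y n := fun n =>
    (LinearMap.inl R _ _ ∘ₗ j n).codRestrict (Y n) fun x => (hY _ _).2 (by
      simpa using (hjq n _).2 ⟨x, rfl⟩)
  have hκ : ∀ n x, (κ n x : I n × B (n + 1)) = (j n x, 0) := fun _ _ => rfl
  have hπ' : ∀ n (x : Y n), π n x = x.1.2 := fun _ _ => rfl
  have hκi : ∀ n, Function.Injective (κ n) := fun n x y h => hj n (by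
    have := congrArg (fun z : Y n => z.1.1) h
    exact this)
  have hπ : ∀ n, Function.Surjective (π n) := by
    intro n x
    obtain ⟨y, hy⟩ := hq n (b n x)
    exact ⟨⟨(y, x), (hY _ _).2 hy⟩, rfl⟩
  have hex : ∀ n, Function.Exact (κ n) (π n) := by
    intro n y
    constructor
    · intro hy
      have hy' : y.1.2 = 0 := hy
      have := (hY n y).1 y.2
      rw [hy', map_zero] at this
      obtain ⟨x, hx⟩ := (hjq n _).1 this
      exact ⟨x, Subtype.ext (Prod.ext hx hy'.symm)⟩
    · rintro ⟨x, rfl⟩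
      rfl
  let dY : ∀ n, Y n →ₗ[R] Y (n + 1) := fun n => κ (n + 1) ∘ₗ π n
  refine ⟨B, iB, mB, f, fun n => Y n, inferInstance, inferInstance, dY, fun n =>
    ((a n).prod (f (n + 1) ∘ₗ dz n)).codRestrict (Y n) fun x => (hY _ _).2 (hb n x).symm, π,
    hBe, fun n => IsB.middle (hκi n) (hπ n) (hex n) (hBB n) (hBB (n + 1)), ?_, ?_, ?_, ?_⟩
  · intro m W _ _ hW w hw
    obtain ⟨w', hw'⟩ := exists_lift_of_injective (κ (m + 1)) (hκi _) w fun x =>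
      (hex _ _).1 (hκi _ ((hw x).trans (map_zero _).symm))
    obtain ⟨l, hl⟩ := (hBF (m + 1) (hZ (m + 1))).lift hS (hBB m) (hκi m) (hπ m) (hex m) hW w'
    exact ⟨l, fun x => by rw [← hw', ← hl]; rfl⟩
  · intro n x
    change κ (n + 1 + 1) (π (n + 1) (κ (n + 1) (π n x))) = 0
    rw [(hex (n + 1)).apply_apply_eq_zero, map_zero]
  · intro n x
    refine Subtype.ext (Prod.ext ?_ ?_)
    · exact (ha (n + 1) (dz n x)).symm
    · change 0 = f (n + 1 + 1) (dz (n + 1) (d n x))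
      have : dz (n + 1) (d n x) = 0 := Subtype.ext (hdd n x)
      rw [this, map_zero]
  · intro n x y hxy
    have h1 := congrArg (fun z : Y (n + 1) => z.1.1) hxy
    exact hj (n + 1) ((ha (n + 1) x).symm.trans h1)

end Embedding

lemma IsB.congr (e : M ≃ₗ[R] N) (hM : IsB S M) : IsB S N := by
  intro n K hK g
  obtain ⟨r, hr⟩ := hM n K hK (e.symm.toLinearMap ∘ₗ g)
  exact ⟨e.toLinearMap ∘ₗ r, fun k => by simp [hr]⟩

lemma IsB.ker_of_exact {i : M →ₗ[R] N} {π : N →ₗ[R] P} (hM : IsB S M)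
    (hi : Function.Injective i) (hex : Function.Exact i π) : IsB S (LinearMap.ker π) := by
  rw [hex.linearMap_ker_eq]
  exact hM.congr (LinearEquiv.ofInjective i hi)

section Cocycles

variable {X : ℤ → Type u} [∀ n, AddCommGroup (X n)] [∀ n, Module R (X n)]
  {d : ∀ n, X n →ₗ[R] X (n + 1)}

/-- Maps from the cocycles to modules in `S^{⊥₁}` extend to the terms of the complex. -/
theorem exists_extension_of_cocycles (hS : IsResolvingFP_s1 S)
    (hdd : ∀ n x, d (n + 1) (d n x) = 0) (hd : ∀ n x, d (n + 1) x = 0 → ∃ y, d n y = x)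
    (hZ : ∀ n, FactorsFP S (LinearMap.ker (d n)))
    (hX : ∀ n, Mem (leftPerp (rightPerp S)) (X n)) (n : ℤ) (hN : IsB S N)
    (g : LinearMap.ker (d (n + 1)) →ₗ[R] N) : ∃ e : X (n + 1) →ₗ[R] N, ∀ x, e x.1 = g x := by
  obtain ⟨B, _, _, f, Y, _, _, dY, φ, π, hext, hYB, hY, hYY, hφ, hfπ⟩ :=
    exists_pureAcyclic_embedding hS d hdd hd hZ
  choose E iE mE p hp hpB hF using fun n => exists_precover (X (n + 1)) hS
  choose i hi using fun n => exists_lift_of_mem_leftPerp_s1 hS (hX (n + 1)) (p n) (hp n) (hpB n)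
    LinearMap.id
  simp only [LinearMap.id_apply] at hi
  obtain ⟨h, hh⟩ := exists_homotopy (dE := fun n => i (n + 1) ∘ₗ d (n + 1) ∘ₗ p n) (dY := dY)
    (f := fun n => φ (n + 1) ∘ₗ p n) hS (fun n => (hF n).some) (by simp [hi, hdd]) hYB hY hYY
    (by simp [hi, hφ])
  obtain ⟨g', hg'⟩ := hext (n + 1) N hN g
  refine ⟨g' ∘ₗ π n ∘ₗ h n ∘ₗ i n, fun x => ?_⟩
  have := hh n (i n x)
  have hx : d (n + 1) x.1 = 0 := x.2
  simp only [LinearMap.comp_apply, hi, hx, map_zero, add_zero] at this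
  rw [← hg', hfπ n x _ this]
  rfl

theorem cocycles_mem_leftPerp (hS : IsResolvingFP_s1 S)
    (hdd : ∀ n x, d (n + 1) (d n x) = 0) (hd : ∀ n x, d (n + 1) x = 0 → ∃ y, d n y = x)
    (hZ : ∀ n, FactorsFP S (LinearMap.ker (d n)))
    (hX : ∀ n, Mem (leftPerp (rightPerp S)) (X n)) (n : ℤ) :
    Mem (leftPerp (rightPerp S)) (LinearMap.ker (d (n + 1 + 1))) := by
  intro N hN E i p w hsh
  have hNB : IsB S N := IsB.of_mem_rightPerp hN
  have hi : Function.Injective i.hom := hsh.moduleCat_injective_f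
  have hp : Function.Surjective p.hom := hsh.moduleCat_surjective_g
  have hex : Function.Exact i.hom p.hom :=
    (ShortComplex.ShortExact.moduleCat_exact_iff_function_exact _).1 hsh.exact
  let δ : X (n + 1) →ₗ[R] LinearMap.ker (d (n + 1 + 1)) :=
    (d (n + 1)).codRestrict _ fun x => hdd _ x
  have hδ : Function.Surjective δ := by
    intro x
    obtain ⟨y, hy⟩ := hd _ x.1 x.2
    exact ⟨y, Subtype.ext hy⟩
  have hδ0 : ∀ x, δ x = 0 ↔ d (n + 1) x = 0 := fun x => Subtype.ext_iff
  obtain ⟨l, hl⟩ := exists_lift_of_mem_leftPerp_s1 hS (hX (n + 1)) p.hom hp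
    (hNB.ker_of_exact hi hex) δ
  obtain ⟨g, hg⟩ := exists_lift_of_injective i.hom hi
    (l ∘ₗ (LinearMap.ker (d (n + 1))).subtype) fun x => (hex _).1 (by
      rw [LinearMap.comp_apply, hl, hδ0]
      exact x.2)
  obtain ⟨e, he⟩ := exists_extension_of_cocycles hS hdd hd hZ hX n hNB g
  obtain ⟨s, hs⟩ := exists_factor_s1 δ hδ (l - i.hom ∘ₗ e) (by
    intro x hx
    have hx' := (hδ0 x).1 hx
    have h1 := he ⟨x, hx'⟩
    have h2 := hg ⟨x, hx'⟩
    rw [LinearMap.sub_apply, LinearMap.comp_apply, h1, h2]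
    exact sub_self _)
  refine ⟨ModuleCat.ofHom s, ?_⟩
  refine ModuleCat.hom_ext (LinearMap.ext fun x => ?_)
  obtain ⟨x, rfl⟩ := hδ x
  change p.hom (s (δ x)) = δ x
  rw [hs, LinearMap.sub_apply, map_sub, hl, LinearMap.comp_apply, hex.apply_apply_eq_zero, sub_zero]

end Cocycles

lemma Ext1Zero.of_iso {X X' Y : ModuleCat.{u} R} (e : X ≅ X') (h : Ext1Zero X Y) :
    Ext1Zero X' Y := by
  intro E i p w hsh
  obtain ⟨s, hs⟩ := h E i (p ≫ e.inv) (by rw [reassoc_of% w, zero_comp]) (by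
    refine ShortComplex.shortExact_of_iso (S₁ := ShortComplex.mk i p w)
      (ShortComplex.isoMk (Iso.refl _) (Iso.refl _) e.symm ?_ ?_) hsh <;> simp)
  refine ⟨e.inv ≫ s, ?_⟩
  rw [Category.assoc, Iso.inv_comp_eq, Category.comp_id, ← cancel_mono e.inv, Category.assoc, hs,
    e.hom_inv_id]

/-- Maps from finitely presented modules to direct limits of modules in `S` factor through
modules in `S`. -/
theorem factorsFP_of_directSystemTo {M : ModuleCat.{u} R} (D : DirectSystemTo S M) :
    FactorsFP S M := by
  obtain ⟨I, dir, ne, F, mem, c, hc, iso⟩ := D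
  have : IsFiltered I := inferInstance
  suffices FactorsFP S c.pt from this.congr iso.toLinearEquiv
  intro W _ _ hW w
  obtain ⟨n, p, hp⟩ := exists_fin_cover (R := R) (M := W)
  have hmap : ∀ {i j : I} (h : i ⟶ j) (x : F.obj i), (c.ι.app j).hom ((F.map h).hom x) =
      (c.ι.app i).hom x := fun h x => LinearMap.congr_fun (congrArg ModuleCat.Hom.hom (c.w h)) x
  choose k y hy using fun a : Fin n =>
    Concrete.isColimit_exists_rep F hc (w (p (Pi.basisFun R (Fin n) a)))
  obtain ⟨i, hi⟩ := Finite.exists_le k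
  let t : (Fin n → R) →ₗ[R] F.obj i :=
    (Pi.basisFun R (Fin n)).constr ℕ fun a => (F.map (homOfLE (hi a))).hom (y a)
  have ht : (c.ι.app i).hom ∘ₗ t = w ∘ₗ p := (Pi.basisFun R (Fin n)).ext fun a => by
    rw [LinearMap.comp_apply, Module.Basis.constr_basis, hmap]
    exact hy a
  obtain ⟨s, hs⟩ := Module.FinitePresentation.fg_ker p hp
  have hrel : ∀ r : s, ∃ (j : I) (h : i ⟶ j), (F.map h).hom (t r) = 0 := by
    intro r
    have hr : p r = 0 := by
      rw [← LinearMap.mem_ker, ← hs]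
      exact Submodule.subset_span r.2
    obtain ⟨j, f, g, hfg⟩ := Concrete.isColimit_exists_of_rep_eq F hc (t r) (0 : F.obj i) (by
      have := LinearMap.congr_fun ht r
      rw [LinearMap.comp_apply, LinearMap.comp_apply, hr, map_zero] at this
      exact this.trans (map_zero _).symm)
    exact ⟨j, f, hfg.trans (map_zero _)⟩
  choose j f hf using hrel
  obtain ⟨m, hm⟩ := Finite.exists_le (fun o : Option s => o.elim i j)
  have him : i ≤ m := hm none
  obtain ⟨a, ha⟩ := exists_factor_s1 p hp ((F.map (homOfLE him)).hom ∘ₗ t) (by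
    have : LinearMap.ker p ≤ LinearMap.ker ((F.map (homOfLE him)).hom ∘ₗ t) := by
      rw [← hs, Submodule.span_le]
      intro r hr
      have hjm : j ⟨r, hr⟩ ≤ m := hm (some ⟨r, hr⟩)
      change (F.map (homOfLE him)).hom (t r) = 0
      rw [show homOfLE him = f ⟨r, hr⟩ ≫ homOfLE hjm from rfl, F.map_comp, ModuleCat.hom_comp,
        LinearMap.comp_apply, hf, map_zero]
    exact fun x hx => this hx)
  refine ⟨F.obj m, mem m, a, (c.ι.app m).hom, fun x => ?_⟩
  obtain ⟨x, rfl⟩ := hp x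
  rw [ha, LinearMap.comp_apply, hmap]
  exact LinearMap.congr_fun ht x

end Modules

theorem statement1 {R : Type u} [Ring R] (S : Set (ModuleCat.{u} Rᵐᵒᵖ))
    (hfp : ∀ M ∈ S, Module.FinitePresentation Rᵐᵒᵖ M)
    (hfree : ModuleCat.of Rᵐᵒᵖ Rᵐᵒᵖ ∈ S)
    (hext : ClosedUnderExtensions S)
    (hker : ClosedUnderKernelsOfEpis S)
    (B A C : Set (ModuleCat.{u} Rᵐᵒᵖ))
    (hB : B = rightPerp S) (hA : A = leftPerp B) (hC : C = limClosure S)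
    (X : CochainComplex (ModuleCat.{u} Rᵐᵒᵖ) ℤ)
    (hacyclic : IsAcyclic X)
    (hterms : ∀ n : ℤ, X.X n ∈ A)
    (hcocycles : ∀ n : ℤ, kernel (X.d n (n + 1)) ∈ C) :
    ∀ n : ℤ, kernel (X.d n (n + 1)) ∈ A := by
  subst hB hA hC
  have hS : IsResolvingFP_s1 S := ⟨hfp, hfree, hext, hker⟩
  have hdd : ∀ n x, (X.d (n + 1) (n + 1 + 1)).hom ((X.d n (n + 1)).hom x) = 0 := fun n x =>
    LinearMap.congr_fun (congrArg ModuleCat.Hom.hom (X.d_comp_d n (n + 1) (n + 1 + 1))) x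
  have hd : ∀ n x, (X.d (n + 1) (n + 1 + 1)).hom x = 0 → ∃ y, (X.d n (n + 1)).hom y = x := by
    intro n
    have := (X.exactAt_iff' n (n + 1) (n + 1 + 1) (by simp) (by simp)).1 (hacyclic (n + 1))
    exact (ShortComplex.moduleCat_exact_iff _).1 this
  have hZ : ∀ n, FactorsFP S (LinearMap.ker (X.d n (n + 1)).hom) := by
    intro n
    obtain ⟨D⟩ := hcocycles n
    exact (factorsFP_of_directSystemTo D).congr
      (ModuleCat.kernelIsoKer (X.d n (n + 1))).toLinearEquiv
  have key := cocycles_mem_leftPerp (d := fun n => (X.d n (n + 1)).hom) hS hdd hd hZ hterms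
  intro n Y hY
  obtain ⟨m, rfl⟩ : ∃ m, n = m + 1 + 1 := ⟨n - 2, by omega⟩
  exact Ext1Zero.of_iso (ModuleCat.kernelIsoKer (X.d (m + 1 + 1) (m + 1 + 1 + 1))).symm
    (key m Y hY)

end GenPeriodicity
end
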